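/- There is a constant C such that for every n, any connected undirected graph on at most n vertices can be explored by a set of at most C·log log n collaborating agents, each having at most C states (constant memory each), within at most n^C steps; the agents do not require n as input and terminate at the starting vertex after exploring the graph. -/

import Mathlib

noncomputable section
open scoped Classical

/-- An undirected graph with locally labeled ports: vertex `v` has degree `deg v`,
and for a port `i < deg v`, `nbr v i` is the other endpoint of the edge with port
number `i` at `v`, while `back v i` is the port number of this edge at the other
endpoint. -/
structure PGraph (V : Type) where
  deg : V → ℕ
  nbr : V → ℕ → V
  back : V → ℕ → ℕ

namespace PGraph

variable {V : Type}

/-- Well-formedness: positive degrees, ports of an edge match up at both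
endpoints, no self-loops and no parallel edges. -/
def Wf (G : PGraph V) : Prop :=
  (∀ v, 0 < G.deg v) ∧
  (∀ v i, i < G.deg v → G.back v i < G.deg (G.nbr v i)) ∧
  (∀ v i, i < G.deg v → G.nbr (G.nbr v i) (G.back v i) = v) ∧
  (∀ v i, i < G.deg v → G.back (G.nbr v i) (G.back v i) = i) ∧
  (∀ v i, i < G.deg v → G.nbr v i ≠ v) ∧
  (∀ v, Set.InjOn (G.nbr v) (Set.Iio (G.deg v)))

/-- Connectivity of a port-labeled graph. -/
def Conn (G : PGraph V) : Prop :=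
  ∀ a b : V, Relation.ReflTransGen (fun x y => ∃ i, i < G.deg x ∧ G.nbr x i = y) a b

end PGraph

/-- A system of `k` collaborating agents, agent `i` having `sz i` states.  The
transition function of agent `i` maps (its state, the vector of states of the
agents sharing its current vertex (`none` for agents located elsewhere), the
degree of the current vertex, the port number of the edge it entered through)
to (new state, move (`none` = stay)). -/
structure MAgentSys (k : ℕ) (sz : Fin k → ℕ) where
  start : ∀ i, Fin (sz i)
  halt : ∀ i, Finset (Fin (sz i))
  trans : ∀ i, Fin (sz i) → (∀ j, Option (Fin (sz j))) → ℕ → ℕ → Fin (sz i) × Option ℕ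

/-- A configuration of a system of collaborating agents. -/
structure MConfig (V : Type) (k : ℕ) (sz : Fin k → ℕ) where
  st : ∀ i, Fin (sz i)
  pos : Fin k → V
  lab : Fin k → ℕ

variable {V : Type} {k : ℕ} {sz : Fin k → ℕ}

/-- The states visible to agent `i`: the states of the other agents sharing its
current vertex. -/
def mVis (c : MConfig V k sz) (i : Fin k) : ∀ j, Option (Fin (sz j)) := fun j =>
  if j = i then none else if c.pos j = c.pos i then some (c.st j) else none

def mOut (A : MAgentSys k sz) (G : PGraph V) (c : MConfig V k sz) (i : Fin k) :
    Fin (sz i) × Option ℕ :=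
  A.trans i (c.st i) (mVis c i) (G.deg (c.pos i)) (c.lab i)

/-- One synchronous step of the system; halted agents stay put. -/
def mStep (A : MAgentSys k sz) (G : PGraph V) (c : MConfig V k sz) : MConfig V k sz where
  st := fun i => if c.st i ∈ A.halt i then c.st i else (mOut A G c i).1
  pos := fun i =>
    if c.st i ∈ A.halt i then c.pos i
    else
      (match (mOut A G c i).2 with
      | none => c.pos i
      | some l => if l < G.deg (c.pos i) then G.nbr (c.pos i) l else c.pos i)
  lab := fun i =>
    if c.st i ∈ A.halt i then c.lab i
    else
      (match (mOut A G c i).2 with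
      | none => c.lab i
      | some l => if l < G.deg (c.pos i) then G.back (c.pos i) l else c.lab i)

/-- The run of the system, with all agents starting at `v0`. -/
def mRun (A : MAgentSys k sz) (G : PGraph V) (v0 : V) (t : ℕ) : MConfig V k sz :=
  (mStep A G)^[t] ⟨fun i => A.start i, fun _ => v0, fun _ => 0⟩

/-- Number of edge traversals performed by agent `i` during the first `N` steps. -/
def mTrav (A : MAgentSys k sz) (G : PGraph V) (v0 : V) (i : Fin k) (N : ℕ) : ℕ :=
  ((Finset.range N).filter
    (fun t => (mRun A G v0 (t + 1)).pos i ≠ (mRun A G v0 t).pos i)).card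

/-- The Euclidean norm of a real function on a finite type. -/
def l2 {X : Type*} [Fintype X] (f : X → ℝ) : ℝ := Real.sqrt (∑ x, f x ^ 2)

section L2
variable {X : Type*} [Fintype X]

lemma l2_eq_norm (f : X → ℝ) : l2 f = ‖(WithLp.toLp 2 f : EuclideanSpace ℝ X)‖ := by
  simp [l2, EuclideanSpace.norm_eq]

lemma l2_nonneg (f : X → ℝ) : 0 ≤ l2 f := Real.sqrt_nonneg _

lemma l2_sq (f : X → ℝ) : l2 f ^ 2 = ∑ x, f x ^ 2 :=
  Real.sq_sqrt (Finset.sum_nonneg fun _ _ => sq_nonneg _)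

lemma l2_add_le (f g : X → ℝ) : l2 (f + g) ≤ l2 f + l2 g := by
  simp only [l2_eq_norm, WithLp.toLp_add]
  exact norm_add_le _ _

lemma l2_smul (c : ℝ) (f : X → ℝ) : l2 (c • f) = |c| * l2 f := by
  simp only [l2_eq_norm, WithLp.toLp_smul, norm_smul, Real.norm_eq_abs]

lemma l2_zero : l2 (0 : X → ℝ) = 0 := by simp [l2]

lemma l2_sum_le {ι : Type*} (s : Finset ι) (f : ι → X → ℝ) :
    l2 (∑ i ∈ s, f i) ≤ ∑ i ∈ s, l2 (f i) := by
  induction s using Finset.induction_on with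
  | empty => simp [l2_zero]
  | insert a s ha ih =>
    rw [Finset.sum_insert ha, Finset.sum_insert ha]
    exact (l2_add_le _ _).trans (by gcongr)

lemma abs_le_l2 (f : X → ℝ) (x : X) : |f x| ≤ l2 f := by
  apply Real.le_sqrt_of_sq_le
  rw [sq_abs]
  exact Finset.single_le_sum (f := fun x => f x ^ 2) (fun _ _ => sq_nonneg _) (Finset.mem_univ x)

lemma l2_comp_perm (f : X → ℝ) (σ : X → X) (h : Function.Bijective σ) :
    l2 (fun x => f (σ x)) = l2 f := by
  unfold l2
  rw [h.sum_comp (fun x => f x ^ 2)]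

lemma inner_le_l2 (f g : X → ℝ) : ∑ x, f x * g x ≤ l2 f * l2 g := by
  have := Finset.sum_mul_sq_le_sq_mul_sq Finset.univ f g
  refine le_of_sq_le_sq ?_ (mul_nonneg (l2_nonneg _) (l2_nonneg _))
  rw [mul_pow, l2_sq, l2_sq]
  exact this

end L2

/-- The averaging operator of a family of maps. -/
def avg {I X : Type*} [Fintype I] (σ : I → X → X) (f : X → ℝ) : X → ℝ :=
  fun x => (∑ i, f (σ i x)) / Fintype.card I

section Avg
variable {I X : Type*} [Fintype I]

lemma avg_eq_smul (σ : I → X → X) (f : X → ℝ) :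
    avg σ f = (Fintype.card I : ℝ)⁻¹ • ∑ i, fun x => f (σ i x) := by
  ext x
  simp [avg, div_eq_inv_mul]

lemma avg_add (σ : I → X → X) (f g : X → ℝ) : avg σ (f + g) = avg σ f + avg σ g := by
  ext x
  simp [avg, Finset.sum_add_distrib, add_div]

lemma avg_const [Nonempty I] (σ : I → X → X) (c : ℝ) : avg σ (fun _ => c) = fun _ => c := by
  ext x
  simp [avg]

variable [Fintype X]

lemma l2_avg_le (σ : I → X → X) (h : ∀ i, Function.Bijective (σ i)) (f : X → ℝ) :
    l2 (avg σ f) ≤ l2 f := by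
  rw [avg_eq_smul, l2_smul]
  have h1 : l2 (∑ i, fun x => f (σ i x)) ≤ Fintype.card I * l2 f := by
    refine (l2_sum_le _ _).trans ?_
    simp [fun i => l2_comp_perm f (σ i) (h i)]
  have h0 := l2_nonneg f
  rw [abs_of_nonneg (by positivity)]
  rcases Nat.eq_zero_or_pos (Fintype.card I) with h2 | h2
  · simp [h2, h0]
  · rw [inv_mul_le_iff₀ (by positivity)]
    exact h1

lemma sum_avg [Nonempty I] (σ : I → X → X) (h : ∀ i, Function.Bijective (σ i)) (f : X → ℝ) :
    ∑ x, avg σ f x = ∑ x, f x := by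
  unfold avg
  rw [← Finset.sum_div, Finset.sum_comm]
  simp [fun i => (h i).sum_comp f]

/-- `avg σ` contracts functions of sum zero by the factor `c`. -/
def Contr (σ : I → X → X) (c : ℝ) : Prop :=
  ∀ f : X → ℝ, ∑ x, f x = 0 → l2 (avg σ f) ≤ c * l2 f

lemma Contr.mono {σ : I → X → X} {c d : ℝ} (h : Contr σ c) (hcd : c ≤ d) : Contr σ d :=
  fun f hf => (h f hf).trans (mul_le_mul_of_nonneg_right hcd (l2_nonneg f))

end Avg

/-- The label group: eight coordinates over `ZMod p`, grouped in pairs. -/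
abbrev LGrp (p : ℕ) := Fin 4 → ZMod p × ZMod p

/-- The generators of the label group, indexed by pairs. -/
def lgen {p : ℕ} (s : ZMod p × ZMod p) : LGrp p :=
  fun i => (s.2 * s.1 ^ (2 * (i : ℕ)), s.2 * s.1 ^ (2 * (i : ℕ) + 1))

lemma iterate_avg_add {A S : Type*} [AddCommGroup A] [Fintype S] (g : S → A) (f : A → ℝ)
    (n : ℕ) (a : A) :
    (avg fun s a => a + g s)^[n] f a =
      (∑ w : Fin n → S, f (a + ∑ i, g (w i))) / (Fintype.card S : ℝ) ^ n := by
  induction n generalizing a with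
  | zero => simp
  | succ n ih =>
    rw [Function.iterate_succ_apply']
    simp only [avg, ih]
    rw [← (Fin.consEquiv fun _ => S).sum_comp, Fintype.sum_prod_type, pow_succ, ← Finset.sum_div,
      div_div]
    simp [Fin.consEquiv, Fin.sum_univ_succ, add_assoc]

section Expander
variable {p : ℕ} [Fact p.Prime]

lemma lgen_comb_bijective {x : Fin 8 → ZMod p} (hx : Function.Injective x) :
    Function.Bijective fun y : Fin 8 → ZMod p => ∑ i, lgen (x i, y i) := by
  rw [Fintype.bijective_iff_injective_and_card]
  constructor
  · intro y z h
    have h0 : y - z = 0 := by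
      apply Matrix.eq_zero_of_forall_pow_sum_mul_pow_eq_zero hx
      intro j
      simp only [Pi.sub_apply, sub_mul, Finset.sum_sub_distrib, sub_eq_zero]
      have h1 : ∀ i : Fin 4, _ := fun i => congrFun h i
      simp only [Finset.sum_apply, lgen, Prod.ext_iff, Prod.fst_sum, Prod.snd_sum] at h1
      fin_cases j
      exacts [(h1 0).1, (h1 0).2, (h1 1).1, (h1 1).2, (h1 2).1, (h1 2).2, (h1 3).1, (h1 3).2]
    exact sub_eq_zero.1 h0
  · simp only [Fintype.card_fun, Fintype.card_fin, Fintype.card_prod, ZMod.card]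
    ring

lemma card_not_injective_le (hp : 8 ≤ p) :
    ((Finset.univ.filter fun x : Fin 8 → ZMod p => ¬ Function.Injective x).card : ℝ)
      ≤ 28 * (p : ℝ) ^ 7 := by
  have h1 := Finset.card_filter_add_card_filter_not (s := (Finset.univ : Finset (Fin 8 → ZMod p)))
    Function.Injective
  have h2 : (Finset.univ.filter fun x : Fin 8 → ZMod p => Function.Injective x).card
      = p.descFactorial 8 := by
    rw [← Fintype.card_subtype,
      Fintype.card_congr (Equiv.subtypeInjectiveEquivEmbedding (Fin 8) (ZMod p)),
      Fintype.card_embedding_eq]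
    simp
  rw [h2] at h1
  simp only [Finset.card_univ, Fintype.card_fun, Fintype.card_fin, ZMod.card] at h1
  have h3 : ((p.descFactorial 8 : ℕ) : ℝ) +
    ((Finset.univ.filter fun x : Fin 8 → ZMod p => ¬ Function.Injective x).card : ℝ) =
      (p : ℝ) ^ 8 := by exact_mod_cast h1
  obtain ⟨q, rfl⟩ := Nat.exists_eq_add_of_le hp
  have h4 : ((8 + q).descFactorial 8 : ℝ) =
      (q+8)*(q+7)*(q+6)*(q+5)*(q+4)*(q+3)*(q+2)*(q+1) := by
    have : (8 + q).descFactorial 8 = (q+8)*(q+7)*(q+6)*(q+5)*(q+4)*(q+3)*(q+2)*(q+1) := by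
      simp only [Nat.descFactorial_succ, Nat.descFactorial_zero, Nat.sub_zero]
      have e : ∀ i, i ≤ 8 → 8 + q - i = q + (8 - i) := by intro i hi; omega
      rw [e 7 (by omega), e 6 (by omega), e 5 (by omega), e 4 (by omega), e 3 (by omega),
        e 2 (by omega), e 1 (by omega)]
      ring
    exact_mod_cast this
  rw [h4] at h3
  have hq : (0 : ℝ) ≤ q := by positivity
  push_cast at h3 ⊢
  suffices h : (8 + q : ℝ) ^ 8 - 28 * (8 + q : ℝ) ^ 7 ≤
      (q+8)*(q+7)*(q+6)*(q+5)*(q+4)*(q+3)*(q+2)*(q+1) by linarith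
  have : (q+8)*(q+7)*(q+6)*(q+5)*(q+4)*(q+3)*(q+2)*(q+1) - ((8 + q : ℝ) ^ 8 - 28 * (8 + q : ℝ) ^ 7)
     ≥ 0 := by
    ring_nf
    positivity
  linarith

lemma l2_iterate_avg_le (hp : 8 ≤ p) {f : LGrp p → ℝ} (hf : ∑ a, f a = 0) :
    l2 ((avg fun (s : ZMod p × ZMod p) a => a + lgen s)^[8] f) ≤ 28 / p * l2 f := by
  have hp0 : (0 : ℝ) < p := by positivity
  let h : (Fin 8 → ZMod p) → LGrp p → ℝ :=
    fun x => avg (fun (y : Fin 8 → ZMod p) a => a + ∑ i, lgen (x i, y i)) f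
  have e : (avg fun (s : ZMod p × ZMod p) a => a + lgen s)^[8] f =
      ((p : ℝ) ^ 8)⁻¹ • ∑ x, h x := by
    ext a
    rw [iterate_avg_add, ← (Equiv.arrowProdEquivProdArrow (Fin 8) (fun _ => ZMod p) (fun _ => ZMod p)).symm.sum_comp,
      Fintype.sum_prod_type]
    simp only [h, avg, Pi.smul_apply, Finset.sum_apply, smul_eq_mul, Fintype.card_prod, ZMod.card,
      Fintype.card_fun, Fintype.card_fin, ← Finset.sum_div]
    simp only [Equiv.arrowProdEquivProdArrow, Equiv.coe_fn_symm_mk]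
    push_cast
    field_simp
  have h0 : ∀ x, Function.Injective x → h x = 0 := by
    intro x hx
    ext a
    simp only [h, avg, Pi.zero_apply]
    rw [(lgen_comb_bijective hx).sum_comp (fun z => f (a + z)), show ∑ z, f (a + z) = 0 from
      ((Equiv.addLeft a).bijective.sum_comp f).trans hf,
      zero_div]
  have h1 : ∀ x, l2 (h x) ≤ l2 f := fun x =>
    l2_avg_le _ (fun y => (Equiv.addRight _).bijective) f
  rw [e, l2_smul, abs_of_pos (by positivity)]
  have h2 : l2 (∑ x, h x) ≤ 28 * (p : ℝ) ^ 7 * l2 f := by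
    have : ∑ x, h x = ∑ x with ¬ Function.Injective x, h x := by
      rw [Finset.sum_filter]
      refine Finset.sum_congr rfl fun x _ => ?_
      split_ifs with hx
      · exact h0 x hx
      · rfl
    rw [this]
    refine (l2_sum_le _ _).trans ((Finset.sum_le_card_nsmul _ _ (l2 f) fun x _ => h1 x).trans ?_)
    rw [nsmul_eq_mul]
    exact mul_le_mul_of_nonneg_right (card_not_injective_le hp) (l2_nonneg f)
  calc _ ≤ ((p : ℝ) ^ 8)⁻¹ * (28 * (p : ℝ) ^ 7 * l2 f) := by gcongr
    _ = _ := by field_simp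

lemma lgen_neg (s : ZMod p × ZMod p) : lgen (s.1, -s.2) = - lgen s := by
  ext i <;> simp [lgen]

lemma avg_lgen_symm (f h : LGrp p → ℝ) :
    ∑ a, avg (fun (s : ZMod p × ZMod p) a => a + lgen s) f a * h a =
      ∑ a, f a * avg (fun (s : ZMod p × ZMod p) a => a + lgen s) h a := by
  simp only [avg, div_mul_eq_mul_div, mul_div_assoc', ← Finset.sum_div, Finset.sum_mul, Finset.mul_sum]
  congr 1
  rw [Finset.sum_comm, Finset.sum_comm (s := (Finset.univ : Finset (LGrp p)))]
  rw [← ((Equiv.refl (ZMod p)).prodCongr (Equiv.neg (ZMod p))).sum_comp]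
  refine Finset.sum_congr rfl fun s _ => ?_
  have : lgen (((Equiv.refl (ZMod p)).prodCongr (Equiv.neg (ZMod p))) s) = - lgen s := lgen_neg s
  rw [this, ← Function.Bijective.sum_comp (Equiv.addRight (lgen s)).bijective]
  simp

lemma symm_step {X : Type*} [Fintype X] (T : (X → ℝ) → X → ℝ)
    (hT : ∀ f h : X → ℝ, ∑ a, T f a * h a = ∑ a, f a * T h a) (f : X → ℝ) :
    l2 (T f) ^ 2 ≤ l2 f * l2 (T (T f)) := by
  rw [l2_sq]
  simp only [sq]
  rw [hT]
  exact inner_le_l2 _ _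

lemma contr_lgen {μ : ℝ} (hμ : 0 ≤ μ) (hp : 8 ≤ p) (h : 28 / p ≤ μ ^ 8) :
    Contr (fun (s : ZMod p × ZMod p) (a : LGrp p) => a + lgen s) μ := by
  intro f hf
  set T := avg (fun (s : ZMod p × ZMod p) (a : LGrp p) => a + lgen s) with hTd
  have hT := avg_lgen_symm (p := p)
  rw [← hTd] at hT
  have h2 : ∀ f h : LGrp p → ℝ, ∑ a, T (T f) a * h a = ∑ a, f a * T (T h) a := by
    intro f h; rw [hT, hT]
  have h4 : ∀ f h : LGrp p → ℝ, ∑ a, T (T (T (T f))) a * h a = ∑ a, f a * T (T (T (T h))) a := by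
    intro f h; rw [h2, h2]
  have a1 := symm_step T hT f
  have a2 := symm_step _ h2 f
  have a4 := symm_step _ h4 f
  have a8 : l2 (T (T (T (T (T (T (T (T f)))))))) ≤ 28 / p * l2 f := l2_iterate_avg_le hp hf
  have n0 := l2_nonneg f
  have n1 := l2_nonneg (T f)
  have n2 := l2_nonneg (T (T f))
  have n4 := l2_nonneg (T (T (T (T f))))
  generalize l2 (T (T (T (T (T (T (T (T f)))))))) = x8 at *
  generalize l2 (T (T (T (T f)))) = x4 at *
  generalize l2 (T (T f)) = x2 at *
  generalize l2 (T f) = x1 at *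
  generalize l2 f = x0 at *
  have b8 : x8 ≤ μ ^ 8 * x0 := a8.trans (by gcongr)
  have b4 : x4 ≤ μ ^ 4 * x0 := by
    apply le_of_sq_le_sq _ (by positivity)
    calc x4 ^ 2 ≤ x0 * x8 := a4
      _ ≤ x0 * (μ ^ 8 * x0) := by gcongr
      _ = _ := by ring
  have b2 : x2 ≤ μ ^ 2 * x0 := by
    apply le_of_sq_le_sq _ (by positivity)
    calc x2 ^ 2 ≤ x0 * x4 := a2
      _ ≤ x0 * (μ ^ 4 * x0) := by gcongr
      _ = _ := by ring
  apply le_of_sq_le_sq _ (by positivity)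
  calc x1 ^ 2 ≤ x0 * x2 := a1
    _ ≤ x0 * (μ ^ 2 * x0) := by gcongr
    _ = _ := by ring

end Expander

lemma exists_expander : ∃ p : ℕ, ∃ _ : Fact p.Prime,
    Contr (fun (s : ZMod p × ZMod p) (a : LGrp p) => a + lgen s) (1 / 36) := by
  obtain ⟨p, hp, hpp⟩ := Nat.exists_infinite_primes (28 * 36 ^ 8)
  refine ⟨p, ⟨hpp⟩, ?_⟩
  have : Fact p.Prime := ⟨hpp⟩
  apply contr_lgen (by norm_num) (le_trans (by norm_num) hp)
  have h : ((28 * 36 ^ 8 : ℕ) : ℝ) ≤ p := Nat.cast_le.2 hp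
  push_cast at h
  have h0 : (0 : ℝ) < p := lt_of_lt_of_le (by norm_num) h
  rw [div_le_iff₀ h0, one_div, inv_pow, inv_mul_eq_div, le_div_iff₀ (by positivity)]
  exact le_trans (by norm_num) h

lemma iterate_avg_foldl {S X : Type*} [Fintype S] (σ : S → X → X) (f : X → ℝ) (n : ℕ) (x : X) :
    (avg σ)^[n] f x =
      (∑ w : Fin n → S, f ((List.ofFn w).foldl (fun x s => σ s x) x)) /
        (Fintype.card S : ℝ) ^ n := by
  induction n generalizing x with
  | zero => simp
  | succ n ih =>
    rw [Function.iterate_succ_apply']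
    simp only [avg, ih]
    rw [← (Fin.consEquiv fun _ => S).sum_comp, Fintype.sum_prod_type, pow_succ, ← Finset.sum_div,
      div_div]
    simp [Fin.consEquiv, List.ofFn_succ]

/-- One expander step followed by one step of the base family. -/
def zstep {K S V : Type*} [Add K] (g : S → K) (π : K → V → V) (s : S) (u : V × K) : V × K :=
  (π (u.2 + g s) u.1, u.2 + g s)

/-- Four consecutive expander and base steps, labelled by a quadruple. -/
def zz {K S V : Type*} [Add K] (g : S → K) (π : K → V → V) (l : Fin 4 → S) (u : V × K) : V × K :=
  zstep g π (l 3) (zstep g π (l 2) (zstep g π (l 1) (zstep g π (l 0) u)))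

section Zigzag
variable {K S V : Type*} [AddCommGroup K]

lemma avg_zz [Fintype S] (g : S → K) (π : K → V → V) (f : V × K → ℝ) :
    avg (zz g π) f = (avg (zstep g π))^[4] f := by
  ext u
  rw [iterate_avg_foldl]
  simp only [avg, Fintype.card_fun, Fintype.card_fin, Nat.cast_pow]
  rfl

lemma zstep_bijective {g : S → K} {π : K → V → V} (hπ : ∀ a, Function.Bijective (π a)) (s : S) :
    Function.Bijective (zstep g π s) := by
  constructor
  · rintro ⟨v, a⟩ ⟨w, b⟩ h
    simp only [zstep, Prod.mk.injEq, add_left_inj] at h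
    obtain ⟨h1, rfl⟩ := h
    rw [(hπ _).1 h1]
  · rintro ⟨v, a⟩
    obtain ⟨w, hw⟩ := (hπ a).2 v
    exact ⟨(w, a - g s), by simp [zstep, hw]⟩

lemma zz_bijective {g : S → K} {π : K → V → V} (hπ : ∀ a, Function.Bijective (π a))
    (l : Fin 4 → S) : Function.Bijective (zz g π l) :=
  (zstep_bijective hπ _).comp <| (zstep_bijective hπ _).comp <|
    (zstep_bijective hπ _).comp <| zstep_bijective hπ _

variable [Fintype S] [Fintype K] [Fintype V]

lemma l2_sq_prod {V K : Type*} [Fintype V] [Fintype K] (f : V × K → ℝ) : l2 f ^ 2 = ∑ v, l2 (fun a => f (v, a)) ^ 2 := by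
  simp only [l2_sq, Fintype.sum_prod_type]

lemma l2_comp_fst {V K : Type*} [Fintype V] [Fintype K] (q : V → ℝ) :
    l2 (fun u : V × K => q u.1) = Real.sqrt (Fintype.card K) * l2 q := by
  unfold l2
  rw [← Real.sqrt_mul (by positivity), Fintype.sum_prod_type]
  simp [Finset.mul_sum]

/-- Averaging over the second coordinate. -/
def kmean {V K : Type*} [Fintype K] (f : V × K → ℝ) (v : V) : ℝ := (∑ a, f (v, a)) / Fintype.card K

lemma l2_slice {K S : Type*} [Fintype K] [Fintype S] [Nonempty K] {σ : S → K → K} [Nonempty S] (hσ : ∀ s, Function.Bijective (σ s)) {μ : ℝ}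
    (h : Contr σ μ) (f : K → ℝ) :
    l2 (avg σ f - (1 - μ) • fun _ => (∑ a, f a) / Fintype.card K) ^ 2 ≤ μ ^ 2 * l2 f ^ 2 := by
  set c := (∑ a, f a) / Fintype.card K with hc
  have hK : (0 : ℝ) < Fintype.card K := by exact_mod_cast Fintype.card_pos
  have hs : ∑ a, f a = Fintype.card K * c := by rw [hc]; field_simp
  set d : K → ℝ := f - fun _ => c with hd
  have hd0 : ∑ a, d a = 0 := by simp [hd, hs]
  have e1 : avg σ f - (1 - μ) • (fun _ => c) = avg σ d + fun _ => μ * c := by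
    have : f = d + fun _ => c := by simp [hd]
    conv_lhs => rw [this, avg_add, avg_const]
    ext a
    simp
    ring
  have e2 : l2 (avg σ d + fun _ => μ * c) ^ 2
      = l2 (avg σ d) ^ 2 + μ ^ 2 * (Fintype.card K * c ^ 2) := by
    have h0 := sum_avg σ hσ d
    rw [hd0] at h0
    simp only [l2_sq, Pi.add_apply, add_sq, Finset.sum_add_distrib, ← Finset.sum_mul,
      ← Finset.mul_sum, h0]
    simp
    ring
  have e3 : l2 f ^ 2 = l2 d ^ 2 + Fintype.card K * c ^ 2 := by
    have : f = d + fun _ => c := by simp [hd]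
    conv_lhs => rw [this]
    simp only [l2_sq, Pi.add_apply, add_sq, Finset.sum_add_distrib, ← Finset.sum_mul,
      ← Finset.mul_sum, hd0]
    simp
  have e4 : l2 (avg σ d) ^ 2 ≤ μ ^ 2 * l2 d ^ 2 := by
    rw [← mul_pow]
    exact pow_le_pow_left₀ (l2_nonneg _) (h d hd0) 2
  rw [e1, e2, e3]
  nlinarith

lemma l2_kmean_le (f : V × K → ℝ) : l2 (fun u : V × K => kmean f u.1) ≤ l2 f := by
  have e : (fun u : V × K => kmean f u.1) = avg (fun (b : K) (u : V × K) => (u.1, u.2 + b)) f := by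
    ext u
    simp only [kmean, avg]
    congr 1
    exact ((Equiv.addLeft u.2).bijective.sum_comp (fun a => f (u.1, a))).symm
  rw [e]
  refine l2_avg_le _ (fun b => ?_) f
  exact ((Equiv.refl V).prodCongr (Equiv.addRight b)).bijective

lemma contr_zz [Nonempty S] {g : S → K} {π : K → V → V} {μ lam : ℝ} (hμ0 : 0 ≤ μ) (hμ : μ ≤ 1)
    (hl0 : 0 ≤ lam) (hg : Contr (fun s a => a + g s) μ)
    (hπ : ∀ a, Function.Bijective (π a)) (hc : Contr π lam) :
    Contr (zz g π) (1 - (1 - μ) ^ 4 * (1 - lam ^ 3)) := by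
  intro f hf
  rw [avg_zz]
  set M := avg (zstep g π) with hM
  let P : (V × K → ℝ) → V × K → ℝ := fun h u => h (π u.2 u.1, u.2)
  have hPb : Function.Bijective fun u : V × K => (π u.2 u.1, u.2) := by
    have := zstep_bijective (g := fun _ : Unit => (0 : K)) hπ ()
    have e : zstep (fun _ : Unit => (0 : K)) π () = fun u => (π u.2 u.1, u.2) := by
      ext u <;> simp [zstep]
    rwa [e] at this
  have hP : ∀ h, l2 (P h) = l2 h := fun h => l2_comp_perm h _ hPb
  let N : (V × K → ℝ) → V × K → ℝ := fun h u => kmean (P h) u.1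
  have hN : ∀ h, l2 (N h) ≤ l2 h := fun h => (l2_kmean_le _).trans (hP h).le
  have hMN : ∀ h, l2 (M h - (1 - μ) • N h) ≤ μ * l2 h := by
    intro h
    apply le_of_sq_le_sq _ (mul_nonneg hμ0 (l2_nonneg _))
    rw [mul_pow, ← hP h, l2_sq_prod, l2_sq_prod, Finset.mul_sum]
    refine Finset.sum_le_sum fun v _ => ?_
    exact l2_slice (σ := fun s a => a + g s) (fun s => (Equiv.addRight (g s)).bijective) hg
      (fun a => P h (v, a))
  have hNadd : ∀ h k, N (h + k) = N h + N k := by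
    intro h k; ext u
    simp [N, P, kmean, Finset.sum_add_distrib, add_div]
  have hNsmul : ∀ (c : ℝ) h, N (c • h) = c • N h := by
    intro c h; ext u
    simp [N, P, kmean, ← Finset.mul_sum, mul_div_assoc]
  have hM1 : ∀ h, l2 (M h) ≤ l2 h := l2_avg_le _ (zstep_bijective hπ)
  have hMj : ∀ j, l2 (M^[j] f) ≤ l2 f := by
    intro j
    induction j with
    | zero => simp
    | succ j ih => rw [Function.iterate_succ_apply']; exact (hM1 _).trans ih
  have key : ∀ j, l2 (M^[j] f - (1 - μ) ^ j • N^[j] f) ≤ (1 - (1 - μ) ^ j) * l2 f := by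
    intro j
    induction j with
    | zero => simp [l2_zero]
    | succ j ih =>
      rw [Function.iterate_succ_apply', Function.iterate_succ_apply']
      have e : M (M^[j] f) - (1 - μ) ^ (j + 1) • N (N^[j] f) =
          (M (M^[j] f) - (1 - μ) • N (M^[j] f)) +
            (1 - μ) • N (M^[j] f - (1 - μ) ^ j • N^[j] f) := by
        rw [sub_eq_add_neg (M^[j] f), ← neg_smul, hNadd, hNsmul, smul_add, smul_smul, pow_succ]
        ext u
        simp
        ring
      rw [e]
      refine (l2_add_le _ _).trans ?_
      rw [l2_smul, abs_of_nonneg (by linarith)]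
      have b1 := hMN (M^[j] f)
      have b2 := hMj j
      have b3 := (hN (M^[j] f - (1 - μ) ^ j • N^[j] f)).trans ih
      have b4 : μ * l2 (M^[j] f) ≤ μ * l2 f := mul_le_mul_of_nonneg_left b2 hμ0
      have b5 := mul_le_mul_of_nonneg_left b3 (show 0 ≤ 1 - μ by linarith)
      have : μ * l2 f + (1 - μ) * ((1 - (1 - μ) ^ j) * l2 f) = (1 - (1 - μ) ^ (j + 1)) * l2 f := by
        ring
      linarith
  have hNfst : ∀ q : V → ℝ, N (fun u => q u.1) = fun u => avg π q u.1 := by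
    intro q; ext u; simp [N, P, kmean, avg]
  have hsq : ∑ v, kmean (P f) v = 0 := by
    simp only [kmean, ← Finset.sum_div]
    rw [← Fintype.sum_prod_type (fun u => P f u)]
    have : ∑ u, P f u = 0 := (hPb.sum_comp f).trans hf
    rw [this, zero_div]
  have hN4 : l2 (N^[4] f) ≤ lam ^ 3 * l2 f := by
    have e : N^[4] f = fun u => avg π (avg π (avg π (kmean (P f)))) u.1 := by
      show N (N (N (N f))) = _
      have : N f = fun u => kmean (P f) u.1 := rfl
      rw [this, hNfst (kmean (P f)), hNfst (avg π (kmean (P f))),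
        hNfst (avg π (avg π (kmean (P f))))]
    have s1 := sum_avg π hπ (kmean (P f))
    have s2 := sum_avg π hπ (avg π (kmean (P f)))
    rw [hsq] at s1
    rw [s1] at s2
    have c1 := hc _ hsq
    have c2 := hc _ s1
    have c3 := hc _ s2
    rw [e, l2_comp_fst]
    have b0 := hN f
    have e0 : l2 (N f) = Real.sqrt (Fintype.card K) * l2 (kmean (P f)) := l2_comp_fst _
    calc _ ≤ Real.sqrt (Fintype.card K) * (lam * (lam * (lam * l2 (kmean (P f))))) := by
          gcongr
          refine c3.trans ?_
          gcongr
          refine c2.trans ?_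
          gcongr
      _ = lam ^ 3 * l2 (N f) := by rw [e0]; ring
      _ ≤ _ := by gcongr
  have h4 := key 4
  have : M^[4] f = (M^[4] f - (1 - μ) ^ 4 • N^[4] f) + (1 - μ) ^ 4 • N^[4] f := by simp
  rw [this]
  refine (l2_add_le _ _).trans ?_
  rw [l2_smul, abs_of_nonneg (by positivity)]
  have : (1 - μ) ^ 4 * l2 (N^[4] f) ≤ (1 - μ) ^ 4 * (lam ^ 3 * l2 f) := by gcongr
  linarith

lemma contr_zz_gap [Nonempty S] {g : S → K} {π : K → V → V} {γ : ℝ} (h0 : 0 ≤ γ) (h1 : γ ≤ 1 / 4)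
    (hg : Contr (fun s a => a + g s) (1 / 36))
    (hπ : ∀ a, Function.Bijective (π a)) (hc : Contr π (1 - γ)) :
    Contr (zz g π) (1 - min (1 / 4) (2 * γ)) := by
  refine (contr_zz (by norm_num) (by norm_num) (by linarith) hg hπ hc).mono ?_
  have : min (1 / 4) (2 * γ) ≤ 2 * γ := min_le_right _ _
  have h2 : (8 / 9 : ℝ) ≤ (1 - 1 / 36) ^ 4 := by norm_num
  have h3 : (1 - (1 - γ) ^ 3) ≥ 0 := by nlinarith [pow_le_one₀ (n := 3) (show 0 ≤ 1 - γ by linarith) (by linarith)]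
  have h4 : (9 / 8) * (2 * γ) ≤ 1 - (1 - γ) ^ 3 := by nlinarith [mul_nonneg h0 h0]
  nlinarith

end Zigzag

/-- A partial move: `none` stays, `some s` applies the involution `act s`. -/
def bact {X : Type*} (act : Fin 3 → X → X) (o : Option (Fin 3)) (x : X) : X :=
  match o with
  | none => x
  | some s => act s x

lemma bact_bact {X : Type*} {act : Fin 3 → X → X} (h : ∀ s x, act s (act s x) = x)
    (o : Option (Fin 3)) (x : X) : bact act o (bact act o x) = x := by
  cases o <;> simp [bact, h]

lemma bact_bijective {X : Type*} {act : Fin 3 → X → X} (h : ∀ s x, act s (act s x) = x)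
    (o : Option (Fin 3)) : Function.Bijective (bact act o) :=
  Function.Involutive.bijective (bact_bact h o)

/-- Any two points are connected by moves. -/
def Transv {X : Type*} (act : Fin 3 → X → X) : Prop :=
  ∀ x y, Relation.ReflTransGen (fun u v => ∃ s, act s u = v) x y

lemma exists_large_edge {X : Type*} [Fintype X] {act : Fin 3 → X → X} (ht : Transv act)
    (f : X → ℝ) (x y : X) : ∃ u s, |f x - f y| ≤ Fintype.card X * |f u - f (act s u)| := by
  by_contra! hcon
  let G : SimpleGraph X := SimpleGraph.fromRel fun u v => ∃ s, act s u = v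
  have hadj : ∀ u v, G.Adj u v → Fintype.card X * |f u - f v| < |f x - f y| := by
    rintro u v ⟨-, ⟨s, rfl⟩ | ⟨s, rfl⟩⟩
    · exact hcon u s
    · rw [abs_sub_comm]; exact hcon v s
  have hreach : G.Reachable x y := by
    clear hadj hcon
    have := ht x y
    induction this with
    | refl => exact SimpleGraph.Reachable.refl _
    | @tail b c _ hbc ih =>
      by_cases hb : b = c
      · exact hb ▸ ih
      · exact ih.trans (SimpleGraph.Adj.reachable ⟨hb, Or.inl hbc⟩)
  obtain ⟨p, hp⟩ := hreach.exists_isPath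
  have hlen := hp.length_lt
  have hw : ∀ u v (p : G.Walk u v),
      Fintype.card X * |f u - f v| ≤ p.length * |f x - f y| := by
    intro u v p
    induction p with
    | nil => simp
    | @cons u v w h p ih =>
      have h1 := hadj _ _ h
      have h2 := abs_sub_le (f u) (f v) (f w)
      have h3 : (0 : ℝ) ≤ Fintype.card X := by positivity
      have := mul_le_mul_of_nonneg_left h2 h3
      push_cast [SimpleGraph.Walk.length_cons]
      linarith
  have h1 := hw x y p
  have h2 : (p.length : ℝ) + 1 ≤ Fintype.card X := by exact_mod_cast hlen
  have h3 := hcon x 0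
  have h4 : 0 ≤ Fintype.card X * |f x - f (act 0 x)| := by positivity
  nlinarith

lemma exists_edge_l2 {X : Type*} [Fintype X] [Nonempty X] {act : Fin 3 → X → X} (ht : Transv act)
    (f : X → ℝ) (hf : ∑ x, f x = 0) :
    ∃ u s, l2 f ^ 2 ≤ (Fintype.card X : ℝ) ^ 3 * (f u - f (act s u)) ^ 2 := by
  obtain ⟨x, -, hx⟩ := Finset.exists_max_image Finset.univ (fun x => |f x|) Finset.univ_nonempty
  obtain ⟨y, hy⟩ : ∃ y, |f x| ≤ |f x - f y| := by
    by_contra! hcon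
    rcases le_total 0 (f x) with h0 | h0
    · have : 0 < ∑ y, f y := Finset.sum_pos (fun y _ => by
        have h1 := hcon y
        rw [abs_of_nonneg h0] at h1
        have := le_abs_self (f x - f y)
        linarith) Finset.univ_nonempty
      linarith
    · have : ∑ y, f y < 0 := Finset.sum_neg (fun y _ => by
        have h1 := hcon y
        rw [abs_of_nonpos h0] at h1
        have := neg_abs_le (f x - f y)
        linarith) Finset.univ_nonempty
      linarith
  obtain ⟨u, s, h⟩ := exists_large_edge ht f x y
  refine ⟨u, s, ?_⟩
  have h1 : l2 f ^ 2 ≤ Fintype.card X * |f x| ^ 2 := by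
    rw [l2_sq, ← nsmul_eq_mul]
    refine Finset.sum_le_card_nsmul _ _ _ fun z hz => ?_
    rw [← sq_abs]
    exact pow_le_pow_left₀ (abs_nonneg _) (hx z hz) 2
  have h2 : |f x| ≤ Fintype.card X * |f u - f (act s u)| := hy.trans h
  calc l2 f ^ 2 ≤ Fintype.card X * |f x| ^ 2 := h1
    _ ≤ Fintype.card X * (Fintype.card X * |f u - f (act s u)|) ^ 2 := by gcongr
    _ = _ := by rw [mul_pow, sq_abs]; ring

lemma sq_mean_le {K : Type*} [Fintype K] (z : K → ℝ) (a b : K) (hab : a ≠ b) :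
    ((∑ i, z i) / Fintype.card K) ^ 2 ≤
      (∑ i, z i ^ 2) / Fintype.card K - (z a - z b) ^ 2 / (2 * Fintype.card K) := by
  have hK : (0 : ℝ) < Fintype.card K := by
    have : Nonempty K := ⟨a⟩
    exact_mod_cast Fintype.card_pos
  set m := (∑ i, z i) / Fintype.card K with hm
  have hs : ∑ i, z i = Fintype.card K * m := by rw [hm]; field_simp
  have h1 : ∑ i, (z i - m) ^ 2 = ∑ i, z i ^ 2 - Fintype.card K * m ^ 2 := by
    simp only [sub_sq, Finset.sum_add_distrib, Finset.sum_sub_distrib, ← Finset.sum_mul,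
      ← Finset.mul_sum, hs]
    simp
    ring
  have h2 : (z a - m) ^ 2 + (z b - m) ^ 2 ≤ ∑ i, (z i - m) ^ 2 := by
    rw [← Finset.sum_pair hab (f := fun i => (z i - m) ^ 2)]
    exact Finset.sum_le_sum_of_subset_of_nonneg (Finset.subset_univ _) fun _ _ _ => sq_nonneg _
  have h3 : (z a - z b) ^ 2 ≤ 2 * ((z a - m) ^ 2 + (z b - m) ^ 2) := by
    nlinarith [sq_nonneg ((z a - m) + (z b - m))]
  rw [div_sub_div _ _ hK.ne' (by positivity), le_div_iff₀ (by positivity)]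
  nlinarith

lemma contr_base {K X : Type*} [Fintype K] [Fintype X] [Nonempty X] {act : Fin 3 → X → X}
    (hi : ∀ s x, act s (act s x) = x) (ht : Transv act) {c : K → Option (Fin 3)}
    (hc : Function.Surjective c) :
    Contr (fun a => bact act (c a))
      (1 - 1 / (4 * Fintype.card K * (Fintype.card X : ℝ) ^ 3)) := by
  intro f hf
  obtain ⟨u, s, hus⟩ := exists_edge_l2 ht f hf
  obtain ⟨a, ha⟩ := hc none
  obtain ⟨b, hb⟩ := hc (some s)
  have hab : a ≠ b := by rintro rfl; simp [ha] at hb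
  have hK : (1 : ℝ) ≤ Fintype.card K := by
    have : Nonempty K := ⟨a⟩
    exact_mod_cast Fintype.card_pos
  have hX : (1 : ℝ) ≤ Fintype.card X := by exact_mod_cast Fintype.card_pos
  have hX3 : (1 : ℝ) ≤ (Fintype.card X : ℝ) ^ 3 := one_le_pow₀ hX
  have h1 : l2 (avg (fun a => bact act (c a)) f) ^ 2 ≤
      l2 f ^ 2 - (f u - f (act s u)) ^ 2 / (2 * Fintype.card K) := by
    rw [l2_sq, l2_sq]
    have e : ∑ x, f x ^ 2 = ∑ x, (∑ k, f (bact act (c k) x) ^ 2) / Fintype.card K := by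
      rw [← Finset.sum_div, Finset.sum_comm]
      simp [fun k => (bact_bijective hi (c k)).sum_comp (fun x => f x ^ 2)]
      field_simp
    rw [e]
    have e2 : (f u - f (act s u)) ^ 2 / (2 * Fintype.card K) ≤
        ∑ x, (f x - f (act s x)) ^ 2 / (2 * Fintype.card K) :=
      Finset.single_le_sum (f := fun x => (f x - f (act s x)) ^ 2 / (2 * (Fintype.card K : ℝ)))
        (fun _ _ => by positivity) (Finset.mem_univ u)
    refine le_trans ?_ (sub_le_sub_left e2 _)
    rw [← Finset.sum_sub_distrib]
    refine Finset.sum_le_sum fun x _ => ?_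
    have := sq_mean_le (fun k => f (bact act (c k) x)) a b hab
    simpa only [avg, ha, hb, bact] using this
  set k := (Fintype.card K : ℝ)
  set n := (Fintype.card X : ℝ) ^ 3
  have hε : 1 / (4 * k * n) ≤ 1 := by
    rw [div_le_one (by positivity)]
    nlinarith
  apply le_of_sq_le_sq _ (mul_nonneg (by linarith) (l2_nonneg _))
  refine h1.trans ?_
  have h2 : l2 f ^ 2 * (1 / (2 * k * n)) ≤ (f u - f (act s u)) ^ 2 / (2 * k) := by
    rw [mul_one_div, div_le_div_iff₀ (by positivity) (by positivity)]
    nlinarith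
  have h3 : 1 / (2 * k * n) = 2 * (1 / (4 * k * n)) := by field_simp; norm_num
  rw [h3] at h2
  have := sq_nonneg (l2 f * (1 / (4 * k * n)))
  nlinarith

/-- The prime over which the labels are defined. -/
def prm : ℕ := exists_expander.choose

instance prm_prime : Fact prm.Prime := exists_expander.choose_spec.choose

abbrev Lab := LGrp prm

/-- The expander generators. -/
def gn (s : ZMod prm × ZMod prm) : Lab := lgen s

lemma contr_gn : Contr (fun s (a : Lab) => a + gn s) (1 / 36) :=
  exists_expander.choose_spec.choose_spec

lemma exists_cmap : ∃ c : Lab → Option (Fin 3), Function.Surjective c := by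
  have h : Fintype.card (Option (Fin 3)) ≤ Fintype.card Lab := by
    have hp : 2 ≤ prm := prm_prime.out.two_le
    simp only [Fintype.card_option, Fintype.card_fin, Fintype.card_fun, Fintype.card_prod, ZMod.card]
    calc 3 + 1 ≤ (2 * 2) ^ 4 := by norm_num
      _ ≤ (prm * prm) ^ 4 := by gcongr
  obtain ⟨f⟩ := Function.Embedding.nonempty_of_card_le h
  exact ⟨Function.invFun f, Function.invFun_surjective f.injective⟩

/-- The partial move selected by a label. -/
def cmap : Lab → Option (Fin 3) := exists_cmap.choose

lemma cmap_surjective : Function.Surjective cmap := exists_cmap.choose_spec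

/-- Letters: a label, a base-four digit and a flag. -/
abbrev Cell := Lab × Fin 4 × Bool

/-- The size of the alphabet. -/
def kap : ℕ := Fintype.card Cell

lemma card_lab_le : Fintype.card Lab ≤ kap := by
  unfold kap
  rw [Fintype.card_prod]
  exact Nat.le_mul_of_pos_right _ Fintype.card_pos

lemma four_le_kap : 4 ≤ kap := by
  have h : 0 < Fintype.card Lab := Fintype.card_pos
  have : kap = Fintype.card Lab * 8 := by simp [kap]
  omega

def all3 (w : List Cell) : Bool := w.all fun z => decide (z.2.1 = 3)

def all0 (w : List Cell) : Bool := w.all fun z => decide (z.2.1 = 0)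

/-- One increment of the odometer `w` with incoming label `l`; also returns the outgoing label. -/
def tkw : Lab → List Cell → List Cell × Lab
  | l, [] => ([], l)
  | l, z :: w =>
    if all3 w then
      let r := tkw (z.1 + gn (l (z.2.1 + 1))) w
      ((z.1 + gn (l (z.2.1 + 1)), z.2.1 + 1, false) :: r.1, r.2)
    else
      let r := tkw z.1 w
      ((z.1, z.2.1, false) :: r.1, r.2)

/-- The outgoing label. -/
def bot : Lab → List Cell → Lab
  | l, [] => l
  | _, z :: w => bot z.1 w

/-- The inverse of an odometer increment. -/
def utw : Lab → List Cell → List Cell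
  | _, [] => []
  | l, z :: w =>
    (if all0 w then (z.1 - gn (l z.2.1), z.2.1 - 1, false) else (z.1, z.2.1, false)) :: utw z.1 w

/-- All flags are off. -/
def FlagOff (w : List Cell) : Prop := ∀ z ∈ w, z.2.2 = false

lemma bot_tkw (l : Lab) (w : List Cell) : bot l (tkw l w).1 = (tkw l w).2 := by
  induction w generalizing l with
  | nil => rfl
  | cons z w ih => simp only [tkw]; split_ifs <;> simp [bot, ih]

lemma length_tkw (l : Lab) (w : List Cell) : (tkw l w).1.length = w.length := by
  induction w generalizing l with
  | nil => rfl
  | cons z w ih => simp only [tkw]; split_ifs <;> simp [ih]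

lemma length_utw (l : Lab) (w : List Cell) : (utw l w).length = w.length := by
  induction w generalizing l with
  | nil => rfl
  | cons z w ih => simp [utw, ih]

lemma flagOff_tkw (l : Lab) (w : List Cell) : FlagOff (tkw l w).1 := by
  induction w generalizing l with
  | nil => simp [tkw, FlagOff]
  | cons z w ih =>
    simp only [tkw]
    split_ifs <;> exact List.forall_mem_cons.2 ⟨rfl, ih _⟩

lemma all0_tkw (l : Lab) (w : List Cell) : all0 (tkw l w).1 = all3 w := by
  induction w generalizing l with
  | nil => rfl
  | cons z w ih =>
    have h3 : ∀ d : Fin 4, decide (d + 1 = 0) = decide (d = 3) := by decide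
    have e3 : all3 (z :: w) = (decide (z.2.1 = 3) && all3 w) := rfl
    simp only [tkw]
    split_ifs with h
    · have := ih (z.1 + gn (l (z.2.1 + 1)))
      simp only [all0] at this
      simp only [all0, List.all_cons, this, e3, h, h3]
    · have := ih z.1
      simp only [all0] at this
      simp only [all0, List.all_cons, this, e3, h, Bool.and_false]

lemma utw_tkw (l : Lab) (w : List Cell) (hw : FlagOff w) : utw l (tkw l w).1 = w := by
  induction w generalizing l with
  | nil => rfl
  | cons z w ih =>
    have hz : z.2.2 = false := hw z List.mem_cons_self
    have hw₂ : FlagOff w := fun y hy => hw y (List.mem_cons_of_mem _ hy)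
    obtain ⟨a, d, f⟩ := z
    simp only at hz
    subst hz
    simp only [tkw]
    split_ifs with h
    · simp [utw, all0_tkw, h, ih _ hw₂]
    · simp [utw, all0_tkw, h, ih _ hw₂]

/-- The label at the head of a word. -/
def hdl (R : List Cell) : Lab := (R.head?.getD (0, 0, false)).1

/-- A step forward of the walk: `(route, odometer, position)`. -/
def fwdS {X : Type*} (act : Fin 3 → X → X) (u : List Cell × List Cell × X) :
    List Cell × List Cell × X :=
  let R := if all3 u.2.1 then u.1.rotate 1 else u.1
  (R, (tkw (hdl R) u.2.1).1, bact act (cmap (tkw (hdl R) u.2.1).2) u.2.2)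

/-- A step backward of the walk. -/
def bwdS {X : Type*} (act : Fin 3 → X → X) (u : List Cell × List Cell × X) :
    List Cell × List Cell × X :=
  let W := utw (hdl u.1) u.2.1
  (if all0 u.2.1 then u.1.rotate (u.1.length - 1) else u.1, W,
    bact act (cmap (bot (hdl u.1) u.2.1)) u.2.2)

lemma bwdS_fwdS {X : Type*} {act : Fin 3 → X → X} (hi : ∀ s x, act s (act s x) = x)
    (u : List Cell × List Cell × X) (hu : FlagOff u.2.1) :
    bwdS act (fwdS act u) = u := by
  obtain ⟨R, W, x⟩ := u
  simp only [fwdS, bwdS, bot_tkw, all0_tkw, utw_tkw _ _ hu, bact_bact hi]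
  have hr : (R.rotate 1).rotate (R.length - 1) = R := by
    rcases R with _ | ⟨r, R⟩
    · simp
    · rw [List.rotate_rotate]
      simp only [List.length_cons, Nat.add_sub_cancel]
      rw [Nat.add_comm, ← List.length_cons (a := r), List.rotate_length]
  split_ifs <;> simp [hr]

lemma fwdS_flagOff {X : Type*} (act : Fin 3 → X → X) (u : List Cell × List Cell × X) :
    FlagOff (fwdS act u).2.1 := flagOff_tkw _ _

lemma fwdS_length {X : Type*} (act : Fin 3 → X → X) (u : List Cell × List Cell × X) :
    (fwdS act u).1.length = u.1.length ∧ (fwdS act u).2.1.length = u.2.1.length := by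
  refine ⟨?_, length_tkw _ _⟩
  simp only [fwdS]
  split_ifs <;> simp

/-- Odometer and position, one step with a fixed label. -/
def tkS {X : Type*} (act : Fin 3 → X → X) (l : Lab) (u : List Cell × X) : List Cell × X :=
  ((tkw l u.1).1, bact act (cmap (tkw l u.1).2) u.2)

/-- Vertices of the iterated product. -/
def Vt (X : Type*) : ℕ → Type _
  | 0 => X
  | m + 1 => Vt X m × Lab

instance Vt.fintype {X : Type*} [Fintype X] : ∀ m, Fintype (Vt X m)
  | 0 => inferInstanceAs (Fintype X)
  | m + 1 => letI := Vt.fintype (X := X) m; inferInstanceAs (Fintype (Vt X m × Lab))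

/-- The labelled permutations of the iterated product. -/
def pim {X : Type*} (act : Fin 3 → X → X) : ∀ m, Lab → Vt X m → Vt X m
  | 0 => fun l => bact act (cmap l)
  | m + 1 => zz gn (pim act m)

/-- The walk state of a vertex of the iterated product. -/
def conf {X : Type*} : ∀ m, Vt X m → List Cell × X
  | 0, x => ([], x)
  | m + 1, u => ((u.2, 3, false) :: (conf m u.1).1, (conf m u.1).2)

section Odometer
variable {X : Type*} {act : Fin 3 → X → X}

lemma all3_conf (m : ℕ) (u : Vt X m) : all3 (conf m u).1 = true := by
  induction m with
  | zero => rfl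
  | succ m ih => simpa [conf, all3] using ih u.1

/-- The walk state of a vertex with another digit on top. -/
def confd {m : ℕ} (d : Fin 4) (u : Vt X m × Lab) : List Cell × X :=
  ((u.2, d, false) :: (conf m u.1).1, (conf m u.1).2)

lemma tkS_block {m : ℕ} (l : Lab) (d : Fin 4) (u : Vt X m × Lab)
    (ih : ∀ t, 0 < t → t < 4 ^ m →
      all3 ((tkS act (u.2 + gn (l (d + 1))))^[t] (conf m u.1)).1 = false)
    (t : ℕ) (h0 : 0 < t) (ht : t ≤ 4 ^ m) :
    (tkS act l)^[t] (confd d u) =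
      ((u.2 + gn (l (d + 1)), d + 1, false) ::
        ((tkS act (u.2 + gn (l (d + 1))))^[t] (conf m u.1)).1,
        ((tkS act (u.2 + gn (l (d + 1))))^[t] (conf m u.1)).2) := by
  induction t with
  | zero => omega
  | succ t iht =>
    rcases Nat.eq_zero_or_pos t with rfl | htp
    · simp [confd, tkS, tkw, all3_conf]
    · rw [Function.iterate_succ_apply', iht htp (by omega), Function.iterate_succ_apply']
      have := ih t htp (by omega)
      simp [tkS, tkw, this]

lemma tkS_main (m : ℕ) (l : Lab) (u : Vt X m) :
    (∀ t, 0 < t → t < 4 ^ m → all3 ((tkS act l)^[t] (conf m u)).1 = false) ∧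
      (tkS act l)^[4 ^ m] (conf m u) = conf m (pim act m l u) := by
  induction m generalizing l with
  | zero =>
    refine ⟨fun t h1 h2 => by simp at h2; omega, ?_⟩
    simp [conf, tkS, tkw, pim]
    rfl
  | succ m ih =>
    have block : ∀ (d : Fin 4) (u : Vt X m × Lab), (tkS act l)^[4 ^ m] (confd d u) =
        confd (d + 1) (zstep gn (pim act m) (l (d + 1)) u) := by
      intro d u
      rw [tkS_block l d u (ih _ _).1 _ (by positivity) le_rfl, (ih _ _).2]
      rfl
    let zq : ℕ → Vt X m × Lab := fun q => Nat.rec u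
      (fun q z => zstep gn (pim act m) (l (3 + Fin.ofNat 4 q + 1)) z) q
    have hq : ∀ q : ℕ, (tkS act l)^[q * 4 ^ m] (conf (m + 1) u) = confd (3 + Fin.ofNat 4 q) (zq q) := by
      intro q
      induction q with
      | zero => simp [zq]; rfl
      | succ q ihq =>
        rw [Nat.succ_mul, Nat.add_comm, Function.iterate_add_apply, ihq, block]
        have : Fin.ofNat 4 (q + 1) = Fin.ofNat 4 q + 1 := by
          ext; simp [Fin.val_add]
        rw [this, ← add_assoc]
    refine ⟨fun t h1 h2 => ?_, ?_⟩
    · have h4 : 0 < 4 ^ m := by positivity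
      obtain ⟨q, r, hr, rfl⟩ : ∃ q r, r < 4 ^ m ∧ t = r + q * 4 ^ m :=
        ⟨t / 4 ^ m, t % 4 ^ m, Nat.mod_lt _ h4, by rw [mul_comm, Nat.mod_add_div]⟩
      have hq4 : q < 4 := by
        by_contra hge
        have : 4 * 4 ^ m ≤ q * 4 ^ m := Nat.mul_le_mul_right _ (by omega)
        rw [pow_succ] at h2
        omega
      rw [Function.iterate_add_apply, hq]
      rcases Nat.eq_zero_or_pos r with rfl | hr0
      · have hq0 : q ≠ 0 := by rintro rfl; simp at h1
        have : (3 + Fin.ofNat 4 q) ≠ 3 := by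
          interval_cases q <;> first | omega | decide
        simp only [confd, Function.iterate_zero, id, all3, List.all_cons, this, decide_false,
          Bool.false_and]
      · rw [tkS_block _ _ _ (ih _ _).1 r hr0 hr.le]
        have := (ih ((zq q).2 + gn (l (3 + Fin.ofNat 4 q + 1))) (zq q).1).1 r hr0 hr
        simp only [all3, List.all_cons] at this ⊢
        rw [this, Bool.and_false]
    · rw [pow_succ, mul_comm, hq 4]
      rfl

lemma fwdS_round (m : ℕ) (R : List Cell) (u : Vt X m) (t : ℕ) (h0 : 0 < t) (ht : t ≤ 4 ^ m) :
    (fwdS act)^[t] (R, conf m u) =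
      (R.rotate 1, (tkS act (hdl (R.rotate 1)))^[t] (conf m u)) := by
  induction t with
  | zero => omega
  | succ t iht =>
    rcases Nat.eq_zero_or_pos t with rfl | htp
    · simp [fwdS, tkS, all3_conf]
    · rw [Function.iterate_succ_apply', iht htp (by omega), Function.iterate_succ_apply']
      have := (tkS_main (act := act) m (hdl (R.rotate 1)) u).1 t htp (by omega)
      simp [fwdS, tkS, this]

lemma fwdS_rounds (m : ℕ) (L : List Lab) (R D : List Cell) (u : Vt X m)
    (hR : R.rotate 1 = L.map (fun l => (l, 0, false)) ++ D) :
    ((fwdS act)^[L.length * 4 ^ m] (R, conf m u)).2 =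
      conf m (L.foldl (fun u l => pim act m l u) u) := by
  induction L generalizing R D u with
  | nil => simp
  | cons l L ih =>
    rw [List.length_cons, Nat.succ_mul, Function.iterate_add_apply,
      fwdS_round m R u _ (by positivity) le_rfl, (tkS_main m _ u).2,
      ih (R.rotate 1) (D ++ [(l, 0, false)])]
    · rw [hR]; rfl
    · rw [hR]; simp

end Odometer

/-- Projection to the base. -/
def vbase {X : Type*} (m : ℕ) (u : Vt X m) : X := (conf m u).2

section Cover
variable {X : Type*} {act : Fin 3 → X → X}

lemma pim_bijective (hi : ∀ s x, act s (act s x) = x) (m : ℕ) (l : Lab) :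
    Function.Bijective (pim act m l) := by
  induction m generalizing l with
  | zero => exact bact_bijective hi _
  | succ m ih => exact zz_bijective ih l

lemma sum_vbase [Fintype X] (m : ℕ) (F : X → ℝ) :
    ∑ u : Vt X m, F (vbase m u) = (Fintype.card Lab : ℝ) ^ m * ∑ x, F x := by
  induction m with
  | zero => simp; rfl
  | succ m ih =>
    have : ∑ u : Vt X (m + 1), F (vbase (m + 1) u) =
        ∑ u : Vt X m × Lab, F (vbase m u.1) := rfl
    rw [this, Fintype.sum_prod_type]
    simp only [Finset.sum_const, Finset.card_univ, nsmul_eq_mul, ← Finset.mul_sum, ih]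
    ring

lemma contr_pim [Fintype X] [Nonempty X] (hi : ∀ s x, act s (act s x) = x) (ht : Transv act)
    (m : ℕ) :
    Contr (pim act m) (1 - min (1 / 4)
      (2 ^ m * (1 / (4 * Fintype.card Lab * (Fintype.card X : ℝ) ^ 3)))) := by
  have hX : (1 : ℝ) ≤ Fintype.card X := by exact_mod_cast Fintype.card_pos
  have hK : (1 : ℝ) ≤ Fintype.card Lab := by exact_mod_cast Fintype.card_pos
  have hX3 : (1 : ℝ) ≤ (Fintype.card X : ℝ) ^ 3 := one_le_pow₀ hX
  induction m with
  | zero =>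
    refine (contr_base hi ht cmap_surjective).mono ?_
    have := min_le_right (1 / 4 : ℝ) (2 ^ 0 * (1 / (4 * Fintype.card Lab * (Fintype.card X : ℝ) ^ 3)))
    linarith
  | succ m ih =>
    set γ := (1 / (4 * Fintype.card Lab * (Fintype.card X : ℝ) ^ 3)) with hγ
    have h0 : 0 ≤ γ := by positivity
    refine (contr_zz_gap (le_min (by norm_num) (by positivity)) (min_le_left _ _) contr_gn
      (pim_bijective hi m) ih).mono ?_
    have h1 : min (1 / 4) (2 ^ (m + 1) * γ) ≤ min (1 / 4) (2 * min (1 / 4) (2 ^ m * γ)) := by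
      apply le_min (min_le_left _ _)
      rcases min_cases (1 / 4) (2 ^ m * γ) with ⟨e, -⟩ | ⟨e, -⟩ <;> rw [e]
      · exact (min_le_left _ _).trans (by norm_num)
      · exact (min_le_right _ _).trans (by rw [pow_succ]; linarith)
    linarith

lemma exists_of_iterate_avg_pos {S V : Type*} [Fintype S] (σ : S → V → V) (f : V → ℝ) (n : ℕ)
    (x : V) (h : 0 < (avg σ)^[n] f x) :
    ∃ w : List S, w.length = n ∧ 0 < f (w.foldl (fun x s => σ s x) x) := by
  rw [iterate_avg_foldl] at h
  by_contra! hcon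
  have : (∑ w : Fin n → S, f ((List.ofFn w).foldl (fun x s => σ s x) x)) ≤ 0 :=
    Finset.sum_nonpos fun w _ => hcon _ (by simp)
  have h2 := div_nonpos_of_nonpos_of_nonneg this
    (show (0 : ℝ) ≤ (Fintype.card S : ℝ) ^ n by positivity)
  linarith

lemma iterate_avg_contr {S V : Type*} [Fintype S] [Nonempty S] [Fintype V] {σ : S → V → V}
    (hσ : ∀ s, Function.Bijective (σ s)) {c : ℝ} (hc0 : 0 ≤ c) (hc : Contr σ c) {f : V → ℝ}
    (hf : ∑ v, f v = 0) (n : ℕ) :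
    ∑ v, (avg σ)^[n] f v = 0 ∧ l2 ((avg σ)^[n] f) ≤ c ^ n * l2 f := by
  induction n with
  | zero => simpa using hf
  | succ n ih =>
    rw [Function.iterate_succ_apply', sum_avg σ hσ]
    refine ⟨ih.1, (hc _ ih.1).trans ?_⟩
    rw [pow_succ, mul_comm _ c, mul_assoc]
    exact mul_le_mul_of_nonneg_left ih.2 hc0

lemma iterate_avg_add_const {S V : Type*} [Fintype S] [Nonempty S] (σ : S → V → V)
    (f : V → ℝ) (c : ℝ) (n : ℕ) (x : V) :
    (avg σ)^[n] (f + fun _ => c) x = (avg σ)^[n] f x + c := by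
  induction n generalizing f with
  | zero => rfl
  | succ n ih =>
    rw [Function.iterate_succ_apply, Function.iterate_succ_apply, avg_add, avg_const, ih]

lemma exists_walk [Fintype X] [Nonempty X] (hi : ∀ s x, act s (act s x) = x) (ht : Transv act)
    (m n : ℕ) (hm : Fintype.card Lab * Fintype.card X ^ 3 ≤ 2 ^ m)
    (hn : (3 / 4 : ℝ) ^ n * (Fintype.card Lab : ℝ) ^ m * Fintype.card X < 1)
    (u : Vt X m) (y : X) :
    ∃ w : List Lab, w.length = n ∧ vbase m (w.foldl (fun u l => pim act m l u) u) = y := by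
  have hX : (1 : ℝ) ≤ Fintype.card X := by exact_mod_cast Fintype.card_pos
  have hK : (1 : ℝ) ≤ Fintype.card Lab := by exact_mod_cast Fintype.card_pos
  have hX3 : (1 : ℝ) ≤ (Fintype.card X : ℝ) ^ 3 := one_le_pow₀ hX
  have hc : Contr (pim act m) (3 / 4) := by
    refine (contr_pim hi ht m).mono ?_
    rw [min_eq_left]
    · norm_num
    · have : (Fintype.card Lab : ℝ) * (Fintype.card X : ℝ) ^ 3 ≤ 2 ^ m := by exact_mod_cast hm
      rw [mul_one_div, div_le_div_iff₀ (by norm_num) (by positivity)]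
      linarith
  let F : X → ℝ := fun x => (if x = y then 1 else 0) - 1 / Fintype.card X
  let h : Vt X m → ℝ := fun v => F (vbase m v)
  have hF : ∑ x, F x = 0 := by
    simp only [F, Finset.sum_sub_distrib, Finset.sum_ite_eq', Finset.mem_univ, if_true,
      Finset.sum_const, Finset.card_univ, nsmul_eq_mul]
    field_simp
    norm_num
  have hF2 : ∑ x, F x ^ 2 ≤ 1 := by
    have : ∀ x, F x ^ 2 = (if x = y then 1 else 0) - 2 / Fintype.card X * F x
        - (1 / Fintype.card X) ^ 2 := by
      intro x
      simp only [F]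
      split_ifs <;> ring
    simp only [this, Finset.sum_sub_distrib, ← Finset.mul_sum, hF]
    simp only [Finset.sum_ite_eq', Finset.mem_univ, if_true, Finset.sum_const, Finset.card_univ,
      nsmul_eq_mul]
    have : 0 ≤ (Fintype.card X : ℝ) * (1 / Fintype.card X) ^ 2 := by positivity
    linarith
  have hh : ∑ v, h v = 0 := by
    have := sum_vbase m F
    rw [hF, mul_zero] at this
    exact this
  have hl2 : l2 h ≤ (Fintype.card Lab : ℝ) ^ m := by
    have hk : (1 : ℝ) ≤ (Fintype.card Lab : ℝ) ^ m := one_le_pow₀ hK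
    apply le_of_sq_le_sq _ (by positivity)
    rw [l2_sq]
    have := sum_vbase m (fun x => F x ^ 2)
    calc _ = (Fintype.card Lab : ℝ) ^ m * ∑ x, F x ^ 2 := this
      _ ≤ (Fintype.card Lab : ℝ) ^ m * 1 := by gcongr
      _ ≤ _ := by nlinarith
  have hA := (iterate_avg_contr (pim_bijective hi m) (by norm_num) hc hh n).2
  have hu := abs_le_l2 ((avg (pim act m))^[n] h) u
  have hpos : 0 < (avg (pim act m))^[n] (h + fun _ => (1 / Fintype.card X : ℝ)) u := by
    rw [iterate_avg_add_const]
    have h1 : (3 / 4 : ℝ) ^ n * l2 h ≤ (3 / 4 : ℝ) ^ n * (Fintype.card Lab : ℝ) ^ m := by gcongr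
    have h2 : (3 / 4 : ℝ) ^ n * (Fintype.card Lab : ℝ) ^ m < 1 / Fintype.card X := by
      rw [lt_div_iff₀ (by positivity)]
      exact hn
    have := neg_abs_le ((avg (pim act m))^[n] h u)
    linarith
  obtain ⟨w, hw, hp⟩ := exists_of_iterate_avg_pos _ _ _ _ hpos
  refine ⟨w, hw, ?_⟩
  by_contra hne
  simp [h, F, hne] at hp

end Cover

/-- The number of odometer cells per unit. -/
def c1 : ℕ := 4 * kap

/-- The number of route cells per unit. -/
def c2 : ℕ := 3 * kap * (c1 + 1)

/-- The initial odometer. -/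
def W0 (m : ℕ) : List Cell := List.replicate m (0, 3, false)

lemma exists_conf_eq {X : Type*} (m : ℕ) (x : X) : ∃ u : Vt X m, conf m u = (W0 m, x) := by
  induction m with
  | zero => exact ⟨x, rfl⟩
  | succ m ih =>
    obtain ⟨u, hu⟩ := ih
    exact ⟨(u, 0), by simp [conf, hu, W0, List.replicate_succ]⟩

/-- The position after `τ` steps along route `R` from `x`. -/
def ypos {X : Type*} (act : Fin 3 → X → X) (b : ℕ) (x : X) (R : List Cell) (τ : ℕ) : X :=
  ((fwdS act)^[τ] (R, W0 (c1 * b), x)).2.2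

lemma cover_small {X : Type*} [Fintype X] {act : Fin 3 → X → X}
    (hi : ∀ s x, act s (act s x) = x) (ht : Transv act) {b : ℕ} (hb : 0 < b)
    (hX : Fintype.card X ≤ kap ^ b) (x y : X) :
    ∃ R : List Cell, R.length = c2 * b ∧ ∃ τ < kap ^ (c2 * b), ypos act b x R τ = y := by
  have : Nonempty X := ⟨x⟩
  have hk4 := four_le_kap
  have hkp : kap < 2 ^ kap := Nat.lt_two_pow_self
  have hL := card_lab_le
  obtain ⟨u, hu⟩ := exists_conf_eq (c1 * b) x
  have h1 : Fintype.card Lab * Fintype.card X ^ 3 ≤ 2 ^ (c1 * b) := by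
    calc Fintype.card Lab * Fintype.card X ^ 3 ≤ kap ^ b * (kap ^ b) ^ 3 :=
          Nat.mul_le_mul (hL.trans (Nat.le_self_pow hb.ne' _)) (Nat.pow_le_pow_left hX 3)
      _ = kap ^ (4 * b) := by rw [← pow_mul, ← pow_add]; congr 1; ring
      _ ≤ (2 ^ kap) ^ (4 * b) := Nat.pow_le_pow_left hkp.le _
      _ = _ := by rw [← pow_mul, c1]; congr 1; ring
  have h2 : (3 / 4 : ℝ) ^ (c2 * b) * (Fintype.card Lab : ℝ) ^ (c1 * b) * Fintype.card X < 1 := by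
    have e1 : (3 / 4 : ℝ) ^ (c2 * b) ≤ (27 / 64) ^ (kap * (c1 + 1) * b) := by
      rw [c2, show 3 * kap * (c1 + 1) * b = 3 * (kap * (c1 + 1) * b) by ring, pow_mul]
      norm_num
    have e2 : (Fintype.card Lab : ℝ) ^ (c1 * b) * Fintype.card X ≤ 2 ^ (kap * (c1 + 1) * b) := by
      have : Fintype.card Lab ^ (c1 * b) * Fintype.card X ≤ 2 ^ (kap * (c1 + 1) * b) := by
        calc Fintype.card Lab ^ (c1 * b) * Fintype.card X ≤ kap ^ (c1 * b) * kap ^ b :=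
              Nat.mul_le_mul (Nat.pow_le_pow_left hL _) hX
          _ = kap ^ ((c1 + 1) * b) := by rw [← pow_add]; congr 1; ring
          _ ≤ (2 ^ kap) ^ ((c1 + 1) * b) := Nat.pow_le_pow_left hkp.le _
          _ = _ := by rw [← pow_mul]; congr 1; ring
      exact_mod_cast this
    rw [mul_assoc]
    calc _ ≤ (27 / 64 : ℝ) ^ (kap * (c1 + 1) * b) * 2 ^ (kap * (c1 + 1) * b) := by gcongr
      _ = (27 / 32) ^ (kap * (c1 + 1) * b) := by rw [← mul_pow]; norm_num
      _ < 1 := pow_lt_one₀ (by norm_num) (by norm_num) (by positivity)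
  obtain ⟨w, hw, hy⟩ := exists_walk hi ht (c1 * b) (c2 * b) h1 h2 u y
  set L : List Cell := w.map fun l => (l, 0, false) with hLd
  have hLl : L.length = c2 * b := by simp [L, hw]
  have hc2 : 0 < c2 * b := by
    have : 0 < c2 := by unfold c2; positivity
    positivity
  have hrot : (L.rotate (L.length - 1)).rotate 1 = L := by
    rw [List.rotate_rotate, Nat.sub_add_cancel (by omega), List.rotate_length]
  refine ⟨L.rotate (L.length - 1), by simp [hLl], c2 * b * 4 ^ (c1 * b), ?_, ?_⟩
  · have a1 : c2 * b < 2 ^ (c2 * b) := Nat.lt_two_pow_self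
    have a2 : 4 ^ (c1 * b) ≤ 2 ^ (c2 * b) := by
      rw [show 4 = 2 ^ 2 by norm_num, ← pow_mul]
      apply Nat.pow_le_pow_right (by norm_num)
      rw [← mul_assoc]
      apply Nat.mul_le_mul_right
      rw [c2]
      nlinarith
    calc c2 * b * 4 ^ (c1 * b) < 2 ^ (c2 * b) * 2 ^ (c2 * b) :=
          Nat.mul_lt_mul_of_lt_of_le a1 a2 (by positivity)
      _ = 4 ^ (c2 * b) := by rw [← mul_pow]; norm_num
      _ ≤ _ := Nat.pow_le_pow_left hk4 _
  · have := fwdS_rounds (act := act) (c1 * b) w (L.rotate (L.length - 1)) [] u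
      (by rw [hrot, List.append_nil])
    rw [hw, hu] at this
    rw [ypos, this]
    exact hy

section Count
variable {X : Type*} {act : Fin 3 → X → X}

lemma ypos_zero (b : ℕ) (x : X) (R : List Cell) : ypos act b x R 0 = x := rfl

lemma ypos_succ (b : ℕ) (x : X) (R : List Cell) (τ : ℕ) :
    ∃ o, ypos act b x R (τ + 1) = bact act o (ypos act b x R τ) := by
  rw [ypos, Function.iterate_succ_apply']
  exact ⟨_, rfl⟩

lemma fwdS_iterate_words {Y : Type*} (act' : Fin 3 → Y → Y) (u : List Cell × List Cell × X)
    (v : List Cell × List Cell × Y) (h : u.1 = v.1 ∧ u.2.1 = v.2.1) (τ : ℕ) :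
    ((fwdS act)^[τ] u).1 = ((fwdS act')^[τ] v).1 ∧
      ((fwdS act)^[τ] u).2.1 = ((fwdS act')^[τ] v).2.1 := by
  induction τ with
  | zero => exact h
  | succ τ ih =>
    rw [Function.iterate_succ_apply', Function.iterate_succ_apply']
    simp only [fwdS, ih.1, ih.2, and_self]

/-- The points visited by the walks of scale `b` from `x`. -/
def reached (act : Fin 3 → X → X) (b : ℕ) (x : X) : Set X :=
  {y | ∃ R : List Cell, R.length = c2 * b ∧ ∃ τ < kap ^ (c2 * b), ypos act b x R τ = y}

lemma mem_reached_self (b : ℕ) (x : X) : x ∈ reached act b x := by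
  have := four_le_kap
  exact ⟨List.replicate _ (0, 0, false), List.length_replicate, 0, by positivity, rfl⟩

/-- The walk stays inside a set containing all reached points. -/
lemma ypos_restrict {b : ℕ} {x : X} {U : Set X} (hU : reached act b x ⊆ U)
    (act' : Fin 3 → U → U) (hact : ∀ s (u : U), act s u ∈ U → (act' s u : X) = act s u)
    (hx : x ∈ U) {R : List Cell} (hR : R.length = c2 * b) (τ : ℕ) (hτ : τ < kap ^ (c2 * b)) :
    ((ypos act' b (⟨x, hx⟩ : U) R τ : U) : X) = ypos act b x R τ := by
  induction τ with
  | zero => rfl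
  | succ τ ih =>
    have ih := ih (by omega)
    have hmem : ypos act b x R (τ + 1) ∈ U := hU ⟨R, hR, _, hτ, rfl⟩
    have hw := fwdS_iterate_words (act := act) act' (R, W0 (c1 * b), x)
      (R, W0 (c1 * b), (⟨x, hx⟩ : U)) ⟨rfl, rfl⟩ τ
    unfold ypos at ih hmem ⊢
    rw [Function.iterate_succ_apply'] at hmem ⊢
    rw [Function.iterate_succ_apply']
    simp only [fwdS] at hmem ⊢
    rw [hw.1, hw.2, ← ih] at hmem ⊢
    cases h : cmap (tkw (hdl (if all3 ((fwdS act')^[τ] (R, W0 (c1 * b), (⟨x, hx⟩ : U))).2.1 = true then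
        ((fwdS act')^[τ] (R, W0 (c1 * b), (⟨x, hx⟩ : U))).1.rotate 1
        else ((fwdS act')^[τ] (R, W0 (c1 * b), (⟨x, hx⟩ : U))).1))
        ((fwdS act')^[τ] (R, W0 (c1 * b), (⟨x, hx⟩ : U))).2.1).2 with
    | none => rfl
    | some s =>
      rw [h] at hmem
      exact hact s _ hmem

lemma card_reached [Fintype X] (hi : ∀ s x, act s (act s x) = x) (ht : Transv act)
    {b : ℕ} (hb : 0 < b) (x : X) :
    min (kap ^ b) (Fintype.card X) ≤ (reached act b x).ncard := by
  by_contra! hcon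
  obtain ⟨h1, h2⟩ := lt_min_iff.1 hcon
  set U := reached act b x with hUd
  obtain ⟨u, hu, s, hz⟩ : ∃ u ∈ U, ∃ s, act s u ∉ U := by
    by_contra! hcl
    have hall : ∀ y, y ∈ U := by
      intro y
      have := ht x y
      clear hcon
      induction this with
      | refl => exact mem_reached_self b x
      | tail _ hbc ih => obtain ⟨s, rfl⟩ := hbc; exact hcl _ ih s
    have : U = Set.univ := Set.eq_univ_of_forall hall
    rw [this, Set.ncard_univ, Nat.card_eq_fintype_card] at h2
    exact lt_irrefl _ h2
  set U' : Set X := insert (act s u) U with hU'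
  let act' : Fin 3 → U' → U' := fun s v => if h : act s v ∈ U' then ⟨act s v, h⟩ else v
  have hact : ∀ s (v : U'), act s v ∈ U' → (act' s v : X) = act s v := by
    intro s v h; simp [act', h]
  have hi' : ∀ s v, act' s (act' s v) = v := by
    intro s v
    by_cases h : act s v ∈ U'
    · have e : act' s v = ⟨act s v, h⟩ := Subtype.ext (hact s v h)
      rw [e]
      apply Subtype.ext
      rw [hact]
      · exact hi s v
      · show act s (act s v) ∈ U'
        rw [hi]; exact v.2
    · have e : act' s v = v := by simp [act', h]
      rw [e, e]
  have hUU : U ⊆ U' := Set.subset_insert _ _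
  have hx : x ∈ U' := hUU (mem_reached_self b x)
  have hreach : ∀ v : U', Relation.ReflTransGen (fun u v => ∃ s, act' s u = v) ⟨x, hx⟩ v := by
    have hU1 : ∀ v (hv : v ∈ U), Relation.ReflTransGen (fun u v => ∃ s, act' s u = v) ⟨x, hx⟩
        ⟨v, hUU hv⟩ := by
      rintro v ⟨R, hR, τ, hτ, rfl⟩
      have e : (⟨ypos act b x R τ, hUU ⟨R, hR, τ, hτ, rfl⟩⟩ : U') = ypos act' b ⟨x, hx⟩ R τ :=
        Subtype.ext (ypos_restrict hUU act' hact hx hR τ hτ).symm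
      rw [e]
      clear e hτ
      induction τ with
      | zero => exact Relation.ReflTransGen.refl
      | succ τ ih =>
        obtain ⟨o, ho⟩ := ypos_succ (act := act') b ⟨x, hx⟩ R τ
        rw [ho]
        cases o with
        | none => exact ih
        | some s => exact ih.tail ⟨s, rfl⟩
    rintro ⟨v, rfl | hv⟩
    · refine (hU1 u hu).tail ⟨s, ?_⟩
      exact Subtype.ext (hact s ⟨u, hUU hu⟩ (Set.mem_insert _ _))
    · exact hU1 v hv
  have hsymm : Std.Symm (fun u v : U' => ∃ s, act' s u = v) :=
    ⟨fun u v ⟨s, h⟩ => ⟨s, by rw [← h, hi']⟩⟩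
  have ht' : Transv act' := fun v w => by
    refine Relation.ReflTransGen.trans ?_ (hreach w)
    exact Relation.ReflTransGen.stdSymm.symm _ _ (hreach v)
  have hcard : Fintype.card U' ≤ kap ^ b := by
    rw [← Nat.card_eq_fintype_card, Nat.card_coe_set_eq, hU', Set.ncard_insert_of_notMem hz]
    exact h1
  obtain ⟨R, hR, τ, hτ, hy⟩ := cover_small hi' ht' hb hcard ⟨x, hx⟩ ⟨act s u, Set.mem_insert _ _⟩
  apply hz
  have := ypos_restrict hUU act' hact hx hR τ hτ
  rw [hy] at this
  exact ⟨R, hR, τ, hτ, this.symm⟩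

end Count

section Numerals
variable {Γ : Type} {q : ℕ} (cd : Γ ≃ Fin q)

/-- The value of a little-endian word. -/
def nv : List Γ → ℕ
  | [] => 0
  | z :: w => cd z + q * nv w

variable [NeZero q]

/-- The word of length `l` representing `n`. -/
def nw : ℕ → ℕ → List Γ
  | 0, _ => []
  | l + 1, n => cd.symm (Fin.ofNat q n) :: nw l (n / q)

/-- Adding a carry bit to a letter. -/
def incl (c : Bool) (z : Γ) : Bool × Γ :=
  if c then (decide ((cd z : ℕ) + 1 = q), cd.symm (Fin.ofNat q (cd z + 1))) else (false, z)

/-- Adding a carry bit to a word. -/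
def incc : Bool → List Γ → Bool × List Γ
  | c, [] => (c, [])
  | c, z :: w => ((incc (incl cd c z).1 w).1, (incl cd c z).2 :: (incc (incl cd c z).1 w).2)

@[simp] lemma length_nw (l n : ℕ) : (nw cd l n).length = l := by
  induction l generalizing n with
  | zero => rfl
  | succ l ih => simp [nw, ih]

lemma nv_nw (l n : ℕ) (h : n < q ^ l) : nv cd (nw cd l n) = n := by
  induction l generalizing n with
  | zero => simp at h; simp [nw, nv, h]
  | succ l ih =>
    have : n / q < q ^ l := Nat.div_lt_of_lt_mul (by rw [pow_succ, mul_comm] at h; exact h)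
    simp [nw, nv, ih _ this, Nat.mod_add_div]

lemma nw_nv (w : List Γ) : nw cd w.length (nv cd w) = w := by
  induction w with
  | nil => rfl
  | cons z w ih =>
    have h0 : 0 < q := Nat.pos_of_ne_zero (NeZero.ne q)
    have e1 : Fin.ofNat q (cd z + q * nv cd w) = cd z := by
      ext; simp [Nat.mod_eq_of_lt]
    have e2 : (cd z + q * nv cd w) / q = nv cd w := by
      rw [Nat.add_mul_div_left _ _ h0, Nat.div_eq_of_lt (cd z).2, zero_add]
    simp only [List.length_cons, nw, nv, e1, e2, ih, Equiv.symm_apply_apply]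

lemma nv_lt (w : List Γ) : nv cd w < q ^ w.length := by
  induction w with
  | nil => simp [nv]
  | cons z w ih =>
    have := (cd z).2
    simp only [nv, List.length_cons, pow_succ]
    nlinarith

lemma nw_inj {l m n : ℕ} (hm : m < q ^ l) (hn : n < q ^ l) (h : nw cd l m = nw cd l n) :
    m = n := by
  rw [← nv_nw cd l m hm, h, nv_nw cd l n hn]

lemma nw_zero (l : ℕ) : nw cd l 0 = List.replicate l (cd.symm 0) := by
  induction l with
  | zero => rfl
  | succ l ih => rw [nw, Nat.zero_div, ih, List.replicate_succ]; rfl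

lemma incc_false (w : List Γ) : incc cd false w = (false, w) := by
  induction w with
  | nil => rfl
  | cons z w ih => simp [incc, incl, ih]

lemma incc_nw (l n : ℕ) (h : n < q ^ l) :
    incc cd true (nw cd l n) = (decide (n + 1 = q ^ l), nw cd l (n + 1)) := by
  have h0 : 0 < q := Nat.pos_of_ne_zero (NeZero.ne q)
  induction l generalizing n with
  | zero => simp at h; simp [h, nw, incc]
  | succ l ih =>
    have h1 : n / q < q ^ l := Nat.div_lt_of_lt_mul (by rw [pow_succ, mul_comm] at h; exact h)
    have hm := Nat.mod_lt n h0
    have hd := Nat.mod_add_div n q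
    have e3 : Fin.ofNat q (n % q + 1) = Fin.ofNat q (n + 1) := by
      ext; simp
    simp only [nw, incc, incl, if_true, Equiv.apply_symm_apply, Fin.val_ofNat, e3]
    by_cases hc : n % q + 1 = q
    · have e1 : (n + 1) / q = n / q + 1 := by
        rw [Nat.succ_div_of_dvd]
        exact ⟨n / q + 1, by rw [mul_add]; omega⟩
      simp only [hc, decide_true, ih _ h1, e1]
      congr 1
      rw [decide_eq_decide, pow_succ]
      constructor
      · intro e; rw [← e]; nlinarith
      · intro e
        have : q * (n / q + 1) = q * q ^ l := by rw [mul_add, mul_comm q (q ^ l), ← e]; omega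
        exact Nat.eq_of_mul_eq_mul_left h0 this
    · have e1 : (n + 1) / q = n / q := by
        rw [Nat.succ_div_of_not_dvd]
        intro hd
        have := Nat.succ_mod_succ_eq_zero_iff (a := n) (b := q - 1)
        rw [Nat.sub_add_cancel h0] at this
        have := this.1 (Nat.mod_eq_zero_of_dvd hd)
        omega
      have e2 : n + 1 ≠ q ^ (l + 1) := by
        intro e
        have : q ∣ n + 1 := ⟨q ^ l, by rw [e, pow_succ, mul_comm]⟩
        have h3 := Nat.succ_mod_succ_eq_zero_iff (a := n) (b := q - 1)
        rw [Nat.sub_add_cancel h0] at h3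
        have := h3.1 (Nat.mod_eq_zero_of_dvd this)
        omega
      simp only [hc, decide_false, incc_false, e1, e2]

end Numerals

/-- The zero letter. -/
def z0 : Cell := (0, 0, false)

instance : NeZero kap := ⟨by have := four_le_kap; omega⟩

/-- A numbering of the letters in which the zero letter comes first. -/
def cellE : Cell ≃ Fin kap :=
  (Fintype.equivFin Cell).trans (Equiv.swap (Fintype.equivFin Cell z0) (0 : Fin kap))

lemma cellE_z0 : cellE z0 = 0 :=
  Equiv.swap_apply_left (Fintype.equivFin Cell z0) (0 : Fin kap)

lemma cellE_symm_zero : cellE.symm 0 = z0 := by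
  rw [Equiv.symm_apply_eq, cellE_z0]

/-- The induced numbering of pairs of letters. -/
def pairE : Cell × Cell ≃ Fin (kap * kap) := (cellE.prodCongr cellE).trans finProdFinEquiv

lemma pairE_symm_zero : pairE.symm 0 = (z0, z0) := by
  rw [Equiv.symm_apply_eq]
  ext
  simp [pairE, cellE_z0, finProdFinEquiv]

/-- Forward zipped sweep. -/
def sw (δ : Cell → Cell → Cell → Cell × Cell × Cell) :
    Cell → List Cell → List Cell → Cell × List Cell × List Cell
  | s, a :: as, b :: bs =>
    ((sw δ (δ s a b).1 as bs).1, (δ s a b).2.1 :: (sw δ (δ s a b).1 as bs).2.1,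
      (δ s a b).2.2 :: (sw δ (δ s a b).1 as bs).2.2)
  | s, _, _ => (s, [], [])

/-- Backward zipped sweep. -/
def swr (δ : Cell → Cell → Cell → Cell × Cell × Cell) :
    Cell → List Cell → List Cell → Cell × List Cell × List Cell
  | s, a :: as, b :: bs =>
    ((δ (swr δ s as bs).1 a b).1, (δ (swr δ s as bs).1 a b).2.1 :: (swr δ s as bs).2.1,
      (δ (swr δ s as bs).1 a b).2.2 :: (swr δ s as bs).2.2)
  | s, _, _ => (s, [], [])

/-- Zipped sweep in a given direction (`true` is forward). -/
def swd (d : Bool) (δ : Cell → Cell → Cell → Cell × Cell × Cell) :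
    Cell → List Cell → List Cell → Cell × List Cell × List Cell :=
  if d then sw δ else swr δ

/-- Forward sweep over one word. -/
def sw1 (ε : Cell → Cell → Cell × Cell) : Cell → List Cell → Cell × List Cell
  | s, [] => (s, [])
  | s, a :: as => ((sw1 ε (ε s a).1 as).1, (ε s a).2 :: (sw1 ε (ε s a).1 as).2)

/-- Backward sweep over one word. -/
def swr1 (ε : Cell → Cell → Cell × Cell) : Cell → List Cell → Cell × List Cell
  | s, [] => (s, [])
  | s, a :: as => ((ε (swr1 ε s as).1 a).1, (ε (swr1 ε s as).1 a).2 :: (swr1 ε s as).2)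

def swd1 (d : Bool) (ε : Cell → Cell → Cell × Cell) : Cell → List Cell → Cell × List Cell :=
  if d then sw1 ε else swr1 ε

/-- Ignoring the second word. -/
def one (ε : Cell → Cell → Cell × Cell) (s a b : Cell) : Cell × Cell × Cell :=
  ((ε s a).1, (ε s a).2, b)

lemma sw_length (δ) (s : Cell) (a b : List Cell) (h : a.length = b.length) :
    (sw δ s a b).2.1.length = a.length ∧ (sw δ s a b).2.2.length = a.length := by
  induction a generalizing s b with
  | nil => cases b <;> simp [sw]
  | cons x a ih => cases b with
    | nil => simp at h
    | cons y b => simp only [List.length_cons, Nat.add_right_cancel_iff] at h; simp [sw, ih _ _ h]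

lemma swr_length (δ) (s : Cell) (a b : List Cell) (h : a.length = b.length) :
    (swr δ s a b).2.1.length = a.length ∧ (swr δ s a b).2.2.length = a.length := by
  induction a generalizing b with
  | nil => cases b <;> simp [swr]
  | cons x a ih => cases b with
    | nil => simp at h
    | cons y b => simp only [List.length_cons, Nat.add_right_cancel_iff] at h; simp [swr, ih _ h]

lemma swd_length (d : Bool) (δ) (s : Cell) (a b : List Cell) (h : a.length = b.length) :
    (swd d δ s a b).2.1.length = a.length ∧ (swd d δ s a b).2.2.length = a.length := by
  unfold swd
  split_ifs
  · exact sw_length δ s a b h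
  · exact swr_length δ s a b h

lemma sw_append (δ) (s : Cell) (a a' b b' : List Cell) (h : a.length = b.length) :
    sw δ s (a ++ a') (b ++ b') =
      ((sw δ (sw δ s a b).1 a' b').1, (sw δ s a b).2.1 ++ (sw δ (sw δ s a b).1 a' b').2.1,
        (sw δ s a b).2.2 ++ (sw δ (sw δ s a b).1 a' b').2.2) := by
  induction a generalizing s b with
  | nil =>
    obtain rfl : b = [] := by simpa using h.symm
    simp [sw]
  | cons x a ih => cases b with
    | nil => simp at h
    | cons y b =>
      simp only [List.length_cons, Nat.add_right_cancel_iff] at h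
      simp [sw, ih _ _ h]

lemma swr_append (δ) (s : Cell) (a a' b b' : List Cell) (h : a.length = b.length) :
    swr δ s (a ++ a') (b ++ b') =
      ((swr δ (swr δ s a' b').1 a b).1, (swr δ (swr δ s a' b').1 a b).2.1 ++ (swr δ s a' b').2.1,
        (swr δ (swr δ s a' b').1 a b).2.2 ++ (swr δ s a' b').2.2) := by
  induction a generalizing b with
  | nil =>
    obtain rfl : b = [] := by simpa using h.symm
    simp [swr]
  | cons x a ih => cases b with
    | nil => simp at h
    | cons y b =>
      simp only [List.length_cons, Nat.add_right_cancel_iff] at h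
      simp [swr, ih _ h]

lemma swd_one (d : Bool) (ε) (s : Cell) (a b : List Cell) (h : a.length = b.length) :
    swd d (one ε) s a b = ((swd1 d ε s a).1, (swd1 d ε s a).2, b) := by
  unfold swd swd1
  cases d
  · simp only [Bool.false_eq_true, if_false]
    induction a generalizing b with
    | nil => obtain rfl : b = [] := by simpa using h.symm
             simp [swr, swr1]
    | cons x a ih => cases b with
      | nil => simp at h
      | cons y b =>
        simp only [List.length_cons, Nat.add_right_cancel_iff] at h
        simp [swr, swr1, ih _ h, one]
  · simp only [if_true]
    induction a generalizing s b with
    | nil => obtain rfl : b = [] := by simpa using h.symm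
             simp [sw, sw1]
    | cons x a ih => cases b with
      | nil => simp at h
      | cons y b =>
        simp only [List.length_cons, Nat.add_right_cancel_iff] at h
        simp [sw, sw1, ih _ _ h, one]

/-- The registers of the programming language. -/
inductive Reg
  | u | v | cnt | it | il | jt | jl | t | r | w | w2
  deriving DecidableEq

instance : Fintype Reg :=
  ⟨{.u, .v, .cnt, .it, .il, .jt, .jl, .t, .r, .w, .w2}, fun f => by cases f <;> simp⟩

/-- The relative length of a register. -/
def Reg.rs : Reg → ℕ
  | .u | .v | .cnt => 1
  | .it | .il | .jt | .jl | .t | .r => c2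
  | .w | .w2 => c1

/-- Another register of the same length. -/
def Reg.dm : Reg → Reg
  | .u => .v | .v => .u | .cnt => .u
  | .it => .il | .il => .it | .jt => .jl | .jl => .jt | .t => .r | .r => .t
  | .w => .w2 | .w2 => .w

lemma Reg.dm_ne (f : Reg) : f ≠ f.dm := by cases f <;> simp [Reg.dm]

lemma Reg.rs_dm (f : Reg) : f.rs = f.dm.rs := by cases f <;> rfl

/-- Programs with finite control `E` and pebbles `P`. -/
inductive Stmt (E P : Type) : Type
  | skip
  | asg (k : E → E)
  | sweep (d : Bool) (i j : Reg) (δ : Cell → Cell → Cell → Cell × Cell × Cell) (s : E → Cell)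
      (k : E → Cell → E)
  | move (s : Fin 3) (S : Set P)
  | test (p : P) (k : E → Bool → E)
  | explore (k : E → Bool → E)
  | seq (a b : Stmt E P)
  | ite (c : E → Bool) (a b : Stmt E P)
  | loop (c : E → Bool) (a : Stmt E P)

/-- Configurations of programs on the space `X`. -/
@[ext] structure St (E P X : Type) where
  e : E
  mem : Reg → List Cell
  x : X
  pos : P → X

/-- The number of points guaranteed by a failed exploration at level `r`. -/
def NN : ℕ → ℕ
  | 0 => 0
  | r + 1 => kap ^ 2 ^ r

/-- The bound on loop iterations at level `r`. -/
def MM (r : ℕ) : ℕ := kap ^ (2 * c2 * 2 ^ r)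

section Semantics
variable {E P X : Type} (act : Fin 3 → X → X) (r : ℕ)

def St.sweep (d : Bool) (i j : Reg) (δ : Cell → Cell → Cell → Cell × Cell × Cell)
    (s : E → Cell) (k : E → Cell → E) (a : St E P X) : St E P X :=
  { a with
    e := k a.e (swd d δ (s a.e) (a.mem i) (a.mem j)).1
    mem := Function.update (Function.update a.mem i (swd d δ (s a.e) (a.mem i) (a.mem j)).2.1) j
      (swd d δ (s a.e) (a.mem i) (a.mem j)).2.2 }

def St.move (act : Fin 3 → X → X) (s : Fin 3) (S : Set P) (a : St E P X) : St E P X :=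
  { a with
    x := act s a.x
    pos := fun p => if p ∈ S ∧ a.pos p = a.x then act s a.x else a.pos p }

/-- Big-step semantics with running time and the set of surely visited points. -/
inductive Ev : Stmt E P → St E P X → ℕ → Set X → St E P X → Prop
  | skip (a) : Ev .skip a 0 ∅ a
  | asg (g) (a : St E P X) : Ev (.asg g) a 1 ∅ { a with e := g a.e }
  | sweep (d i j δ s g) (a : St E P X) (h : NN r ≤ Nat.card X) (hij : i ≠ j)
      (hl : i.rs = j.rs) : Ev (.sweep d i j δ s g) a 1 ∅ (a.sweep d i j δ s g)
  | move (s S) (a : St E P X) (h : NN r ≤ Nat.card X) :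
      Ev (.move s S) a 1 ∅ (a.move act s S)
  | test (p g) (a : St E P X) :
      Ev (.test p g) a 1 {a.x} { a with e := g a.e (decide (a.pos p = a.x)) }
  | explore (g) (a : St E P X) :
      Ev (.explore g) a 1 (if Nat.card X < NN r then Set.univ else ∅)
        { a with e := g a.e (decide (Nat.card X < NN r)) }
  | seq {s₁ s₂ a b c t₁ t₂ V₁ V₂} (h₁ : Ev s₁ a t₁ V₁ b) (h₂ : Ev s₂ b t₂ V₂ c) :
      Ev (.seq s₁ s₂) a (t₁ + t₂ + 1) (V₁ ∪ V₂) c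
  | ite_true {c s₁ s₂ a b t W} (hc : c a.e = true) (h : Ev s₁ a t W b) :
      Ev (.ite c s₁ s₂) a (t + 1) W b
  | ite_false {c s₁ s₂ a b t W} (hc : c a.e = false) (h : Ev s₂ a t W b) :
      Ev (.ite c s₁ s₂) a (t + 1) W b
  | loop_true {c s a b d t₁ t₂ V₁ V₂} (hc : c a.e = true) (h₁ : Ev s a t₁ V₁ b)
      (h₂ : Ev (.loop c s) b t₂ V₂ d) : Ev (.loop c s) a (t₁ + t₂ + 2) (V₁ ∪ V₂) d
  | loop_false {c s a} (hc : c a.e = false) : Ev (.loop c s) a 1 ∅ a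

end Semantics

/-- Time bound for programs whose loops iterate at most `M` times. -/
def Stmt.tb {E P : Type} (M : ℕ) : Stmt E P → ℕ
  | .skip => 0
  | .seq a b => a.tb M + b.tb M + 1
  | .ite _ a b => a.tb M + b.tb M + 1
  | .loop _ a => (M + 1) * (a.tb M + 2)
  | _ => 1

def Stmt.size {E P : Type} : Stmt E P → ℕ
  | .seq a b => 1 + a.size + b.size
  | .ite _ a b => 1 + a.size + b.size
  | .loop _ a => 2 + a.size
  | _ => 1

lemma Stmt.tb_le {E P : Type} (M : ℕ) (s : Stmt E P) : s.tb M + 1 ≤ (M + 3) ^ s.size := by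
  have key : ∀ (a b m n : ℕ), a + 1 ≤ (M + 3) ^ m → b + 1 ≤ (M + 3) ^ n →
      a + b + 1 + 1 ≤ (M + 3) ^ (1 + m + n) := by
    intro a b m n ha hb
    rw [pow_add, pow_add, pow_one]
    have h1 : 1 ≤ (M + 3) ^ m := Nat.one_le_pow _ _ (by omega)
    have h2 : 1 ≤ (M + 3) ^ n := Nat.one_le_pow _ _ (by omega)
    generalize (M + 3) ^ m = A at *
    generalize (M + 3) ^ n = B at *
    nlinarith [Nat.mul_le_mul h1 h2, mul_nonneg (Nat.zero_le M) (Nat.zero_le (A * B)),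
      Nat.mul_le_mul h1 (le_refl B), Nat.mul_le_mul (le_refl A) h2]
  induction s with
  | seq a b iha ihb => exact key _ _ _ _ iha ihb
  | ite c a b iha ihb => exact key _ _ _ _ iha ihb
  | loop c a ih =>
    simp only [Stmt.tb, Stmt.size, pow_add]
    have h1 : 1 ≤ (M + 3) ^ a.size := Nat.one_le_pow _ _ (by omega)
    generalize (M + 3) ^ a.size = A at *
    nlinarith [Nat.mul_le_mul (le_refl (M + 1)) ih, Nat.zero_le (M * A), Nat.zero_le (M * M * A)]
  | _ => simp [Stmt.tb, Stmt.size]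

section Runs
variable {E P X : Type} (act : Fin 3 → X → X) (r : ℕ)

/-- The program `s` leads from `a` to `b` within the structural time bound, visiting `V`. -/
def Runs (s : Stmt E P) (a : St E P X) (V : Set X) (b : St E P X) : Prop :=
  ∃ t ≤ s.tb (MM r), ∃ V', V ⊆ V' ∧ Ev act r s a t V' b

variable {act r} {s s₁ s₂ : Stmt E P} {a b c d : St E P X} {V V₁ V₂ : Set X}

lemma Runs.mono (h : Runs act r s a V₁ b) (hV : V₂ ⊆ V₁) : Runs act r s a V₂ b := by
  obtain ⟨t, ht, V', h', he⟩ := h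
  exact ⟨t, ht, V', hV.trans h', he⟩

lemma Runs.weaken (h : Runs act r s a V b) : Runs act r s a ∅ b := h.mono (Set.empty_subset _)

lemma Runs.to (h : Runs act r s a V b) (hb : b = c) : Runs act r s a V c := hb ▸ h

lemma runs_skip : Runs act r .skip a ∅ a := ⟨0, le_rfl, ∅, le_rfl, .skip a⟩

lemma runs_asg (k : E → E) : Runs act r (.asg k) a ∅ { a with e := k a.e } :=
  ⟨1, le_rfl, ∅, le_rfl, .asg k a⟩

lemma runs_sweep {d i j δ s k} (h : NN r ≤ Nat.card X) (hij : i ≠ j) (hl : i.rs = j.rs) :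
    Runs act r (.sweep d i j δ s k) a ∅ (a.sweep d i j δ s k) :=
  ⟨1, le_rfl, ∅, le_rfl, .sweep d i j δ s k a h hij hl⟩

lemma runs_move {s S} (h : NN r ≤ Nat.card X) : Runs act r (.move s S) a ∅ (a.move act s S) :=
  ⟨1, le_rfl, ∅, le_rfl, .move s S a h⟩

lemma runs_test (p : P) (k : E → Bool → E) :
    Runs act r (.test p k) a {a.x} { a with e := k a.e (decide (a.pos p = a.x)) } :=
  ⟨1, le_rfl, _, le_rfl, .test p k a⟩

lemma runs_explore (k : E → Bool → E) :
    Runs act r (.explore k) a (if Nat.card X < NN r then Set.univ else ∅)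
      { a with e := k a.e (decide (Nat.card X < NN r)) } :=
  ⟨1, le_rfl, _, le_rfl, .explore k a⟩

lemma Runs.seq (h₁ : Runs act r s₁ a V₁ b) (h₂ : Runs act r s₂ b V₂ c) :
    Runs act r (.seq s₁ s₂) a (V₁ ∪ V₂) c := by
  obtain ⟨t, ht, V', h', he⟩ := h₁
  obtain ⟨t', ht', V'', h'', he'⟩ := h₂
  exact ⟨t + t' + 1, by simp only [Stmt.tb]; omega, _, Set.union_subset_union h' h'', .seq he he'⟩

lemma Runs.then (h₁ : Runs act r s₁ a ∅ b) (h₂ : Runs act r s₂ b V c) :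
    Runs act r (.seq s₁ s₂) a V c := (h₁.seq h₂).mono (by simp)

lemma runs_ite_true {k : E → Bool} (hc : k a.e = true) (h : Runs act r s₁ a V b) :
    Runs act r (.ite k s₁ s₂) a V b := by
  obtain ⟨t, ht, V', h', he⟩ := h
  exact ⟨t + 1, by simp only [Stmt.tb]; omega, _, h', .ite_true hc he⟩

lemma runs_ite_false {k : E → Bool} (hc : k a.e = false) (h : Runs act r s₂ a V b) :
    Runs act r (.ite k s₁ s₂) a V b := by
  obtain ⟨t, ht, V', h', he⟩ := h
  exact ⟨t + 1, by simp only [Stmt.tb]; omega, _, h', .ite_false hc he⟩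

lemma runs_loop {k : E → Bool} (f : ℕ → St E P X) (W : ℕ → Set X) (n : ℕ) (hn : n ≤ MM r)
    (hk : ∀ i < n, k (f i).e = true) (hs : ∀ i < n, Runs act r s (f i) (W i) (f (i + 1)))
    (hend : k (f n).e = false) :
    Runs act r (.loop k s) (f 0) (⋃ i < n, W i) (f n) := by
  have : ∀ m ≤ n, ∃ t ≤ m * (s.tb (MM r) + 2) + 1, ∃ V', (⋃ i, ⋃ (_ : n - m ≤ i ∧ i < n), W i) ⊆ V' ∧
      Ev act r (.loop k s) (f (n - m)) t V' (f n) := by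
    intro m
    induction m with
    | zero =>
      intro _
      refine ⟨1, by omega, ∅, ?_, .loop_false hend⟩
      intro y hy
      simp only [Set.mem_iUnion] at hy
      obtain ⟨i, hi, -⟩ := hy
      omega
    | succ m ih =>
      intro hm
      obtain ⟨t, ht, V', hV', he⟩ := ih (by omega)
      obtain ⟨t', ht', V'', hV'', he'⟩ := hs (n - (m + 1)) (by omega)
      have e : n - (m + 1) + 1 = n - m := by omega
      rw [e] at he'
      refine ⟨t' + t + 2, by rw [add_mul]; omega, _, ?_, .loop_true (hk _ (by omega)) he' he⟩
      intro y hy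
      simp only [Set.mem_iUnion] at hy
      obtain ⟨i, hi, hy⟩ := hy
      rcases Nat.eq_or_lt_of_le hi.1 with h | h
      · subst h; exact Or.inl (hV'' hy)
      · refine Or.inr (hV' ?_)
        simp only [Set.mem_iUnion]
        exact ⟨i, ⟨by omega, hi.2⟩, hy⟩
  obtain ⟨t, ht, V', hV', he⟩ := this n le_rfl
  rw [Nat.sub_self] at he hV'
  refine ⟨t, ?_, V', ?_, he⟩
  · refine ht.trans ?_
    simp only [Stmt.tb, add_mul]
    have := Nat.mul_le_mul_right (s.tb (MM r) + 2) hn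
    omega
  · refine subset_trans ?_ hV'
    intro y hy
    simp only [Set.mem_iUnion] at hy ⊢
    obtain ⟨i, hi, hy⟩ := hy
    exact ⟨i, ⟨by omega, hi⟩, hy⟩

/-- A single-register sweep. -/
def sweep1 (d : Bool) (i : Reg) (ε : Cell → Cell → Cell × Cell) (s : E → Cell)
    (k : E → Cell → E) : Stmt E P := .sweep d i i.dm (one ε) s k

lemma runs_sweep1 {d i ε s k} (h : NN r ≤ Nat.card X)
    (hl : (a.mem i).length = (a.mem i.dm).length) :
    Runs act r (sweep1 d i ε s k) a ∅
      { a with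
        e := k a.e (swd1 d ε (s a.e) (a.mem i)).1
        mem := Function.update a.mem i (swd1 d ε (s a.e) (a.mem i)).2 } := by
  refine (runs_sweep h i.dm_ne i.rs_dm).to ?_
  simp only [St.sweep, swd_one d ε _ _ _ hl, St.mk.injEq, true_and, and_true]
  ext f
  by_cases hf : f = i.dm
  · subst hf
    simp [Function.update_of_ne i.dm_ne.symm]
  · simp [Function.update_of_ne hf]

end Runs

/-- Local control variables of the simulation. -/
@[ext] structure Loc where
  s : Cell := z0
  s2 : Cell := z0
  carry : Bool := false
  same : Bool := false
  seen : Bool := false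
  new : Bool := false
  eqJ : Bool := false
  go : Bool := false
  hit : Bool := false
  ovf : Bool := false

instance : Finite Loc :=
  Finite.of_injective (β := Cell × Cell × Bool × Bool × Bool × Bool × Bool × Bool × Bool × Bool)
    (fun l => (l.s, l.s2, l.carry, l.same, l.seen, l.new, l.eqJ, l.go, l.hit, l.ovf))
    (fun a b h => by
      simp only [Prod.mk.injEq] at h
      ext1 <;> simp [h])

/-- Encoding of a bit by a letter. -/
def bc (c : Bool) : Cell := (0, 0, c)

section Words

def incδ (s z : Cell) : Cell × Cell := (bc (incl cellE s.2.2 z).1, (incl cellE s.2.2 z).2)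

def incδ₂ (s a b : Cell) : Cell × Cell × Cell :=
  (bc (incl pairE s.2.2 (a, b)).1, (incl pairE s.2.2 (a, b)).2)

def cmpδ (s a b : Cell) : Cell × Cell × Cell := (bc (s.2.2 && decide (a = b)), a, b)

def maxδ (s a : Cell) : Cell × Cell := (bc (s.2.2 && decide ((cellE a : ℕ) + 1 = kap)), a)

instance : NeZero (kap * kap) := ⟨mul_ne_zero (NeZero.ne kap) (NeZero.ne kap)⟩

lemma sw1_incδ (c : Bool) (w : List Cell) :
    sw1 incδ (bc c) w = (bc (incc cellE c w).1, (incc cellE c w).2) := by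
  induction w generalizing c with
  | nil => rfl
  | cons z w ih => simp only [sw1, incc, incδ, ih]; rfl

lemma sw_incδ₂ (c : Bool) (w : List (Cell × Cell)) :
    sw incδ₂ (bc c) (w.map Prod.fst) (w.map Prod.snd) =
      (bc (incc pairE c w).1, (incc pairE c w).2.map Prod.fst, (incc pairE c w).2.map Prod.snd) := by
  induction w generalizing c with
  | nil => rfl
  | cons z w ih => simp only [sw, incc, incδ₂, List.map_cons, ih]; rfl

lemma sw_cmpδ (c : Bool) (a b : List Cell) (h : a.length = b.length) :
    sw cmpδ (bc c) a b = (bc (c && decide (a = b)), a, b) := by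
  induction a generalizing c b with
  | nil => obtain rfl : b = [] := by simpa using h.symm
           simp [sw]
  | cons x a ih => cases b with
    | nil => simp at h
    | cons y b =>
      simp only [List.length_cons, Nat.add_right_cancel_iff] at h
      simp only [sw, cmpδ, ih _ _ h]
      simp only [bc, List.cons.injEq, Bool.decide_and, Bool.and_assoc]

lemma sw1_maxδ (c : Bool) (w : List Cell) :
    sw1 maxδ (bc c) w = (bc (c && (w.all fun a => decide ((cellE a : ℕ) + 1 = kap))), w) := by
  induction w generalizing c with
  | nil => simp [sw1]
  | cons z w ih => simp only [sw1, maxδ, ih]; simp [bc, Bool.and_assoc]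

lemma all_max_iff (w : List Cell) :
    (w.all fun a => decide ((cellE a : ℕ) + 1 = kap)) =
      decide (nv cellE w + 1 = kap ^ w.length) := by
  induction w with
  | nil => simp [nv]
  | cons z w ih =>
    rw [List.all_cons, ih, ← Bool.decide_and, decide_eq_decide, nv, List.length_cons, pow_succ]
    have h1 := (cellE z).2
    have h2 := nv_lt cellE w
    have h4 := four_le_kap
    constructor
    · rintro ⟨e1, e2⟩
      rw [← e2]
      nlinarith
    · intro e
      have h3 : nv cellE w + 1 = kap ^ w.length := by
        by_contra hne
        have h5 : nv cellE w + 1 + 1 ≤ kap ^ w.length := by omega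
        have := Nat.mul_le_mul_left kap h5
        rw [mul_add, mul_add] at this
        nlinarith
      refine ⟨?_, h3⟩
      rw [← h3] at e
      nlinarith

lemma sw1_const (c : Cell) (s : Cell) (w : List Cell) :
    sw1 (fun s _ => (s, c)) s w = (s, List.replicate w.length c) := by
  induction w with
  | nil => rfl
  | cons z w ih => simp only [sw1, ih]; rfl

lemma sw_copy (s : Cell) (a b : List Cell) (h : a.length = b.length) :
    sw (fun s a _ => (s, a, a)) s a b = (s, a, a) := by
  induction a generalizing b with
  | nil => obtain rfl : b = [] := by simpa using h.symm
           rfl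
  | cons x a ih => cases b with
    | nil => simp at h
    | cons y b =>
      simp only [List.length_cons, Nat.add_right_cancel_iff] at h
      simp only [sw, ih _ h]

lemma swr1_head (s : Cell) (w : List Cell) :
    swr1 (fun _ z => (z, z)) s w = (w.head?.getD s, w) := by
  induction w with
  | nil => rfl
  | cons z w ih => simp [swr1, ih]

lemma sw1_last (s : Cell) (w : List Cell) :
    sw1 (fun _ z => (z, z)) s w = (w.getLast?.getD s, w) := by
  induction w generalizing s with
  | nil => rfl
  | cons z w ih => simp [sw1, ih, List.getLast?_cons]

lemma swr1_shift (s : Cell) (w : List Cell) :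
    swr1 (fun s z => (z, s)) s w = (w.head?.getD s, (w ++ [s]).tail) := by
  induction w with
  | nil => rfl
  | cons z w ih => simp only [swr1, ih]; cases w <;> simp

lemma sw1_shift (s : Cell) (w : List Cell) :
    (sw1 (fun s z => (z, s)) s w).2 = (s :: w).dropLast := by
  induction w generalizing s with
  | nil => rfl
  | cons z w ih => simp [sw1, ih]

lemma rotate_one_eq (w : List Cell) (h : w ≠ []) :
    w.rotate 1 = (w ++ [w.head?.getD z0]).tail := by
  cases w with
  | nil => simp at h
  | cons z w => simp

lemma rotate_pred_eq (w : List Cell) (h : w ≠ []) :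
    w.rotate (w.length - 1) = (w.getLast?.getD z0 :: w).dropLast := by
  induction w using List.reverseRecOn with
  | nil => simp at h
  | append_singleton w z _ =>
    simp only [List.length_append, List.length_singleton, Nat.add_sub_cancel]
    rw [List.rotate_append_length_eq]
    simp [List.dropLast_cons_of_ne_nil]

/-- Marking the letters whose lower digits all equal `d`. -/
def markδ (d : Fin 4) (s z : Cell) : Cell × Cell :=
  (bc (s.2.2 && decide (z.2.1 = d)), (z.1, z.2.1, s.2.2))

def allD (d : Fin 4) (w : List Cell) : Bool := w.all fun z => decide (z.2.1 = d)

def mkD (d : Fin 4) : List Cell → List Cell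
  | [] => []
  | z :: w => (z.1, z.2.1, allD d w) :: mkD d w

lemma length_mkD (d : Fin 4) (w : List Cell) : (mkD d w).length = w.length := by
  induction w with
  | nil => rfl
  | cons z w ih => simp [mkD, ih]

lemma swr1_mark (d : Fin 4) (w : List Cell) :
    swr1 (markδ d) (bc true) w = (bc (allD d w), mkD d w) := by
  induction w with
  | nil => rfl
  | cons z w ih =>
    simp only [swr1, ih]
    simp only [markδ, mkD, bc, allD, List.all_cons, Bool.and_comm]

def tickδ (s z : Cell) : Cell × Cell :=
  if z.2.2 then
    ((z.1 + gn (s.1 (z.2.1 + 1)), z.2.1 + 1, false), (z.1 + gn (s.1 (z.2.1 + 1)), z.2.1 + 1, false))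
  else ((z.1, z.2.1, false), (z.1, z.2.1, false))

lemma sw1_tick (s : Cell) (w : List Cell) :
    (sw1 tickδ s (mkD 3 w)).1.1 = (tkw s.1 w).2 ∧ (sw1 tickδ s (mkD 3 w)).2 = (tkw s.1 w).1 := by
  induction w generalizing s with
  | nil => exact ⟨rfl, rfl⟩
  | cons z w ih =>
    simp only [mkD, sw1, tkw]
    have e : allD 3 w = all3 w := rfl
    rw [e]
    by_cases h : all3 w = true
    · simp only [h, if_true, tickδ]
      exact ⟨(ih _).1, by rw [(ih _).2]⟩
    · simp only [h, if_false, tickδ, Bool.false_eq_true]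
      exact ⟨(ih _).1, by rw [(ih _).2]⟩

def untickδ (s z : Cell) : Cell × Cell :=
  (z, if z.2.2 then (z.1 - gn (s.1 z.2.1), z.2.1 - 1, false) else (z.1, z.2.1, false))

lemma sw1_untick (s : Cell) (w : List Cell) :
    (sw1 untickδ s (mkD 0 w)).1.1 = bot s.1 w ∧ (sw1 untickδ s (mkD 0 w)).2 = utw s.1 w := by
  induction w generalizing s with
  | nil => exact ⟨rfl, rfl⟩
  | cons z w ih =>
    simp only [mkD, sw1, utw, bot, untickδ]
    have e : allD 0 w = all0 w := rfl
    rw [e]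
    exact ⟨(ih _).1, by rw [(ih _).2]⟩

end Words

/-- All registers have the right length. -/
def WF (r : ℕ) (m : Reg → List Cell) : Prop := ∀ f, (m f).length = f.rs * 2 ^ r

lemma WF.update {r : ℕ} {m : Reg → List Cell} (h : WF r m) {f : Reg} {w : List Cell}
    (hw : w.length = f.rs * 2 ^ r) : WF r (Function.update m f w) := by
  intro g
  by_cases hg : g = f
  · subst hg; simpa using hw
  · simpa [Function.update_of_ne hg] using h g

lemma WF.dm {r : ℕ} {m : Reg → List Cell} (h : WF r m) (f : Reg) :
    (m f).length = (m f.dm).length := by rw [h, h, ← f.rs_dm]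

/-- The registers holding the two indices. -/
def tr (i : Bool) : Reg := if i then .it else .jt
def lr (i : Bool) : Reg := if i then .il else .jl

/-- The words of the index `n` for words of length `l`. -/
def ixT (l n : ℕ) : List Cell := (nw pairE l n).map Prod.fst
def ixL (l n : ℕ) : List Cell := (nw pairE l n).map Prod.snd

@[simp] lemma length_ixT (l n : ℕ) : (ixT l n).length = l := by simp [ixT]
@[simp] lemma length_ixL (l n : ℕ) : (ixL l n).length = l := by simp [ixL]

section Prims
variable {E P : Type}

def inc1 (f : Reg) (k : E → Bool → E) : Stmt E P :=
  sweep1 true f incδ (fun _ => bc true) fun e z => k e z.2.2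

def inc2 (i : Bool) (k : E → Bool → E) : Stmt E P :=
  .sweep true (tr i) (lr i) incδ₂ (fun _ => bc true) fun e z => k e z.2.2

def cmpw (i j : Reg) (k : E → Bool → E) : Stmt E P :=
  .sweep true i j cmpδ (fun _ => bc true) fun e z => k e z.2.2

def ismax (f : Reg) (k : E → Bool → E) : Stmt E P :=
  sweep1 true f maxδ (fun _ => bc true) fun e z => k e z.2.2

def fill (c : Cell) (f : Reg) : Stmt E P :=
  sweep1 true f (fun s _ => (s, c)) (fun _ => z0) fun e _ => e

def copy (i j : Reg) : Stmt E P :=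
  .sweep true i j (fun s a _ => (s, a, a)) (fun _ => z0) fun e _ => e

variable {X : Type} {act : Fin 3 → X → X} {r : ℕ} {a : St E P X}

lemma runs_inc1 (hN : NN r ≤ Nat.card X) (hW : WF r a.mem) {f : Reg} {k : E → Bool → E} {n : ℕ}
    (hn : n < kap ^ (f.rs * 2 ^ r)) (hm : a.mem f = nw cellE (f.rs * 2 ^ r) n) :
    Runs act r (inc1 f k) a ∅
      { a with
        e := k a.e (decide (n + 1 = kap ^ (f.rs * 2 ^ r)))
        mem := Function.update a.mem f (nw cellE (f.rs * 2 ^ r) (n + 1)) } := by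
  refine (runs_sweep1 hN (hW.dm f)).to ?_
  simp only [swd1, if_true, hm, sw1_incδ, incc_nw cellE _ _ hn]
  rfl

lemma runs_inc2 (hN : NN r ≤ Nat.card X) {i : Bool} {k : E → Bool → E} {n : ℕ}
    (hn : n < (kap * kap) ^ (c2 * 2 ^ r)) (hm : a.mem (tr i) = ixT (c2 * 2 ^ r) n)
    (hm' : a.mem (lr i) = ixL (c2 * 2 ^ r) n) :
    Runs act r (inc2 i k) a ∅
      { a with
        e := k a.e (decide (n + 1 = (kap * kap) ^ (c2 * 2 ^ r)))
        mem := Function.update (Function.update a.mem (tr i) (ixT (c2 * 2 ^ r) (n + 1))) (lr i)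
          (ixL (c2 * 2 ^ r) (n + 1)) } := by
  refine (runs_sweep hN (by cases i <;> simp [tr, lr]) (by cases i <;> rfl)).to ?_
  simp only [St.sweep, swd, if_true, hm, hm', ixT, ixL, sw_incδ₂, incc_nw pairE _ _ hn]
  rfl

lemma runs_cmp (hN : NN r ≤ Nat.card X) (hW : WF r a.mem) {i j : Reg} {k : E → Bool → E}
    (hij : i ≠ j) (hl : i.rs = j.rs) :
    Runs act r (cmpw i j k) a ∅ { a with e := k a.e (decide (a.mem i = a.mem j)) } := by
  refine (runs_sweep hN hij hl).to ?_
  simp only [St.sweep, swd, if_true, sw_cmpδ true _ _ (show (a.mem i).length = (a.mem j).length by rw [hW, hW, hl]),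
    Function.update_eq_self]
  rfl

lemma runs_ismax (hN : NN r ≤ Nat.card X) (hW : WF r a.mem) {f : Reg} {k : E → Bool → E} :
    Runs act r (ismax f k) a ∅
      { a with e := k a.e (decide (nv cellE (a.mem f) + 1 = kap ^ (f.rs * 2 ^ r))) } := by
  refine (runs_sweep1 hN (hW.dm f)).to ?_
  simp only [swd1, if_true, sw1_maxδ, all_max_iff, Function.update_eq_self, hW f]
  rfl

lemma runs_fill (hN : NN r ≤ Nat.card X) (hW : WF r a.mem) {c : Cell} {f : Reg} :
    Runs act r (fill c f) a ∅
      { a with mem := Function.update a.mem f (List.replicate (f.rs * 2 ^ r) c) } := by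
  refine (runs_sweep1 hN (hW.dm f)).to ?_
  simp only [swd1, if_true, sw1_const, hW f]

lemma runs_copy (hN : NN r ≤ Nat.card X) (hW : WF r a.mem) {i j : Reg}
    (hij : i ≠ j) (hl : i.rs = j.rs) :
    Runs act r (copy i j) a ∅ { a with mem := Function.update a.mem j (a.mem i) } := by
  refine (runs_sweep hN hij hl).to ?_
  simp only [St.sweep, swd, if_true, sw_copy _ _ _ (show (a.mem i).length = (a.mem j).length by
    rw [hW, hW, hl]), Function.update_eq_self]

end Prims

section Steps
variable {E P : Type}

abbrev Prog (E P : Type) := Stmt (E × Loc) P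

def mark (d : Fin 4) : Prog E P :=
  sweep1 false .w (markδ d) (fun _ => bc true) fun e z => (e.1, { e.2 with carry := z.2.2 })

def head : Prog E P :=
  sweep1 false .r (fun _ z => (z, z)) (fun _ => z0) fun e z => (e.1, { e.2 with s := z })

def rotl : Prog E P :=
  .seq head <| sweep1 false .r (fun s z => (z, s)) (fun e => e.2.s) fun e _ => e

def rotr : Prog E P :=
  .seq (sweep1 true .r (fun _ z => (z, z)) (fun _ => z0) fun e z => (e.1, { e.2 with s := z })) <|
    sweep1 true .r (fun s z => (z, s)) (fun e => e.2.s) fun e _ => e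

def mvs (S : Set P) : Prog E P :=
  .ite (fun e => decide (cmap e.2.s.1 = some 0)) (.move 0 S) <|
  .ite (fun e => decide (cmap e.2.s.1 = some 1)) (.move 1 S) <|
  .ite (fun e => decide (cmap e.2.s.1 = some 2)) (.move 2 S) .skip

def clr : Prog E P := .asg fun e => (e.1, { e.2 with s := z0, carry := false })

def fwdStep (S : Set P) : Prog E P :=
  .seq (mark 3) <| .seq (.ite (fun e => e.2.carry) rotl .skip) <| .seq head <|
  .seq (sweep1 true .w tickδ (fun e => e.2.s) fun e z => (e.1, { e.2 with s := z })) <|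
  .seq (mvs S) clr

def bwdStep (S : Set P) : Prog E P :=
  .seq (mark 0) <| .seq head <|
  .seq (sweep1 true .w untickδ (fun e => e.2.s) fun e z => (e.1, { e.2 with s := z })) <|
  .seq (mvs S) <| .seq (.ite (fun e => e.2.carry) rotr .skip) clr

variable {X : Type} {act : Fin 3 → X → X} {r : ℕ} {a : St (E × Loc) P X}

lemma runs_mark (hN : NN r ≤ Nat.card X) (hW : WF r a.mem) (d : Fin 4) :
    Runs act r (mark d) a ∅
      { a with
        e := (a.e.1, { a.e.2 with carry := allD d (a.mem .w) })
        mem := Function.update a.mem .w (mkD d (a.mem .w)) } := by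
  refine (runs_sweep1 hN (hW.dm _)).to ?_
  simp only [swd1, Bool.false_eq_true, if_false, swr1_mark]
  rfl

lemma runs_head (hN : NN r ≤ Nat.card X) (hW : WF r a.mem) :
    Runs act r head a ∅
      { a with e := (a.e.1, { a.e.2 with s := (a.mem .r).head?.getD z0 }) } := by
  refine (runs_sweep1 hN (hW.dm _)).to ?_
  simp only [swd1, Bool.false_eq_true, if_false, swr1_head, Function.update_eq_self]

lemma rs_pos (f : Reg) : 0 < f.rs := by
  have := four_le_kap
  have h1 : 0 < c1 := by unfold c1; omega
  have h2 : 0 < c2 := by unfold c2; positivity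
  cases f <;> simp [Reg.rs, h1, h2]

lemma WF.ne_nil {m : Reg → List Cell} (h : WF r m) (f : Reg) : m f ≠ [] := by
  rw [← List.length_pos_iff, h f]
  have := rs_pos f
  positivity

lemma runs_rotl (hN : NN r ≤ Nat.card X) (hW : WF r a.mem) :
    Runs act r (.ite (fun e => e.2.carry) rotl .skip) a ∅
      { a with
        e := (a.e.1, { a.e.2 with s := if a.e.2.carry then (a.mem .r).head?.getD z0 else a.e.2.s })
        mem := Function.update a.mem .r
          (if a.e.2.carry then (a.mem .r).rotate 1 else a.mem .r) } := by
  by_cases h : a.e.2.carry = true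
  · refine runs_ite_true h (Runs.then (runs_head hN hW) (Runs.to (runs_sweep1 hN (hW.dm .r)) ?_))
    simp only [swd1, Bool.false_eq_true, if_false, swr1_shift, h, if_true,
      rotate_one_eq _ (hW.ne_nil .r)]
  · rw [Bool.not_eq_true] at h
    refine runs_ite_false h (runs_skip.to ?_)
    rcases a with ⟨⟨e, ⟨⟩⟩, m, x, p⟩
    simp_all

lemma runs_rotr (hN : NN r ≤ Nat.card X) (hW : WF r a.mem) :
    Runs act r (.ite (fun e => e.2.carry) rotr .skip) a ∅
      { a with
        e := (a.e.1, { a.e.2 with s := if a.e.2.carry then (a.mem .r).getLast?.getD z0 else a.e.2.s })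
        mem := Function.update a.mem .r
          (if a.e.2.carry then (a.mem .r).rotate ((a.mem .r).length - 1) else a.mem .r) } := by
  by_cases h : a.e.2.carry = true
  · refine runs_ite_true h (Runs.then (Runs.to (runs_sweep1 hN (hW.dm .r)) ?_)
      ((runs_sweep1 (a := { a with
        e := (a.e.1, { a.e.2 with s := (a.mem .r).getLast?.getD z0 }) }) hN (hW.dm .r)).to ?_))
    · simp only [swd1, if_true, sw1_last, Function.update_eq_self]
    · simp only [swd1, if_true, sw1_shift, h, rotate_pred_eq _ (hW.ne_nil .r)]
  · rw [Bool.not_eq_true] at h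
    refine runs_ite_false h (runs_skip.to ?_)
    rcases a with ⟨⟨e, ⟨⟩⟩, m, x, p⟩
    simp_all

lemma runs_mvs (hN : NN r ≤ Nat.card X) {S : Set P} (hS : ∀ p ∈ S, a.pos p = a.x) :
    Runs act r (mvs S) a ∅
      { a with
        x := bact act (cmap a.e.2.s.1) a.x
        pos := fun p => if p ∈ S then bact act (cmap a.e.2.s.1) a.x else a.pos p } := by
  have key : ∀ s, cmap a.e.2.s.1 = some s → a.move act s S = { a with
        x := bact act (cmap a.e.2.s.1) a.x
        pos := fun p => if p ∈ S then bact act (cmap a.e.2.s.1) a.x else a.pos p } := by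
    intro s hs
    simp only [St.move, hs, bact, St.mk.injEq, true_and]
    funext p
    by_cases hp : p ∈ S <;> simp [hp, hS]
  rcases h : cmap a.e.2.s.1 with _ | s
  · refine runs_ite_false (by simp [h]) (runs_ite_false (by simp [h]) (runs_ite_false (by simp [h])
      (runs_skip.to ?_)))
    ext1 <;> simp [bact]
    funext p
    by_cases hp : p ∈ S <;> simp [hp, hS]
  · rw [← h]
    fin_cases s
    · exact runs_ite_true (by simpa using h) ((runs_move hN).to (key _ h))
    · exact runs_ite_false (by simp [h]) (runs_ite_true (by simpa using h)
        ((runs_move hN).to (key _ h)))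
    · exact runs_ite_false (by simp [h]) (runs_ite_false (by simp [h])
        (runs_ite_true (by simpa using h) ((runs_move hN).to (key _ h))))

lemma runs_fwdStep (hN : NN r ≤ Nat.card X) (hW : WF r a.mem) {S : Set P}
    (hS : ∀ p ∈ S, a.pos p = a.x) (hs : a.e.2.s = z0) (hc : a.e.2.carry = false) :
    Runs act r (fwdStep S) a ∅
      { a with
        mem := Function.update (Function.update a.mem .r (fwdS act (a.mem .r, a.mem .w, a.x)).1) .w
          (fwdS act (a.mem .r, a.mem .w, a.x)).2.1
        x := (fwdS act (a.mem .r, a.mem .w, a.x)).2.2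
        pos := fun p => if p ∈ S then (fwdS act (a.mem .r, a.mem .w, a.x)).2.2 else a.pos p } := by
  have h3 : allD 3 (a.mem .w) = all3 (a.mem .w) := rfl
  refine (runs_mark hN hW 3).then ?_
  have hW1 := hW.update (f := .w) (w := mkD 3 (a.mem .w)) (by rw [length_mkD, hW])
  refine (runs_rotl hN hW1).then ?_
  have hW2 := hW1.update (f := .r) (w := if allD 3 (a.mem .w) then (a.mem .r).rotate 1 else a.mem .r)
    (by split_ifs <;> simp [hW .r])
  simp only [ne_eq, reduceCtorEq, not_false_eq_true, Function.update_of_ne]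
  refine Runs.then (runs_head hN hW2) (Runs.then (runs_sweep1 hN (hW2.dm .w))
    (Runs.then (runs_mvs hN hS) (Runs.to (runs_asg _) ?_)))
  simp only [swd1, if_true, ne_eq, reduceCtorEq, not_false_eq_true, Function.update_of_ne,
    Function.update_self, sw1_tick, h3]
  have e : ∀ l : Loc, l.s = z0 → l.carry = false → { l with s := z0, carry := false } = l := by
    rintro ⟨⟩ h1 h2; simp_all
  ext1
  · exact Prod.ext rfl (e _ hs hc)
  · funext f
    cases f <;> simp [fwdS, hdl, z0]
  · simp [fwdS, hdl, z0]
  · simp [fwdS, hdl, z0]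

lemma runs_bwdStep (hN : NN r ≤ Nat.card X) (hW : WF r a.mem) {S : Set P}
    (hS : ∀ p ∈ S, a.pos p = a.x) (hs : a.e.2.s = z0) (hc : a.e.2.carry = false) :
    Runs act r (bwdStep S) a ∅
      { a with
        mem := Function.update (Function.update a.mem .r (bwdS act (a.mem .r, a.mem .w, a.x)).1) .w
          (bwdS act (a.mem .r, a.mem .w, a.x)).2.1
        x := (bwdS act (a.mem .r, a.mem .w, a.x)).2.2
        pos := fun p => if p ∈ S then (bwdS act (a.mem .r, a.mem .w, a.x)).2.2 else a.pos p } := by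
  have h0 : allD 0 (a.mem .w) = all0 (a.mem .w) := rfl
  refine (runs_mark hN hW 0).then ?_
  have hW1 := hW.update (f := .w) (w := mkD 0 (a.mem .w)) (by rw [length_mkD, hW])
  refine (runs_head hN hW1).then ?_
  refine Runs.then (runs_sweep1 hN (hW1.dm .w)) ?_
  simp only [swd1, if_true, ne_eq, reduceCtorEq, not_false_eq_true, Function.update_of_ne,
    Function.update_self, sw1_untick, h0, Function.update_idem]
  refine Runs.then (runs_mvs hN hS) ?_
  have hW2 := hW.update (f := .w) (w := utw ((a.mem .r).head?.getD z0).1 (a.mem .w))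
    (by rw [length_utw, hW])
  refine Runs.then (runs_rotr hN hW2) (Runs.to (runs_asg _) ?_)
  have e : ∀ l : Loc, l.s = z0 → l.carry = false → { l with s := z0, carry := false } = l := by
    rintro ⟨⟩ h1 h2; simp_all
  ext1
  · exact Prod.ext rfl (e _ hs hc)
  · funext f
    cases f <;> simp [bwdS, hdl, z0]
  · simp [sw1_untick, bwdS, hdl, z0]
  · simp [sw1_untick, bwdS, hdl, z0]

end Steps

/-- The zero word of a register. -/
def zw (r : ℕ) (f : Reg) : List Cell := List.replicate (f.rs * 2 ^ r) z0

@[simp] lemma length_zw (r : ℕ) (f : Reg) : (zw r f).length = f.rs * 2 ^ r := by simp [zw]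

lemma nw_cellE_zero (r : ℕ) (f : Reg) : nw cellE (f.rs * 2 ^ r) 0 = zw r f := by
  rw [nw_zero, cellE_symm_zero, zw]

lemma ixT_zero (r : ℕ) (i : Bool) : ixT (c2 * 2 ^ r) 0 = zw r (tr i) := by
  rw [ixT, nw_zero, pairE_symm_zero, List.map_replicate]
  cases i <;> rfl

lemma ixL_zero (r : ℕ) (i : Bool) : ixL (c2 * 2 ^ r) 0 = zw r (lr i) := by
  rw [ixL, nw_zero, pairE_symm_zero, List.map_replicate]
  cases i <;> rfl

/-- The number of steps and the endpoint of the walk with index `n`. -/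
def tau (r n : ℕ) : ℕ := nv cellE (ixT (c2 * 2 ^ r) n)

def yy {X : Type} (act : Fin 3 → X → X) (r : ℕ) (x : X) (n : ℕ) : X :=
  ypos act (2 ^ r) x (ixL (c2 * 2 ^ r) n) (tau r n)

lemma nw_tau (r n : ℕ) : nw cellE (c2 * 2 ^ r) (tau r n) = ixT (c2 * 2 ^ r) n := by
  have := nw_nv cellE (ixT (c2 * 2 ^ r) n)
  rwa [length_ixT] at this

lemma tau_lt (r n : ℕ) : tau r n < kap ^ (c2 * 2 ^ r) := by
  have := nv_lt cellE (ixT (c2 * 2 ^ r) n)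
  rwa [length_ixT] at this

lemma tau_le_MM (r n : ℕ) : tau r n ≤ MM r := by
  refine (tau_lt r n).le.trans (Nat.pow_le_pow_right (by have := four_le_kap; omega) ?_)
  exact Nat.mul_le_mul_right _ (by omega)

/-- The state of the walk with index `n` after `k` steps. -/
def fwk {X : Type} (act : Fin 3 → X → X) (r : ℕ) (x : X) (n k : ℕ) : List Cell × List Cell × X :=
  (fwdS act)^[k] (ixL (c2 * 2 ^ r) n, W0 (c1 * 2 ^ r), x)

section Walk
variable {E P X : Type} {act : Fin 3 → X → X} {r : ℕ} {a : St (E × Loc) P X}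

lemma fwk_length (x : X) (n k : ℕ) :
    (fwk act r x n k).1.length = c2 * 2 ^ r ∧ (fwk act r x n k).2.1.length = c1 * 2 ^ r := by
  induction k with
  | zero => simp [fwk, W0]
  | succ k ih =>
    simp only [fwk, Function.iterate_succ_apply'] at ih ⊢
    rwa [(fwdS_length _ _).1, (fwdS_length _ _).2]

lemma fwk_flagOff (x : X) (n k : ℕ) : FlagOff (fwk act r x n k).2.1 := by
  cases k with
  | zero =>
    intro z hz
    rw [List.eq_of_mem_replicate hz]
  | succ k =>
    simp only [fwk, Function.iterate_succ_apply']
    exact fwdS_flagOff _ _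

def walk (i : Bool) (body : Prog E P) : Prog E P :=
  .seq (cmpw .t (tr i) fun e c => (e.1, { e.2 with same := c })) <|
  .seq (.loop (fun e => !e.2.same) (.seq body (.seq (inc1 .t fun e _ => e)
    (cmpw .t (tr i) fun e c => (e.1, { e.2 with same := c }))))) <|
  .seq (fill z0 .t) (.asg fun e => (e.1, { e.2 with same := false }))

def withT (r k : ℕ) (a : St (E × Loc) P X) : St (E × Loc) P X :=
  { a with mem := Function.update a.mem .t (nw cellE (c2 * 2 ^ r) k) }

lemma runs_walk (hN : NN r ≤ Nat.card X) {i : Bool} {body : Prog E P}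
    (g : ℕ → St (E × Loc) P X) (n : ℕ) (hn : n < kap ^ (c2 * 2 ^ r)) (hM : n ≤ MM r)
    (hb : ∀ k < n, Runs act r body (withT r k (g k)) ∅ (withT r k (g (k + 1))))
    (hs : ∀ k, (g k).e.2.same = false) (hm : ∀ k, (g k).mem (tr i) = nw cellE (c2 * 2 ^ r) n)
    (hW : ∀ k, WF r (g k).mem) (ht : ∀ k, (g k).mem .t = zw r .t) :
    Runs act r (walk i body) (g 0) ∅ (g n) := by
  have htr : Reg.t ≠ tr i := by cases i <;> simp [tr]
  have htr' : Reg.t.rs = (tr i).rs := by cases i <;> rfl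
  have hz : nw cellE (c2 * 2 ^ r) 0 = zw r .t := nw_cellE_zero r .t
  have hinj : ∀ k ≤ n, (nw cellE (c2 * 2 ^ r) k = nw cellE (c2 * 2 ^ r) n ↔ k = n) := fun k hk =>
    ⟨nw_inj cellE (by omega) hn, fun h => by rw [h]⟩
  have e1 : ∀ l : Loc, l.same = false → { l with same := false } = l := by
    rintro ⟨⟩ h; simp_all
  have eT : ∀ k, Function.update (g k).mem .t (zw r .t) = (g k).mem := fun k => by
    rw [← ht k, Function.update_eq_self]
  let f : ℕ → St (E × Loc) P X := fun k =>
    { withT r k (g k) with e := ((g k).e.1, { (g k).e.2 with same := decide (k = n) }) }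
  have hf0 : Runs act r (cmpw .t (tr i) fun e c => (e.1, { e.2 with same := c })) (g 0) ∅ (f 0) := by
    refine Runs.to (runs_cmp hN (hW 0) htr htr') ?_
    simp only [f, withT, hz, eT, ht, hm]
    rw [← hz, decide_eq_decide.2 (hinj 0 (Nat.zero_le _))]
  have hL := runs_loop (act := act) (r := r) (s := .seq body (.seq (inc1 .t fun e _ => e)
      (cmpw .t (tr i) fun e c => (e.1, { e.2 with same := c })))) (k := fun e => !e.2.same)
      f (fun _ => ∅) n hM
      (fun k hk => by simp [f, hk.ne]) ?_ (by simp [f])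
  · refine Runs.then hf0 (Runs.then hL.weaken (Runs.then (runs_fill hN ?_)
      (Runs.to (runs_asg _) ?_)))
    · exact (hW n).update (by simp [Reg.rs])
    · simp only [f, withT, Function.update_idem]
      ext1
      · exact Prod.ext rfl (by simpa using e1 _ (hs n))
      · exact eT n
      · rfl
      · rfl
  · intro k hk
    have h0 : f k = withT r k (g k) := by
      simp only [f, hk.ne, decide_false]
      ext1
      · exact Prod.ext rfl (e1 _ (hs k))
      · rfl
      · rfl
      · rfl
    rw [h0]
    refine Runs.then (hb k hk) (Runs.then (runs_inc1 (n := k) hN ((hW _).update (by simp [Reg.rs]))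
      (show k < kap ^ (c2 * 2 ^ r) by omega) (by simp [withT]; rfl))
      (Runs.to (runs_cmp hN ?_ htr htr') ?_))
    · exact ((hW _).update (by simp [Reg.rs])).update (by simp)
    · simp only [f, withT, Function.update_idem, Function.update_self,
        Function.update_of_ne htr.symm, hm]
      have : nw cellE (Reg.t.rs * 2 ^ r) (k + 1) = nw cellE (c2 * 2 ^ r) (k + 1) := rfl
      rw [this, decide_eq_decide.2 (hinj (k + 1) hk)]

/-- The walk registers are clear. -/
structure Rdy (r : ℕ) (a : St (E × Loc) P X) : Prop where
  wf : WF r a.mem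
  t0 : a.mem .t = zw r .t
  r0 : a.mem .r = zw r .r
  w0 : a.mem .w = zw r .w
  hs : a.e.2.s = z0
  hc : a.e.2.carry = false
  hq : a.e.2.same = false

/-- The configuration with walk state `u` carrying the pebbles in `S`. -/
def gs (a : St (E × Loc) P X) (S : Set P) (u : List Cell × List Cell × X) : St (E × Loc) P X :=
  { a with
    mem := Function.update (Function.update a.mem .r u.1) .w u.2.1
    x := u.2.2
    pos := fun p => if p ∈ S then u.2.2 else a.pos p }

lemma gs_wf (ha : Rdy r a) {S : Set P} (x : X) (n k : ℕ) : WF r (gs a S (fwk act r x n k)).mem :=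
  (ha.wf.update (fwk_length x n k).1).update (fwk_length x n k).2

def goTo (i : Bool) (S : Set P) : Prog E P :=
  .seq (copy (lr i) .r) <| .seq (fill (0, 3, false) .w) (walk i (fwdStep S))

def goBack (i : Bool) (S : Set P) : Prog E P :=
  .seq (walk i (bwdStep S)) <| .seq (fill z0 .r) (fill z0 .w)

lemma lr_ne_r (i : Bool) : lr i ≠ .r := by cases i <;> simp [lr]

lemma tr_ne_r (i : Bool) : tr i ≠ .r := by cases i <;> simp [tr]

lemma tr_ne_w (i : Bool) : tr i ≠ .w := by cases i <;> simp [tr]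

lemma runs_goTo (hN : NN r ≤ Nat.card X) (ha : Rdy r a) {i : Bool} {S : Set P} {n : ℕ}
    (hS : ∀ p ∈ S, a.pos p = a.x) (hT : a.mem (tr i) = ixT (c2 * 2 ^ r) n)
    (hL : a.mem (lr i) = ixL (c2 * 2 ^ r) n) :
    Runs act r (goTo i S) a ∅ (gs a S (fwk act r a.x n (tau r n))) := by
  refine Runs.then (runs_copy hN ha.wf (lr_ne_r i) (by cases i <;> rfl)) (Runs.then
    (runs_fill hN (ha.wf.update (by rw [hL]; simp [Reg.rs]))) ?_)
  have h0 : gs a S (fwk act r a.x n 0) = { a with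
      mem := Function.update (Function.update a.mem .r (ixL (c2 * 2 ^ r) n)) .w (W0 (c1 * 2 ^ r)) } := by
    simp only [gs, fwk, Function.iterate_zero, id_eq, St.mk.injEq, true_and]
    funext p
    by_cases hp : p ∈ S <;> simp [hp, hS]
  rw [hL]
  change Runs act r _ { a with
      mem := Function.update (Function.update a.mem .r (ixL (c2 * 2 ^ r) n)) .w (W0 (c1 * 2 ^ r)) } _ _
  rw [← h0]
  refine runs_walk hN (fun k => gs a S (fwk act r a.x n k)) (tau r n) (tau_lt r n) (tau_le_MM r n)
    ?_ (fun _ => ha.hq) (fun k => ?_) (fun k => gs_wf ha _ _ _) (fun k => ?_)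
  · intro k hk
    refine Runs.to (runs_fwdStep hN ((gs_wf ha _ _ _).update (by simp [Reg.rs])) ?_ ha.hs ha.hc) ?_
    · intro p hp
      simp [withT, gs, hp]
    · simp only [withT, gs, fwk, Function.iterate_succ_apply']
      ext1
      · rfl
      · funext f
        cases f <;> simp
      · simp
      · funext p
        by_cases hp : p ∈ S <;> simp [hp]
  · simp [gs, tr_ne_r, tr_ne_w, hT, nw_tau]
  · simp [gs, ha.t0]

lemma runs_goBack (hN : NN r ≤ Nat.card X) (hi : ∀ s x, act s (act s x) = x) (ha : Rdy r a)
    {i : Bool} {S : Set P} {n : ℕ} {x : X} (hT : a.mem (tr i) = ixT (c2 * 2 ^ r) n) :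
    Runs act r (goBack i S) (gs a S (fwk act r x n (tau r n))) ∅
      { a with x := x, pos := fun p => if p ∈ S then x else a.pos p } := by
  refine Runs.then (b := gs a S (fwk act r x n 0)) ?_ (Runs.then (runs_fill hN (gs_wf ha _ _ _))
    (Runs.to (runs_fill hN ((gs_wf ha _ _ _).update (by simp))) ?_))
  · have := runs_walk (act := act) (i := i) (body := bwdStep S) hN
      (fun k => gs a S (fwk act r x n (tau r n - k))) (tau r n)
      (tau_lt r n) (tau_le_MM r n) ?_ (fun _ => ha.hq) (fun k => ?_) (fun k => gs_wf ha _ _ _)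
      (fun k => ?_)
    · simpa using this
    · intro k hk
      refine Runs.to (runs_bwdStep hN ((gs_wf ha _ _ _).update (by simp [Reg.rs])) ?_ ha.hs ha.hc) ?_
      · intro p hp
        simp [withT, gs, hp]
      · have e1 : bwdS act (fwk act r x n (tau r n - k)) = fwk act r x n (tau r n - (k + 1)) := by
          have e2 : tau r n - k = tau r n - (k + 1) + 1 := by omega
          rw [e2, fwk, Function.iterate_succ_apply']
          exact bwdS_fwdS hi _ (fwk_flagOff _ _ _)
        simp only [withT, gs, ← e1]
        ext1
        · rfl
        · funext f
          cases f <;> simp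
        · simp
        · funext p
          by_cases hp : p ∈ S <;> simp [hp]
    · simp [gs, tr_ne_r, tr_ne_w, hT, nw_tau]
    · simp [gs, ha.t0]
  · ext1
    · rfl
    · funext f
      cases f <;> simp [gs, ha.r0, ha.w0] <;> simp [zw]
    · rfl
    · rfl

/-- Walk to the indexed point carrying `S`, look for `q`, and return, fetching `q` if `bk`. -/
def visit (i : Bool) (S : Set P) (q : P) (bk : Bool) : Prog E P :=
  .seq (goTo i S) <| .seq (.test q fun e c => (e.1, { e.2 with seen := c })) <|
  .ite (fun e => bk && e.2.seen) (goBack i {q}) (goBack i ∅)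

lemma fwk_point (x : X) (n : ℕ) : (fwk act r x n (tau r n)).2.2 = yy act r x n := rfl

lemma runs_visit (hN : NN r ≤ Nat.card X) (hi : ∀ s x, act s (act s x) = x) (ha : Rdy r a)
    {i : Bool} {S : Set P} {n : ℕ} (hS : ∀ p ∈ S, a.pos p = a.x)
    (hT : a.mem (tr i) = ixT (c2 * 2 ^ r) n) (hL : a.mem (lr i) = ixL (c2 * 2 ^ r) n)
    (q : P) (bk : Bool) {pos₁ : P → X}
    (h₁ : pos₁ = fun p => if p ∈ S then yy act r a.x n else a.pos p) :
    Runs act r (visit i S q bk) a {yy act r a.x n}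
      { a with
        e := (a.e.1, { a.e.2 with seen := decide (pos₁ q = yy act r a.x n) })
        pos := fun p => if bk = true ∧ p = q ∧ pos₁ q = yy act r a.x n then a.x else pos₁ p } := by
  refine Runs.then (runs_goTo hN ha hS hT hL) ?_
  refine Runs.mono (V₁ := {yy act r a.x n} ∪ ∅) (Runs.seq (runs_test _ _) ?_) (by simp)
  let b : St (E × Loc) P X :=
    { a with e := (a.e.1, { a.e.2 with seen := decide (pos₁ q = yy act r a.x n) }), pos := pos₁ }
  have hb : Rdy r b := ⟨ha.wf, ha.t0, ha.r0, ha.w0, ha.hs, ha.hc, ha.hq⟩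
  by_cases hc : bk = true ∧ pos₁ q = yy act r a.x n
  · refine runs_ite_true (by simpa [gs, ← h₁, fwk_point] using hc) ?_
    have := runs_goBack hN hi hb (S := {q}) (x := a.x) (i := i) (n := n) hT
    convert this using 1
    · simp only [gs, b, h₁, fwk_point, St.mk.injEq, true_and]
      refine ⟨rfl, ?_⟩
      funext p
      by_cases hp : p = q
      · subst hp
        have := hc.2
        simpa [h₁] using this
      · simp [hp]
    · simp only [b, St.mk.injEq, true_and]
      funext p
      simp [hc]
  · refine runs_ite_false (by simpa [gs, ← h₁, fwk_point] using hc) ?_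
    have := runs_goBack hN hi hb (S := ∅) (x := a.x) (i := i) (n := n) hT
    convert this using 1
    · simp only [gs, b, h₁, fwk_point, St.mk.injEq, true_and]
      refine ⟨rfl, ?_⟩
      funext p
      simp
    · simp only [b, St.mk.injEq, true_and]
      funext p
      have : ¬ (bk = true ∧ p = q ∧ pos₁ q = yy act r a.x n) := fun h => hc ⟨h.1, h.2.2⟩
      simp [this]

end Walk

lemma MM_eq (r : ℕ) : (kap * kap) ^ (c2 * 2 ^ r) = MM r := by
  rw [MM, ← pow_two, ← pow_mul, mul_assoc]

lemma ix_inj {l m n : ℕ} (hm : m < (kap * kap) ^ l) (hn : n < (kap * kap) ^ l)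
    (hT : ixT l m = ixT l n) (hL : ixL l m = ixL l n) : m = n := by
  refine nw_inj pairE hm hn ?_
  have key : ∀ a b : List (Cell × Cell), a.map Prod.fst = b.map Prod.fst →
      a.map Prod.snd = b.map Prod.snd → a = b := by
    intro a
    induction a with
    | nil => intro b h _; simpa using h.symm
    | cons x a ih =>
      intro b h h'
      cases b with
      | nil => simp at h
      | cons y b =>
        simp only [List.map_cons, List.cons.injEq] at h h'
        rw [ih b h.2 h'.2, Prod.ext h.1 h'.1]
  exact key _ _ hT hL

/-- The index `n` is the first one leading to its endpoint. -/
def isFirst {X : Type} (act : Fin 3 → X → X) (r : ℕ) (x : X) (n : ℕ) : Prop :=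
  ∀ m < n, yy act r x m ≠ yy act r x n

section Scan
variable {E P X : Type} {act : Fin 3 → X → X} {r : ℕ}

def cmpIJ : Prog E P :=
  .seq (cmpw .it .jt fun e c => (e.1, { e.2 with eqJ := c })) <|
    cmpw .il .jl fun e c => (e.1, { e.2 with eqJ := e.2.eqJ && c })

/-- Does the first index lead to a new point? -/
def isNew (Z : P) : Prog E P :=
  .seq (visit true {Z} Z false) <|
  .seq (.asg fun e => (e.1, { e.2 with new := true, seen := false })) <|
  .seq cmpIJ <|
  .seq (.loop (fun e => !e.2.eqJ) <|
    .seq (visit false ∅ Z false) <|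
    .seq (.asg fun e => (e.1, { e.2 with new := e.2.new && !e.2.seen, seen := false })) <|
    .seq (inc2 false fun e _ => e) cmpIJ) <|
  .seq (visit true ∅ Z true) <|
  .seq (fill z0 .jt) <| .seq (fill z0 .jl) <|
  .asg fun e => (e.1, { e.2 with eqJ := false, seen := false })

lemma runs_cmpIJ (hN : NN r ≤ Nat.card X) {a : St (E × Loc) P X} (hW : WF r a.mem) {n m : ℕ}
    (hn : n < MM r) (hm : m < MM r) (h1 : a.mem .it = ixT (c2 * 2 ^ r) n)
    (h2 : a.mem .il = ixL (c2 * 2 ^ r) n) (h3 : a.mem .jt = ixT (c2 * 2 ^ r) m)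
    (h4 : a.mem .jl = ixL (c2 * 2 ^ r) m) :
    Runs act r cmpIJ a ∅ { a with e := (a.e.1, { a.e.2 with eqJ := decide (m = n) }) } := by
  refine Runs.then (runs_cmp (i := .it) (j := .jt) hN hW (by simp) rfl)
    (Runs.to (runs_cmp (i := .il) (j := .jl) (a := ⟨(a.e.1, { a.e.2 with eqJ := decide (a.mem .it = a.mem .jt) }), a.mem, a.x, a.pos⟩) hN hW (by simp) rfl) ?_)
  have : (decide (ixT (c2 * 2 ^ r) n = ixT (c2 * 2 ^ r) m) &&
      decide (ixL (c2 * 2 ^ r) n = ixL (c2 * 2 ^ r) m)) = decide (m = n) := by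
    rw [← Bool.decide_and, decide_eq_decide]
    rw [← MM_eq] at hn hm
    exact ⟨fun h => ix_inj hm hn h.1.symm h.2.symm, fun h => by simp [h]⟩
  simp only [h1, h2, h3, h4, this]

lemma runs_isNew (hN : NN r ≤ Nat.card X) (hi : ∀ s x, act s (act s x) = x) {Z : P} {e0 : E}
    {c : Cell} {m : Reg → List Cell} {x : X} {pos : P → X} (hW : WF r m) (ht : m .t = zw r .t)
    (hr : m .r = zw r .r) (hw : m .w = zw r .w) (hjt : m .jt = zw r .jt) (hjl : m .jl = zw r .jl)
    (hZ : pos Z = x) {n : ℕ} (hn : n < MM r) (hT : m .it = ixT (c2 * 2 ^ r) n)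
    (hL : m .il = ixL (c2 * 2 ^ r) n) :
    Runs act r (isNew Z) ⟨(e0, { s2 := c, go := true }), m, x, pos⟩ {yy act r x n}
      ⟨(e0, { s2 := c, go := true, new := decide (isFirst act r x n) }), m, x, pos⟩ := by
  have hz1 : ixT (c2 * 2 ^ r) 0 = m .jt := by rw [ixT_zero r false, hjt]; rfl
  have hz2 : ixL (c2 * 2 ^ r) 0 = m .jl := by rw [ixL_zero r false, hjl]; rfl
  let y := yy act r x n
  let mj : ℕ → Reg → List Cell := fun k =>
    Function.update (Function.update m .jt (ixT (c2 * 2 ^ r) k)) .jl (ixL (c2 * 2 ^ r) k)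
  have hmj0 : mj 0 = m := by simp only [mj, hz1, hz2, Function.update_eq_self]
  have hWj : ∀ k, WF r (mj k) := fun k =>
    (hW.update (f := .jt) (length_ixT _ _)).update (f := .jl) (length_ixL _ _)
  let ok : ℕ → Prop := fun k => ∀ i < k, yy act r x i ≠ y
  let f : ℕ → St (E × Loc) P X := fun k =>
    ⟨(e0, { s2 := c, go := true, new := decide (ok k), eqJ := decide (k = n) }), mj k, x,
      Function.update pos Z y⟩
  have hv1 : Runs act r (visit true {Z} Z false) ⟨(e0, { s2 := c, go := true }), m, x, pos⟩ {y}
      ⟨(e0, { s2 := c, go := true, seen := true }), m, x, Function.update pos Z y⟩ := by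
    refine Runs.to (runs_visit (n := n) hN hi ⟨hW, ht, hr, hw, rfl, rfl, rfl⟩ ?_ hT hL Z false rfl) ?_
    · rintro p rfl; exact hZ
    · simp only [St.mk.injEq, true_and]
      refine ⟨by simp, ?_⟩
      funext p
      by_cases hp : p = Z <;> simp [hp, y]
  have hc0 : Runs act r cmpIJ ⟨(e0, { s2 := c, go := true, new := true }), m, x,
      Function.update pos Z y⟩ ∅ (f 0) := by
    refine Runs.to (runs_cmpIJ hN hW hn (by omega) hT hL hz1.symm hz2.symm) ?_
    simp [f, ok, hmj0]
  refine Runs.mono (V₁ := {y} ∪ ∅) (Runs.seq hv1 (Runs.then (runs_asg _) (Runs.then hc0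
    (Runs.then (b := f n) (Runs.weaken (runs_loop f (fun _ => ∅) n hn.le (fun k hk => by
      simp [f, hk.ne]) ?_ (by simp [f]))) (Runs.then
      (b := ⟨(e0, { s2 := c, go := true, new := decide (ok n), eqJ := true, seen := true }), mj n, x,
        pos⟩) ?_ (Runs.then (runs_fill hN (hWj n)) (Runs.then (runs_fill hN ((hWj n).update
        (by simp))) (Runs.to (runs_asg _) ?_)))))))) (by simp [y])
  · intro k hk
    refine Runs.then (Runs.weaken (runs_visit (a := f k) (i := false) (n := k) hN hi
      ⟨hWj k, ?_, ?_, ?_, rfl, rfl, rfl⟩ (by simp) ?_ ?_ Z false rfl)) (Runs.then (runs_asg _) ?_)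
    · simp [f, mj, ht]
    · simp [f, mj, hr]
    · simp [f, mj, hw]
    · simp [f, mj, tr]
    · simp [f, mj, lr]
    · have hn' : (kap * kap) ^ (c2 * 2 ^ r) = MM r := MM_eq r
      refine Runs.then (runs_inc2 (i := false) (n := k) hN (by omega) (by simp [f, mj, tr])
        (by simp [f, mj, lr])) (Runs.to (runs_cmpIJ (n := n) (m := k + 1) hN ?_ hn (by omega)
          ?_ ?_ ?_ ?_) ?_)
      · exact ((hWj k).update (by simp [tr, Reg.rs])).update (by simp [lr, Reg.rs])
      · simp [f, mj, tr, lr, hT]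
      · simp [f, mj, tr, lr, hL]
      · simp [tr, lr]
      · simp [lr]
      · have hok : ok (k + 1) ↔ ok k ∧ yy act r x k ≠ y := Nat.forall_lt_succ_right
        ext1
        · simp [f, hok, eq_comm]
        · funext g
          cases g <;> simp [f, mj, tr, lr]
        · rfl
        · simp [f]
  · refine Runs.to (Runs.weaken (runs_visit (a := f n) (i := true) (n := n) hN hi
      ⟨hWj n, ?_, ?_, ?_, rfl, rfl, rfl⟩ (by simp) ?_ ?_ Z true rfl)) ?_
    · simp [f, mj, ht]
    · simp [f, mj, hr]
    · simp [f, mj, hw]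
    · simp [f, mj, tr, hT]
    · simp [f, mj, lr, hL]
    · simp only [f, St.mk.injEq, true_and]
      refine ⟨by simp [y], ?_⟩
      funext p
      by_cases hp : p = Z <;> simp [hp, y, hZ]
  · simp only [St.mk.injEq, true_and]
    refine ⟨by congr, ?_, trivial⟩
    funext g
    cases g <;> simp [mj, hjt, hjl] <;> rfl

/-- Run `body` at the indices of new points, counting them, until a hit. -/
def scan (Z : P) (body : Prog E P) : Prog E P :=
  .seq (.asg fun e => (e.1, { e.2 with go := true })) <|
  .seq (.loop (fun e => e.2.go) <|
    .seq (isNew Z) <|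
    .seq (.ite (fun e => e.2.new) (.seq body (inc1 .cnt fun e _ => e)) .skip) <|
    .seq (inc2 true fun e o => (e.1, { e.2 with ovf := o })) <|
    .asg fun e => (e.1, { e.2 with go := !(e.2.hit || e.2.ovf), new := false })) <|
  .seq (fill z0 .cnt) <| .seq (fill z0 .it) <| .seq (fill z0 .il) <|
  .asg fun e => (e.1, { e.2 with go := false, ovf := false })

/-- The registers other than `u` and `v` are zero. -/
structure Cln (r : ℕ) (m : Reg → List Cell) : Prop where
  wf : WF r m
  z : ∀ f, f ≠ .u → f ≠ .v → m f = zw r f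

/-- The memory during a scan. -/
def lm (r : ℕ) (m : Reg → List Cell) (k n : ℕ) : Reg → List Cell :=
  Function.update (Function.update (Function.update m .cnt (nw cellE (Reg.cnt.rs * 2 ^ r) k))
    .it (ixT (c2 * 2 ^ r) n)) .il (ixL (c2 * 2 ^ r) n)

lemma lm_wf {m : Reg → List Cell} (h : WF r m) (k n : ℕ) : WF r (lm r m k n) :=
  ((h.update (f := .cnt) (by simp)).update (f := .it) (by simp [Reg.rs])).update (f := .il)
    (by simp [Reg.rs])

lemma lm_zero {m : Reg → List Cell} (h : Cln r m) : lm r m 0 0 = m := by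
  have e1 : ixT (c2 * 2 ^ r) 0 = m .it := by rw [ixT_zero r true, h.z _ (by simp) (by simp)]; rfl
  have e2 : ixL (c2 * 2 ^ r) 0 = m .il := by rw [ixL_zero r true, h.z _ (by simp) (by simp)]; rfl
  have e3 : nw cellE (Reg.cnt.rs * 2 ^ r) 0 = m .cnt := by
    rw [nw_cellE_zero, h.z _ (by simp) (by simp)]
  simp only [lm, e1, e2, e3, Function.update_eq_self]

/-- The index of a scan in terms of points found. -/
def rk (act : Fin 3 → X → X) (r : ℕ) (x : X) (n : ℕ) : ℕ := Nat.count (isFirst act r x) n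

lemma runs_scan_iter (hN : NN r ≤ Nat.card X) (hi : ∀ s x, act s (act s x) = x) {Z : P} {e0 : E}
    {c : Cell} {m m' : Reg → List Cell} {x : X} {pos pos' : P → X} {h : Bool} (hm : Cln r m)
    (hm' : Cln r m') (hZ : pos Z = x) {body : Prog E P} {n : ℕ} (hn : n < MM r)
    (hk : isFirst act r x n → rk act r x n < kap ^ (Reg.cnt.rs * 2 ^ r))
    (hb : isFirst act r x n → Runs act r body
      ⟨(e0, { s2 := c, go := true, new := true }), lm r m (rk act r x n) n, x, pos⟩ ∅
      ⟨(e0, { s2 := c, go := true, new := true, hit := h }), lm r m' (rk act r x n) n, x, pos'⟩)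
    (hnb : ¬ isFirst act r x n → m' = m ∧ pos' = pos ∧ h = false) :
    Runs act r (.seq (isNew Z) <|
      .seq (.ite (fun e => e.2.new) (.seq body (inc1 .cnt fun e _ => e)) .skip) <|
      .seq (inc2 true fun e o => (e.1, { e.2 with ovf := o })) <|
      .asg fun e => (e.1, { e.2 with go := !(e.2.hit || e.2.ovf), new := false }))
      ⟨(e0, { s2 := c, go := true }), lm r m (rk act r x n) n, x, pos⟩ {yy act r x n}
      ⟨(e0,
        { s2 := c, go := !(h || decide (n + 1 = MM r)), hit := h, ovf := decide (n + 1 = MM r) }), lm r m' (rk act r x (n + 1)) (n + 1), x, pos'⟩ := by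
  have hz := hm.z
  refine Runs.mono (V₁ := {yy act r x n} ∪ ∅) (Runs.seq (runs_isNew (n := n) hN hi (lm_wf hm.wf _ _)
    ?_ ?_ ?_ ?_ ?_ hZ hn ?_ ?_) (Runs.then
    (b := ⟨(e0, { s2 := c, go := true, new := decide (isFirst act r x n), hit := h }),
      lm r m' (rk act r x (n + 1)) n, x, pos'⟩) ?_
    (Runs.then (runs_inc2 (i := true) (n := n) hN (by rw [MM_eq]; exact hn) ?_ ?_)
    (Runs.to (runs_asg _) ?_)))) (by simp)
  iterate 5 simp [lm, hz]
  · simp [lm]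
  · simp [lm]
  · by_cases hf : isFirst act r x n
    · refine runs_ite_true (by simp [hf]) ?_
      have hrk : rk act r x (n + 1) = rk act r x n + 1 := by
        rw [rk, Nat.count_succ, if_pos hf]; rfl
      have := hb hf
      rw [show decide (isFirst act r x n) = true by simp [hf], hrk]
      refine Runs.then this (Runs.to (runs_inc1 (n := rk act r x n) hN (lm_wf hm'.wf _ _) (hk hf)
        (by simp [lm])) ?_)
      simp only [St.mk.injEq, true_and]
      refine ⟨?_, trivial⟩
      funext g
      cases g <;> simp [lm]
    · obtain ⟨rfl, rfl, rfl⟩ := hnb hf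
      have hrk : rk act r x (n + 1) = rk act r x n := by
        rw [rk, Nat.count_succ, if_neg hf]; rfl
      rw [hrk]
      exact runs_ite_false (by simp [hf]) runs_skip
  · simp [lm, tr]
  · simp [lm, lr]
  · rw [MM_eq]
    simp only [St.mk.injEq, true_and]
    refine ⟨?_, trivial⟩
    funext g
    cases g <;> simp [lm, tr, lr]

lemma runs_scan (hN : NN r ≤ Nat.card X) (hi : ∀ s x, act s (act s x) = x) {Z : P} {e0 : E}
    {c : Cell} {m m' : Reg → List Cell} {x : X} {pos pos' : P → X} {h : Bool} (hm : Cln r m)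
    (hm' : Cln r m') (hZ : pos Z = x) {body : Prog E P} {n : ℕ} (hn : n < MM r)
    (hk : ∀ i ≤ n, isFirst act r x i → rk act r x i < kap ^ (Reg.cnt.rs * 2 ^ r))
    (hpre : ∀ i < n, isFirst act r x i → Runs act r body
      ⟨(e0, { s2 := c, go := true, new := true }), lm r m (rk act r x i) i, x, pos⟩ ∅
      ⟨(e0, { s2 := c, go := true, new := true }), lm r m (rk act r x i) i, x, pos⟩)
    (hb : isFirst act r x n → Runs act r body
      ⟨(e0, { s2 := c, go := true, new := true }), lm r m (rk act r x n) n, x, pos⟩ ∅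
      ⟨(e0, { s2 := c, go := true, new := true, hit := h }), lm r m' (rk act r x n) n, x, pos'⟩)
    (hnb : ¬ isFirst act r x n → m' = m ∧ pos' = pos ∧ h = false)
    (hend : h = true ∨ n + 1 = MM r) :
    Runs act r (scan Z body) ⟨(e0, { s2 := c }), m, x, pos⟩ (⋃ i < n + 1, {yy act r x i})
      ⟨(e0, { s2 := c, hit := h }), m', x, pos'⟩ := by
  let f : ℕ → St (E × Loc) P X := fun i =>
    if i ≤ n then ⟨(e0, { s2 := c, go := true }), lm r m (rk act r x i) i, x, pos⟩
    else ⟨(e0, { s2 := c, hit := h, ovf := decide (n + 1 = MM r) }),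
      lm r m' (rk act r x (n + 1)) (n + 1), x, pos'⟩
  have hf0 : f 0 = ⟨(e0, { s2 := c, go := true }), m, x, pos⟩ := by
    have : rk act r x 0 = 0 := Nat.count_zero _
    simp only [f, Nat.zero_le, if_true, this, lm_zero hm]
  have hL := runs_loop (act := act) (r := r) (s := .seq (isNew Z) <|
      .seq (.ite (fun e => e.2.new) (.seq body (inc1 .cnt fun e _ => e)) .skip) <|
      .seq (inc2 true fun e o => (e.1, { e.2 with ovf := o })) <|
      .asg fun e => (e.1, { e.2 with go := !(e.2.hit || e.2.ovf), new := false }))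
    (k := fun e => e.2.go) f (fun i => {yy act r x i}) (n + 1) hn (fun i hi => by
      simp [f, Nat.lt_succ_iff.1 hi]) ?_ (by simp [f])
  · rw [hf0] at hL
    refine Runs.then (runs_asg _) (Runs.mono (V₁ := (⋃ i < n + 1, {yy act r x i}) ∪ ∅)
      (Runs.seq hL ?_) (by simp))
    have e1 : f (n + 1) = ⟨(e0, { s2 := c, hit := h, ovf := decide (n + 1 = MM r) }),
      lm r m' (rk act r x (n + 1)) (n + 1), x, pos'⟩ := by simp [f]
    rw [e1]
    have hW := lm_wf hm'.wf (rk act r x (n + 1)) (n + 1)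
    refine Runs.then (runs_fill hN hW) (Runs.then (runs_fill hN (hW.update (by simp)))
      (Runs.then (runs_fill hN ((hW.update (by simp)).update (by simp))) (Runs.to (runs_asg _) ?_)))
    simp only [St.mk.injEq, true_and]
    refine ⟨?_, trivial⟩
    funext g
    cases g <;> simp [lm] <;> rw [hm'.z _ (by simp) (by simp)] <;> rfl
  · intro i hin
    rcases Nat.lt_or_eq_of_le (Nat.lt_succ_iff.1 hin) with hlt | rfl
    · have := runs_scan_iter (m' := m) (pos' := pos) (h := false) (n := i) hN hi hm hm hZ (by omega)
        (hk i hlt.le) (hpre i hlt) (fun _ => ⟨rfl, rfl, rfl⟩)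
      have e2 : decide (i + 1 = MM r) = false := by simp; omega
      rw [e2] at this
      simpa [f, hlt.le, Nat.succ_le_of_lt hlt] using this
    · have := runs_scan_iter hN hi hm hm' hZ hn (hk i le_rfl) hb hnb
      have e2 : (h || decide (i + 1 = MM r)) = true := by simpa using hend
      rw [e2] at this
      simpa [f] using this

end Scan

section Points
variable {X : Type} {act : Fin 3 → X → X} {r : ℕ} {x : X}

lemma exists_of_lt_count {p : ℕ → Prop} {k M : ℕ} (h : k < Nat.count p M) :
    ∃ n < M, p n ∧ Nat.count p n = k := by
  induction M with
  | zero => simp at h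
  | succ M ih =>
    by_cases h' : k < Nat.count p M
    · obtain ⟨n, hn, hp⟩ := ih h'
      exact ⟨n, hn.trans (Nat.lt_succ_self M), hp⟩
    · rw [Nat.count_succ] at h
      by_cases hp : p M
      · exact ⟨M, Nat.lt_succ_self M, hp, by simp [hp] at h; omega⟩
      · simp [hp] at h; omega

lemma isFirst_inj {m n : ℕ} (hm : isFirst act r x m) (hn : isFirst act r x n)
    (h : yy act r x m = yy act r x n) : m = n := by
  rcases lt_trichotomy m n with hl | he | hl
  · exact absurd h (hn m hl)
  · exact he
  · exact absurd h.symm (hm n hl)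

lemma rk_lt {m n : ℕ} (hm : isFirst act r x m) (h : m < n) : rk act r x m < rk act r x n :=
  Nat.count_strict_mono hm h

lemma zip_words {l : ℕ} {T R : List Cell} (hT : T.length = l) (hR : R.length = l) :
    ∃ n < (kap * kap) ^ l, ixT l n = T ∧ ixL l n = R := by
  have hl : (T.zip R).length = l := by simp [hT, hR]
  have h := nw_nv pairE (T.zip R)
  refine ⟨nv pairE (T.zip R), by simpa [hl] using nv_lt pairE (T.zip R), ?_, ?_⟩
  · rw [ixT, ← hl, h, List.map_fst_zip (by omega)]
  · rw [ixL, ← hl, h, List.map_snd_zip (by omega)]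

lemma reached_subset : reached act (2 ^ r) x ⊆ ⋃ n < MM r, {yy act r x n} := by
  rintro y ⟨R, hR, τ, hτ, rfl⟩
  obtain ⟨n, hn, hT, hL⟩ := zip_words (T := nw cellE (c2 * 2 ^ r) τ) (length_nw _ _ _) hR
  simp only [Set.mem_iUnion, Set.mem_singleton_iff, exists_prop]
  exact ⟨n, MM_eq r ▸ hn, by rw [yy, tau, hT, hL, nv_nw _ _ _ hτ]⟩

lemma ncard_iUnion_le : (⋃ n < MM r, {yy act r x n} : Set X).ncard ≤ rk act r x (MM r) := by
  rw [rk, Nat.count_eq_card_filter_range]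
  refine le_trans ?_ (Finset.card_image_le (f := yy act r x))
  rw [← Set.ncard_coe_finset]
  refine Set.ncard_le_ncard ?_ (Finset.finite_toSet _)
  intro y hy
  simp only [Set.mem_iUnion, Set.mem_singleton_iff, exists_prop] at hy
  have h := Nat.find_spec hy
  have hmin : isFirst act r x (Nat.find hy) := fun m hm he =>
    Nat.find_min hy hm ⟨hm.trans h.1, h.2.trans he.symm⟩
  simp only [Finset.coe_image, Finset.coe_filter, Finset.mem_range, Set.mem_image]
  exact ⟨_, ⟨h.1, hmin⟩, h.2.symm⟩

variable [Fintype X]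

lemma rk_le_card : rk act r x (MM r) ≤ Nat.card X := by
  rw [rk, Nat.count_eq_card_filter_range, Nat.card_eq_fintype_card, ← Finset.card_univ]
  refine Finset.card_le_card_of_injOn (yy act r x) (fun _ _ => Finset.mem_univ _) ?_
  intro m hm n hn h
  simp only [Finset.coe_filter, Finset.mem_range, Set.mem_ofPred_eq] at hm hn
  exact isFirst_inj hm.2 hn.2 h

lemma le_rk (hi : ∀ s x, act s (act s x) = x) (ht : Transv act) (x : X) :
    min (NN (r + 1)) (Nat.card X) ≤ (⋃ n < MM r, {yy act r x n} : Set X).ncard := by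
  rw [Nat.card_eq_fintype_card]
  exact (card_reached hi ht (b := 2 ^ r) (by positivity) x).trans
    (Set.ncard_le_ncard reached_subset (Set.toFinite _))

lemma iUnion_eq_univ (hi : ∀ s x, act s (act s x) = x) (ht : Transv act) (x : X)
    (h : Nat.card X ≤ NN (r + 1)) : (⋃ n < MM r, {yy act r x n} : Set X) = Set.univ := by
  have := le_rk (r := r) hi ht x
  rw [min_eq_right h] at this
  exact (Set.eq_of_subset_of_ncard_le (Set.subset_univ _) (by rwa [Set.ncard_univ])
    (Set.toFinite _))

/-- The point number `k`. -/
def pt (act : Fin 3 → X → X) (r : ℕ) (x : X) (k : ℕ) : X :=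
  if h : ∃ n < MM r, isFirst act r x n ∧ rk act r x n = k then yy act r x h.choose else x

omit [Fintype X] in
lemma pt_eq {n : ℕ} (h : n < MM r) (hn : isFirst act r x n) :
    pt act r x (rk act r x n) = yy act r x n := by
  have he : ∃ m < MM r, isFirst act r x m ∧ rk act r x m = rk act r x n := ⟨n, h, hn, rfl⟩
  rw [pt, dif_pos he]
  have := he.choose_spec
  congr 1
  rcases lt_trichotomy he.choose n with hl | he | hl
  · have := rk_lt this.2.1 hl; omega
  · exact he
  · have := rk_lt hn hl; omega

lemma exists_first (hi : ∀ s x, act s (act s x) = x) (ht : Transv act) (x : X)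
    (h : NN (r + 1) ≤ Nat.card X) {k : ℕ} (hk : k < NN (r + 1)) :
    ∃ n < MM r, isFirst act r x n ∧ rk act r x n = k ∧ pt act r x k = yy act r x n := by
  have h1 := (le_rk (r := r) hi ht x).trans ncard_iUnion_le
  rw [min_eq_left h] at h1
  obtain ⟨n, hn, hf, rfl⟩ := exists_of_lt_count (hk.trans_le h1)
  exact ⟨n, hn, hf, rfl, pt_eq hn hf⟩

omit [Fintype X] in
lemma pt_zero : pt act r x 0 = x := by
  have h0 : isFirst act r x 0 := fun m hm => absurd hm (Nat.not_lt_zero m)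
  have h1 : rk act r x 0 = 0 := Nat.count_zero _
  have := four_le_kap
  have h2 : yy act r x 0 = x := by
    have ht : tau r 0 = 0 := by
      have := ixT_zero r true
      rw [tau, this, ← nw_cellE_zero, nv_nw _ _ _ (by positivity)]
    rw [yy, ht, ypos_zero]
  rw [← h1, pt_eq (by rw [MM]; positivity) h0, h2]

end Points

lemma NN_succ_mono (r : ℕ) : NN r ≤ NN (r + 1) := by
  have := four_le_kap
  cases r with
  | zero => exact Nat.zero_le _
  | succ r => exact Nat.pow_le_pow_right (by omega) (Nat.pow_le_pow_right (by omega) (by omega))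

section Access
variable {E P X : Type} {act : Fin 3 → X → X} {r : ℕ}

/-- Read the position of the pebble `p` into the register `f`, fetching the pebble. -/
def load (Z p : P) (f : Reg) : Prog E P :=
  .seq (scan Z <|
    .seq (visit true ∅ p true) <|
    .ite (fun e => e.2.seen)
      (.seq (copy .cnt f) (.asg fun e => (e.1, { e.2 with hit := true, seen := false }))) .skip) <|
  .asg fun e => (e.1, { e.2 with hit := false })

/-- Take the pebble `p` to the point given by the register `f`. -/
def store (Z p : P) (f : Reg) : Prog E P :=
  .seq (scan Z <|
    .seq (cmpw .cnt f fun e c => (e.1, { e.2 with eqJ := c })) <|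
    .ite (fun e => e.2.eqJ)
      (.seq (visit true {p} p false)
        (.asg fun e => (e.1, { e.2 with hit := true, seen := false, eqJ := false }))) .skip) <|
  .asg fun e => (e.1, { e.2 with hit := false })

/-- Visit all points, or detect that there are many. -/
def explo (Z : P) (k : E → Bool → E) : Prog E P :=
  .seq (.explore fun e c => (e.1, { e.2 with hit := c })) <|
  .ite (fun e => e.2.hit) (.asg fun e => (k e.1 true, { e.2 with hit := false })) <|
  .seq (scan Z (ismax .cnt fun e c => (e.1, { e.2 with hit := c }))) <|
  .asg fun e => (k e.1 (!e.2.hit), { e.2 with hit := false })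

lemma lm_rdy {m : Reg → List Cell} (h : Cln r m) {k n : ℕ} {e0 : E} {c : Cell} {n' : Bool} {x : X}
    {pos : P → X} :
    Rdy r (⟨(e0, { s2 := c, go := true, new := n' }), lm r m k n, x, pos⟩ : St (E × Loc) P X) :=
  ⟨lm_wf h.wf k n, by simp [lm, h.z], by simp [lm, h.z], by simp [lm, h.z], rfl, rfl, rfl⟩

lemma Cln.update {m : Reg → List Cell} (h : Cln r m) {f : Reg} (hf : f = .u ∨ f = .v)
    {w : List Cell} (hw : w.length = 2 ^ r) : Cln r (Function.update m f w) := by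
  refine ⟨h.wf.update (by rcases hf with rfl | rfl <;> simp [hw, Reg.rs]), fun g hu hv => ?_⟩
  rw [Function.update_of_ne (by rcases hf with rfl | rfl <;> assumption), h.z g hu hv]

lemma lm_update {m : Reg → List Cell} {f : Reg} (hf : f = .u ∨ f = .v) {w : List Cell} {k n : ℕ} :
    Function.update (lm r m k n) f w = lm r (Function.update m f w) k n := by
  funext g
  rcases hf with rfl | rfl <;> cases g <;> simp [lm]

variable [Fintype X] (hN : NN (r + 1) ≤ Nat.card X) (hi : ∀ s x, act s (act s x) = x)
  (ht : Transv act) {Z : P} {e0 : E} {c : Cell} {m : Reg → List Cell} {x : X} {pos : P → X}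
  (hm : Cln r m) (hZ : pos Z = x) {p : P} {f : Reg} (hf : f = .u ∨ f = .v)
include hN hi ht hm hZ hf

lemma runs_load {w : List Cell} (hw : w.length = 2 ^ r) (hp : pos p = pt act r x (nv cellE w)) :
    Runs act r (load Z p f) ⟨(e0, { s2 := c }), m, x, pos⟩ ∅
      ⟨(e0, { s2 := c }), Function.update m f w, x, Function.update pos p x⟩ := by
  have hN' := (NN_succ_mono r).trans hN
  have hk : nv cellE w < NN (r + 1) := by
    have := nv_lt cellE w
    rwa [hw] at this
  have hfs : Reg.cnt.rs = f.rs := by rcases hf with rfl | rfl <;> rfl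
  have hcf : Reg.cnt ≠ f := by rcases hf with rfl | rfl <;> simp
  obtain ⟨n, hn, hfn, hrk, hpt⟩ := exists_first hi ht x hN hk
  rw [hpt] at hp
  refine Runs.then (Runs.weaken (runs_scan (n := n) (m' := Function.update m f w)
    (pos' := Function.update pos p x) (h := true) hN' hi hm (hm.update hf hw) hZ hn ?_ ?_ ?_ ?_
    (Or.inl rfl))) (runs_asg _)
  · intro i hin hfi
    have h1 : rk act r x i ≤ rk act r x n := Nat.count_monotone _ hin
    simpa [Reg.rs, NN] using (h1.trans_eq hrk).trans_lt hk
  · intro i hin hfi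
    have hne : pos p ≠ yy act r x i := by rw [hp]; exact (hfn i hin).symm
    refine Runs.then (Runs.weaken (runs_visit (n := i) hN' hi (lm_rdy hm) (by simp) (by simp [lm, tr])
      (by simp [lm, lr]) p true (pos₁ := pos) (by simp))) (runs_ite_false (by simp [hne])
      (Runs.to runs_skip ?_))
    simp [hne]
  · intro _
    refine Runs.then (Runs.weaken (runs_visit (n := n) hN' hi (lm_rdy hm) (by simp) (by simp [lm, tr])
      (by simp [lm, lr]) p true (pos₁ := pos) (by simp))) (runs_ite_true (by simp [hp])
      (Runs.then (runs_copy hN' (lm_wf hm.wf _ _) hcf hfs) (Runs.to (runs_asg _) ?_)))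
    have e1 : lm r m (rk act r x n) n .cnt = w := by
      rw [hrk]
      have := nw_nv cellE w
      rw [hw] at this
      simpa [lm, Reg.rs] using this
    simp only [St.mk.injEq, true_and, e1]
    refine ⟨lm_update hf, ?_⟩
    funext q
    by_cases hq : q = p <;> simp [hq, hp]
  · exact fun h => absurd hfn h

lemma runs_store {w : List Cell} (hw : w.length = 2 ^ r) (hmf : m f = w) (hp : pos p = x) :
    Runs act r (store Z p f) ⟨(e0, { s2 := c }), m, x, pos⟩ ∅
      ⟨(e0, { s2 := c }), m, x, Function.update pos p (pt act r x (nv cellE w))⟩ := by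
  have hN' := (NN_succ_mono r).trans hN
  have hk : nv cellE w < NN (r + 1) := by
    have := nv_lt cellE w
    rwa [hw] at this
  have hfs : Reg.cnt.rs = f.rs := by rcases hf with rfl | rfl <;> rfl
  have hcf : Reg.cnt ≠ f := by rcases hf with rfl | rfl <;> simp
  obtain ⟨n, hn, hfn, hrk, hpt⟩ := exists_first hi ht x hN hk
  have hlf : ∀ k i, lm r m k i f = w := by
    intro k i
    rcases hf with rfl | rfl <;> simpa [lm] using hmf
  have hww : nw cellE (Reg.cnt.rs * 2 ^ r) (nv cellE w) = w := by
    have := nw_nv cellE w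
    rw [hw] at this
    simpa [Reg.rs] using this
  have hlc : ∀ k i, lm r m k i .cnt = nw cellE (Reg.cnt.rs * 2 ^ r) k := by intro k i; simp [lm]
  refine Runs.then (Runs.weaken (runs_scan (n := n) (m' := m)
    (pos' := Function.update pos p (pt act r x (nv cellE w))) (h := true) hN' hi hm hm hZ hn ?_ ?_ ?_
    ?_ (Or.inl rfl))) (runs_asg _)
  · intro i hin hfi
    have h1 : rk act r x i ≤ rk act r x n := Nat.count_monotone _ hin
    simpa [Reg.rs, NN] using (h1.trans_eq hrk).trans_lt hk
  · intro i hin hfi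
    have hlt := rk_lt hfi hin
    rw [hrk] at hlt
    have hne : nw cellE (Reg.cnt.rs * 2 ^ r) (rk act r x i) ≠ w := by
      intro h
      rw [← hww] at h
      have := nw_inj cellE (by simpa [Reg.rs, NN] using hlt.trans hk) (by simpa [Reg.rs, NN] using hk) h
      omega
    refine Runs.then (runs_cmp hN' (lm_wf hm.wf _ _) hcf hfs) (runs_ite_false (by
      simp [hlf, hlc, hne]) (Runs.to runs_skip ?_))
    simp [hlf, hlc, hne]
  · intro _
    have he : decide (lm r m (rk act r x n) n .cnt = lm r m (rk act r x n) n f) = true := by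
      simp [hlf, hlc, hrk, hww]
    refine Runs.then (runs_cmp hN' (lm_wf hm.wf _ _) hcf hfs) ?_
    simp only [he]
    have hR : Rdy r (⟨(e0, { s2 := c, go := true, new := true, eqJ := true }),
        lm r m (rk act r x n) n, x, pos⟩ : St (E × Loc) P X) :=
      ⟨lm_wf hm.wf _ _, by simp [lm, hm.z], by simp [lm, hm.z], by simp [lm, hm.z], rfl, rfl, rfl⟩
    refine runs_ite_true rfl (Runs.then (Runs.weaken (runs_visit (n := n) hN' hi hR
      (by rintro q rfl; exact hp) (by simp [lm, tr]) (by simp [lm, lr]) p false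
      (pos₁ := Function.update pos p (yy act r x n)) (by
        funext q
        by_cases hq : q = p <;> simp [hq]))) (Runs.to (runs_asg _) ?_))
    simp [hpt]
  · exact fun h => absurd hfn h

omit hN hf in
lemma runs_explo (k : E → Bool → E) :
    Runs act r (explo Z k) ⟨(e0, {}), m, x, pos⟩ (if Nat.card X < NN (r + 1) then Set.univ else ∅)
      ⟨(k e0 (decide (Nat.card X < NN (r + 1))), {}), m, x, pos⟩ := by
  by_cases h0 : Nat.card X < NN r
  · have h1 := h0.trans_le (NN_succ_mono r)
    refine Runs.mono (V₁ := Set.univ ∪ ∅) (Runs.seq (Runs.mono (runs_explore _) (by simp [-Nat.card_eq_fintype_card, h0]))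
      (runs_ite_true (by simp [-Nat.card_eq_fintype_card, h0]) (Runs.to (runs_asg _) ?_))) (by simp)
    simp [-Nat.card_eq_fintype_card, h1]
  have hN' : NN r ≤ Nat.card X := not_lt.1 h0
  refine Runs.then (Runs.weaken (runs_explore _)) (runs_ite_false (by simp [-Nat.card_eq_fintype_card, h0]) ?_)
  simp only [h0, decide_false]
  have hmax : ∀ n, rk act r x n < NN (r + 1) → Runs act r (ismax .cnt fun e c => (e.1, { e.2 with hit := c }))
      (⟨(e0, { go := true, new := true }), lm r m (rk act r x n) n, x, pos⟩ : St (E × Loc) P X) ∅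
      ⟨(e0, { go := true, new := true, hit := decide (rk act r x n + 1 = NN (r + 1)) }),
        lm r m (rk act r x n) n, x, pos⟩ := by
    intro n hn
    refine Runs.to (runs_ismax hN' (lm_wf hm.wf _ _)) ?_
    have hlc : lm r m (rk act r x n) n .cnt = nw cellE (Reg.cnt.rs * 2 ^ r) (rk act r x n) := by
      simp [lm]
    have hrs : Reg.cnt.rs * 2 ^ r = 2 ^ r := by simp [Reg.rs]
    simp only [hlc]
    rw [hrs, nv_nw _ _ _ hn]
    rfl
  have hexp : kap ^ (Reg.cnt.rs * 2 ^ r) = NN (r + 1) := by simp [Reg.rs, NN]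
  have hk4 := four_le_kap
  by_cases h1 : Nat.card X < NN (r + 1)
  · have hM : MM r - 1 + 1 = MM r := Nat.sub_add_cancel (by rw [MM]; exact Nat.one_le_pow _ _ (by omega))
    have hrk : ∀ i < MM r, isFirst act r x i → rk act r x i + 1 < NN (r + 1) := by
      intro i hin hfi
      have := rk_lt hfi hin
      have := rk_le_card (act := act) (r := r) (x := x)
      omega
    have hb : ∀ i < MM r, isFirst act r x i → Runs act r (ismax .cnt fun e c => (e.1, { e.2 with hit := c }))
      (⟨(e0, { go := true, new := true }), lm r m (rk act r x i) i, x, pos⟩ : St (E × Loc) P X) ∅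
      ⟨(e0, { go := true, new := true }), lm r m (rk act r x i) i, x, pos⟩ := by
      intro i hin hfi
      have h := hrk i hin hfi
      have := hmax i (by omega)
      rwa [decide_eq_false (by omega)] at this
    have hs := runs_scan (c := z0) (n := MM r - 1) (m' := m) (pos' := pos) (h := false) hN' hi hm hm hZ (by omega)
      (fun i hin hfi => by rw [hexp]; have := hrk i (by omega) hfi; omega)
      (fun i hin hfi => hb i (by omega) hfi) (hb _ (by omega)) (fun _ => ⟨rfl, rfl, rfl⟩) (Or.inr hM)
    rw [hM, iUnion_eq_univ hi ht x h1.le] at hs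
    refine Runs.mono (V₁ := Set.univ ∪ ∅) (Runs.seq hs (Runs.to (runs_asg _) ?_)) (by simp)
    simp [-Nat.card_eq_fintype_card, h1]
  · have hN := not_lt.1 h1
    have hpos : 0 < NN (r + 1) := by simp only [NN]; positivity
    obtain ⟨n, hn, hfn, hrk, hpt⟩ := exists_first hi ht x hN (Nat.sub_lt hpos one_pos)
    have hs := runs_scan (c := z0) (n := n) (m' := m) (pos' := pos) (h := true) hN' hi hm hm hZ hn
      (fun i hin hfi => by
        rw [hexp]
        have : rk act r x i ≤ rk act r x n := Nat.count_monotone _ hin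
        omega)
      (fun i hin hfi => by
        have := rk_lt hfi hin
        have h := hmax i (by omega)
        rwa [decide_eq_false (by omega)] at h)
      (fun _ => by
        have h := hmax n (by omega)
        rwa [decide_eq_true (by omega)] at h) (fun h => absurd hfn h) (Or.inl rfl)
    rw [if_neg h1]
    refine Runs.then (Runs.weaken hs) (Runs.to (runs_asg _) ?_)
    simp [-Nat.card_eq_fintype_card, h1]

end Access

/-- The pebbles of the compiled program: those of the program, one for the walker and one for
each of the memory blocks. -/
inductive PP (P : Type)
  | old (p : P)
  | Z
  | blk (q : Σ f : Reg, Fin (2 * f.rs))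

section Chunks
variable {b : ℕ}

/-- The block number `h` of length `b`. -/
def chunk (b h : ℕ) (w : List Cell) : List Cell := (w.drop (h * b)).take b

/-- Replacing the block number `h`. -/
def setC (b h : ℕ) (c w : List Cell) : List Cell := w.take (h * b) ++ (c ++ w.drop ((h + 1) * b))

lemma length_chunk {h : ℕ} {w : List Cell} (hw : (h + 1) * b ≤ w.length) :
    (chunk b h w).length = b := by
  simp only [chunk, List.length_take, List.length_drop]
  rw [add_mul, one_mul] at hw
  omega

lemma chunk_setC {h k : ℕ} {c w : List Cell} (hw : (h + 1) * b ≤ w.length) (hc : c.length = b) :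
    chunk b k (setC b h c w) = if k = h then c else chunk b k w := by
  have hl : (w.take (h * b)).length = h * b := by
    rw [List.length_take, min_eq_left]
    rw [add_mul] at hw; omega
  split_ifs with hk
  · subst hk
    rw [chunk, setC, List.drop_append_of_le_length hl.ge, List.drop_of_length_le hl.le,
      List.nil_append, List.take_append_of_le_length hc.ge, List.take_of_length_le hc.le]
  · rcases Nat.lt_or_gt_of_ne hk with hlt | hgt
    · have h1 : k * b + b ≤ h * b := by
        have := Nat.mul_le_mul_right b (show k + 1 ≤ h from hlt); rwa [add_mul, one_mul] at this
      rw [chunk, setC, List.drop_append_of_le_length (by omega),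
        List.take_append_of_le_length (by rw [List.length_drop]; omega), chunk, List.drop_take,
        List.take_take, min_eq_left (by omega)]
    · obtain ⟨d, rfl⟩ := Nat.exists_eq_add_of_lt hgt
      have h1 : (h + d + 1) * b = h * b + (b + d * b) := by ring
      have h2 : (h + 1) * b = h * b + b := by ring
      rw [chunk, setC, chunk, h1, h2, ← List.append_assoc, List.drop_append, List.drop_of_length_le
        (by simp only [List.length_append, hl, hc]; omega), List.nil_append, List.drop_drop]
      congr 2
      simp only [List.length_append, hl, hc]
      omega

lemma take_succ_chunk (h : ℕ) (w : List Cell) :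
    w.take ((h + 1) * b) = w.take (h * b) ++ chunk b h w := by
  rw [add_mul, one_mul, List.take_add, chunk]

lemma drop_chunk (h : ℕ) (w : List Cell) :
    w.drop (h * b) = chunk b h w ++ w.drop ((h + 1) * b) := by
  rw [add_mul, one_mul, ← List.drop_drop, chunk, List.take_append_drop]

lemma chunk_append {h : ℕ} {u v : List Cell} (hu : u.length = h * b) :
    chunk b h (u ++ v) = v.take b := by
  rw [chunk, List.drop_append_of_le_length hu.ge, List.drop_of_length_le hu.le, List.nil_append]

end Chunks

section SeqL
variable {E P X : Type} {act : Fin 3 → X → X} {r : ℕ}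

def seqL : List (Stmt E P) → Stmt E P
  | [] => .skip
  | s :: l => .seq s (seqL l)

lemma runs_seqL (g : ℕ → Stmt E P) (f : ℕ → St E P X) (n : ℕ)
    (h : ∀ k < n, Runs act r (g k) (f k) ∅ (f (k + 1))) :
    Runs act r (seqL ((List.range n).map g)) (f 0) ∅ (f n) := by
  induction n generalizing g f with
  | zero => exact runs_skip
  | succ n ih =>
    rw [List.range_succ_eq_map, List.map_cons, List.map_map]
    exact Runs.then (h 0 n.succ_pos) (ih (g ∘ Nat.succ) (fun k => f (k + 1)) fun k hk =>
      h (k + 1) (Nat.succ_lt_succ hk))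

lemma size_seqL {ι : Type} (l : List ι) (g : ι → Stmt E P) (c : ℕ) (h : ∀ i, (g i).size ≤ c) :
    (seqL (l.map g)).size ≤ 1 + l.length * (c + 1) := by
  induction l with
  | nil => simp [seqL, Stmt.size]
  | cons a l ih =>
    simp only [List.map_cons, seqL, Stmt.size, List.length_cons, add_mul]
    have := h a
    omega

end SeqL

section Compile
variable {E P X : Type} {act : Fin 3 → X → X} {r : ℕ}

def pp (f : Reg) (h : ℕ) : PP P := if hh : h < 2 * f.rs then .blk ⟨f, ⟨h, hh⟩⟩ else .Z

/-- Apply a sweep to the block number `h`. -/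
def chunkSw (d : Bool) (i j : Reg) (δ : Cell → Cell → Cell → Cell × Cell × Cell) (h : ℕ) :
    Prog E (PP P) :=
  .seq (load .Z (pp i h) .u) <| .seq (load .Z (pp j h) .v) <|
  .seq (.sweep d .u .v δ (fun e => e.2.s2) fun e z => (e.1, { e.2 with s2 := z })) <|
  .seq (store .Z (pp i h) .u) <| .seq (store .Z (pp j h) .v) <|
  .seq (fill z0 .u) (fill z0 .v)

/-- Move one memory pebble along with the walker. -/
def mvOne (s : Fin 3) (q : Σ f : Reg, Fin (2 * f.rs)) : Prog E (PP P) :=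
  .seq (load .Z (.blk q) .u) <| .seq (.move s {.blk q, .Z}) <|
  .seq (store .Z (.blk q) .u) <| .seq (.move s {.Z}) (fill z0 .u)

/-- The program with memory kept by pebbles. -/
def compile : Stmt E P → Prog E (PP P)
  | .skip => .skip
  | .asg k => .asg fun e => (k e.1, e.2)
  | .sweep d i j δ s k =>
    .seq (.asg fun e => (e.1, { e.2 with s2 := s e.1 })) <|
    .seq (seqL ((List.range (2 * i.rs)).map fun n =>
      chunkSw d i j δ (if d then n else 2 * i.rs - 1 - n))) <|
    .asg fun e => (k e.1 e.2.s2, { e.2 with s2 := z0 })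
  | .move s S =>
    .seq (seqL ((Finset.univ : Finset (Σ f : Reg, Fin (2 * f.rs))).toList.map (mvOne s))) <|
    .move s (PP.old '' S ∪ {.Z})
  | .test p k => .test (.old p) fun e c => (k e.1 c, e.2)
  | .explore k => explo .Z k
  | .seq a b => .seq (compile a) (compile b)
  | .ite c a b => .ite (fun e => c e.1) (compile a) (compile b)
  | .loop c a => .loop (fun e => c e.1) (compile a)

/-- Pebble positions encoding a configuration. -/
def encPos (act : Fin 3 → X → X) (r : ℕ) (x : X) (m : Reg → List Cell) (pos : P → X) : PP P → X
  | .old p => pos p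
  | .Z => x
  | .blk q => pt act r x (nv cellE (chunk (2 ^ r) q.2 (m q.1)))

/-- The configuration of the compiled program. -/
def encS (act : Fin 3 → X → X) (r : ℕ) (a : St E P X) (s : Cell) : St (E × Loc) (PP P) X :=
  ⟨(a.e, { s2 := s }), zw r, a.x, encPos act r a.x a.mem a.pos⟩

lemma cln_zw : Cln r (zw r) := ⟨fun _ => length_zw _ _, fun _ _ _ => rfl⟩

lemma pp_eq {f : Reg} {h : ℕ} (hh : h < 2 * f.rs) : pp (P := P) f h = .blk ⟨f, ⟨h, hh⟩⟩ := by
  simp [pp, hh]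

lemma WF.chunk_le {m : Reg → List Cell} (hW : WF (r + 1) m) {f : Reg} {h : ℕ} (hh : h < 2 * f.rs) :
    (h + 1) * 2 ^ r ≤ (m f).length := by
  rw [hW f, pow_succ, show f.rs * (2 ^ r * 2) = (2 * f.rs) * 2 ^ r by ring]
  exact Nat.mul_le_mul_right _ hh

variable [Fintype X] (hi : ∀ s x, act s (act s x) = x) (ht : Transv act)
include hi ht

lemma runs_chunkSw (hN : NN (r + 1) ≤ Nat.card X) {a : St E P X} (hW : WF (r + 1) a.mem) {d : Bool}
    {i j : Reg} {δ : Cell → Cell → Cell → Cell × Cell × Cell} {h : ℕ} (hij : i ≠ j)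
    (hl : i.rs = j.rs) (hh : h < 2 * i.rs) {s s' : Cell} {A B : List Cell}
    (hs : swd d δ s (chunk (2 ^ r) h (a.mem i)) (chunk (2 ^ r) h (a.mem j)) = (s', A, B)) :
    Runs act r (chunkSw d i j δ h) (encS act r a s) ∅
      (encS act r { a with mem := Function.update (Function.update a.mem i
        (setC (2 ^ r) h A (a.mem i))) j (setC (2 ^ r) h B (a.mem j)) } s') := by
  have hN' := (NN_succ_mono r).trans hN
  have hj : h < 2 * j.rs := hl ▸ hh
  have hci := length_chunk (hW.chunk_le hh)
  have hcj := length_chunk (hW.chunk_le hj)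
  have hA : A.length = 2 ^ r ∧ B.length = 2 ^ r := by
    have := swd_length d δ s _ _ (hci.trans hcj.symm)
    rw [hs, hci] at this
    exact this
  have hpij : pp (P := P) i h ≠ pp j h := by rw [pp_eq hh, pp_eq hj]; simp [hij]
  have hpi : pp (P := P) i h ≠ .Z := by rw [pp_eq hh]; simp
  have hpj : pp (P := P) j h ≠ .Z := by rw [pp_eq hj]; simp
  set m1 := Function.update (zw r) .u (chunk (2 ^ r) h (a.mem i)) with hm1
  set m2 := Function.update m1 .v (chunk (2 ^ r) h (a.mem j)) with hm2
  set m3 := Function.update (Function.update m2 .u A) .v B with hm3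
  have hC1 : Cln r m1 := cln_zw.update (Or.inl rfl) hci
  have hC2 : Cln r m2 := hC1.update (Or.inr rfl) hcj
  have hC3 : Cln r m3 := (hC2.update (Or.inl rfl) hA.1).update (Or.inr rfl) hA.2
  have h0i : encPos act r a.x a.mem a.pos (pp i h) = pt act r a.x (nv cellE (chunk (2 ^ r) h (a.mem i))) := by
    rw [pp_eq hh]; rfl
  have h0j : encPos act r a.x a.mem a.pos (pp j h) = pt act r a.x (nv cellE (chunk (2 ^ r) h (a.mem j))) := by
    rw [pp_eq hj]; rfl
  have h0Z : encPos act r a.x a.mem a.pos .Z = a.x := rfl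
  refine Runs.then (runs_load hN hi ht cln_zw h0Z (Or.inl rfl) hci h0i) ?_
  refine Runs.then (runs_load hN hi ht hC1 (by rw [Function.update_of_ne hpi.symm, h0Z]) (Or.inr rfl)
    hcj (by rw [Function.update_of_ne hpij.symm, h0j])) ?_
  refine Runs.then (Runs.to (c := ⟨(a.e, { s2 := s' }), m3, a.x, Function.update
    (Function.update (encPos act r a.x a.mem a.pos) (pp i h) a.x) (pp j h) a.x⟩)
    (runs_sweep hN' (by simp) rfl) ?_) ?_
  · simp only [St.sweep]
    have e1 : Function.update (Function.update (zw r) .u (chunk (2 ^ r) h (a.mem i))) .v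
      (chunk (2 ^ r) h (a.mem j)) .u = chunk (2 ^ r) h (a.mem i) := by simp
    have e2 : Function.update (Function.update (zw r) .u (chunk (2 ^ r) h (a.mem i))) .v
      (chunk (2 ^ r) h (a.mem j)) .v = chunk (2 ^ r) h (a.mem j) := by simp
    simp only [hm3, hm2, hm1, e1, e2, hs]
  refine Runs.then (runs_store (w := A) hN hi ht hC3 (by
    rw [Function.update_of_ne hpj.symm, Function.update_of_ne hpi.symm, h0Z]) (Or.inl rfl) hA.1
    (by simp [hm3]) (by rw [Function.update_of_ne hpij]; simp)) ?_
  refine Runs.then (runs_store (w := B) hN hi ht hC3 (by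
    rw [Function.update_of_ne hpi.symm, Function.update_of_ne hpj.symm,
      Function.update_of_ne hpi.symm, h0Z]) (Or.inr rfl) hA.2
    (by simp [hm3]) (by rw [Function.update_of_ne hpij.symm]; simp)) ?_
  refine Runs.then (runs_fill hN' hC3.wf) (Runs.to (runs_fill hN' (hC3.wf.update (by simp))) ?_)
  simp only [encS, St.mk.injEq, true_and]
  refine ⟨?_, ?_⟩
  · funext f
    cases f <;> simp [hm3, hm2, hm1] <;> rfl
  · funext q
    rcases q with p | _ | ⟨⟨f, k⟩⟩
    · simp [pp_eq hh, pp_eq hj, encPos]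
    · simp [pp_eq hh, pp_eq hj, encPos]
    · rw [pp_eq hh, pp_eq hj]
      by_cases hfj : f = j
      · subst hfj
        by_cases hk : k = ⟨h, hj⟩
        · subst hk
          simp [encPos, chunk_setC (hW.chunk_le hj) hA.2]
        · have hk' : (k : ℕ) ≠ h := fun e => hk (Fin.ext e)
          simp [encPos, chunk_setC (hW.chunk_le hj) hA.2, hk, hk', hij.symm]
      · by_cases hfi : f = i
        · subst hfi
          by_cases hk : k = ⟨h, hh⟩
          · subst hk
            simp [encPos, chunk_setC (hW.chunk_le hh) hA.1, hij]
          · have hk' : (k : ℕ) ≠ h := fun e => hk (Fin.ext e)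
            simp [encPos, chunk_setC (hW.chunk_le hh) hA.1, hk, hk', hij]
        · simp [encPos, hfi, hfj]

lemma runs_sweeps (hN : NN (r + 1) ≤ Nat.card X) {a : St E P X} (hW : WF (r + 1) a.mem) {d : Bool}
    {i j : Reg} {δ : Cell → Cell → Cell → Cell × Cell × Cell} (hij : i ≠ j) (hl : i.rs = j.rs)
    (s : Cell) :
    Runs act r (seqL ((List.range (2 * i.rs)).map fun n =>
      chunkSw d i j δ (if d then n else 2 * i.rs - 1 - n))) (encS act r a s) ∅
      (encS act r { a with mem := Function.update (Function.update a.mem i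
        (swd d δ s (a.mem i) (a.mem j)).2.1) j (swd d δ s (a.mem i) (a.mem j)).2.2 }
        (swd d δ s (a.mem i) (a.mem j)).1) := by
  set A := a.mem i with hA
  set B := a.mem j with hB
  have hlA : A.length = 2 * i.rs * 2 ^ r := by rw [hA, hW i, pow_succ]; ring
  have hlB : B.length = 2 * i.rs * 2 ^ r := by rw [hB, hW j, pow_succ, hl]; ring
  have hle : ∀ n, n ≤ 2 * i.rs → n * 2 ^ r ≤ 2 * i.rs * 2 ^ r := fun n => Nat.mul_le_mul_right _
  let g : Cell × List Cell × List Cell → St (E × Loc) (PP P) X := fun u =>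
    encS act r { a with mem := Function.update (Function.update a.mem i u.2.1) j u.2.2 } u.1
  have step : ∀ (u : Cell × List Cell × List Cell) (h : ℕ), h < 2 * i.rs → u.2.1.length = A.length →
      u.2.2.length = B.length → Runs act r (chunkSw d i j δ h) (g u) ∅
        (g ((swd d δ u.1 (chunk (2 ^ r) h u.2.1) (chunk (2 ^ r) h u.2.2)).1,
          setC (2 ^ r) h (swd d δ u.1 (chunk (2 ^ r) h u.2.1) (chunk (2 ^ r) h u.2.2)).2.1 u.2.1,
          setC (2 ^ r) h (swd d δ u.1 (chunk (2 ^ r) h u.2.1) (chunk (2 ^ r) h u.2.2)).2.2 u.2.2)) := by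
    rintro ⟨s, A', B'⟩ h hh h1 h2
    simp only at h1 h2
    have hW' : WF (r + 1) (Function.update (Function.update a.mem i A') j B') :=
      (hW.update (by rw [h1, hA, hW i])).update (by rw [h2, hB, hW j])
    have ei : Function.update (Function.update a.mem i A') j B' i = A' := by simp [hij]
    have ej : Function.update (Function.update a.mem i A') j B' j = B' := by simp
    have st := runs_chunkSw (a := { a with mem := Function.update (Function.update a.mem i A') j B' })
      (d := d) (δ := δ) (h := h) (s := s)
      (s' := (swd d δ s (chunk (2 ^ r) h A') (chunk (2 ^ r) h B')).1)
      (A := (swd d δ s (chunk (2 ^ r) h A') (chunk (2 ^ r) h B')).2.1)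
      (B := (swd d δ s (chunk (2 ^ r) h A') (chunk (2 ^ r) h B')).2.2)
      hi ht hN hW' hij hl hh (by simp only [ei, ej])
    refine Runs.to st ?_
    simp only [g]
    congr 2
    · funext f
      by_cases hfj : f = j
      · subst hfj
        simp [hij]
      · by_cases hfi : f = i
        · subst hfi
          simp [hij]
        · simp [hfi, hfj]
  cases d
  · let f : ℕ → Cell × List Cell × List Cell := fun n =>
      ((swr δ s (A.drop ((2 * i.rs - n) * 2 ^ r)) (B.drop ((2 * i.rs - n) * 2 ^ r))).1,
        A.take ((2 * i.rs - n) * 2 ^ r) ++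
          (swr δ s (A.drop ((2 * i.rs - n) * 2 ^ r)) (B.drop ((2 * i.rs - n) * 2 ^ r))).2.1,
        B.take ((2 * i.rs - n) * 2 ^ r) ++
          (swr δ s (A.drop ((2 * i.rs - n) * 2 ^ r)) (B.drop ((2 * i.rs - n) * 2 ^ r))).2.2)
    have h0 : f 0 = (s, A, B) := by
      simp only [f, Nat.sub_zero]
      rw [List.drop_of_length_le hlA.le, List.take_of_length_le hlA.le, List.drop_of_length_le hlB.le,
        List.take_of_length_le hlB.le]
      simp [swr]
    have h1 : f (2 * i.rs) = swr δ s A B := by simp [f]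
    have := runs_seqL (act := act) (r := r) (fun n => chunkSw (E := E) (P := P) false i j δ
      (if false then n else 2 * i.rs - 1 - n)) (fun n => g (f n)) (2 * i.rs) ?_
    · refine Runs.to (a := encS act r a s) ?_ (b := g (swr δ s A B)) (by simp [g, swd])
      have h2 : g (f 0) = encS act r a s := by
        simp only [h0, g, hA, hB, Function.update_eq_self]
      rw [h1, h2] at this
      exact this
    · intro n hn
      obtain ⟨h, hh⟩ : ∃ h, 2 * i.rs = n + 1 + h := ⟨2 * i.rs - (n + 1), by omega⟩
      have e1 : 2 * i.rs - n = h + 1 := by omega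
      have e2 : 2 * i.rs - (n + 1) = h := by omega
      have e3 : 2 * i.rs - 1 - n = h := by omega
      have hle1 := hle (h + 1) (by omega)
      have hle0 := hle h (by omega)
      have hdl : (A.drop ((h + 1) * 2 ^ r)).length = (B.drop ((h + 1) * 2 ^ r)).length := by simp [hlA, hlB]
      have hsl := swr_length δ s _ _ hdl
      have st := step (f n) h (by omega) (by
        simp only [f, List.length_append, e1, hsl.1, List.length_take, List.length_drop]; omega) (by
        simp only [f, List.length_append, e1, hsl.2, List.length_take, List.length_drop]; omega)
      simp only [Bool.false_eq_true, if_false, e3]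
      refine Runs.to st ?_
      congr 1
      have ch : ∀ (W T : List Cell), W.length = 2 * i.rs * 2 ^ r →
          chunk (2 ^ r) h (W.take ((h + 1) * 2 ^ r) ++ T) = chunk (2 ^ r) h W ∧
          ∀ c, setC (2 ^ r) h c (W.take ((h + 1) * 2 ^ r) ++ T) = W.take (h * 2 ^ r) ++ (c ++ T) := by
        intro W T hW
        have hl1 : (W.take (h * 2 ^ r)).length = h * 2 ^ r := by rw [List.length_take]; omega
        have hl2 : (W.take ((h + 1) * 2 ^ r)).length = (h + 1) * 2 ^ r := by
          rw [List.length_take]; omega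
        have hc := length_chunk (b := 2 ^ r) (h := h) (w := W) (by omega)
        constructor
        · rw [take_succ_chunk, List.append_assoc, chunk_append hl1,
            List.take_append_of_le_length hc.ge, List.take_of_length_le hc.le]
        · intro c
          rw [setC, List.drop_append_of_le_length hl2.ge, List.drop_of_length_le hl2.le,
            take_succ_chunk, List.append_assoc, List.take_append_of_le_length hl1.ge,
            List.take_of_length_le hl1.le, List.nil_append]
      simp only [f, e1, e2, (ch A _ hlA).1, (ch B _ hlB).1, (ch A _ hlA).2, (ch B _ hlB).2, swd,
        Bool.false_eq_true, if_false]
      rw [drop_chunk h A, drop_chunk h B, swr_append _ _ _ _ _ _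
        ((length_chunk (by omega)).trans (length_chunk (by omega)).symm)]
  · let f : ℕ → Cell × List Cell × List Cell := fun n =>
      ((sw δ s (A.take (n * 2 ^ r)) (B.take (n * 2 ^ r))).1,
        (sw δ s (A.take (n * 2 ^ r)) (B.take (n * 2 ^ r))).2.1 ++ A.drop (n * 2 ^ r),
        (sw δ s (A.take (n * 2 ^ r)) (B.take (n * 2 ^ r))).2.2 ++ B.drop (n * 2 ^ r))
    have h0 : f 0 = (s, A, B) := by simp [f, sw]
    have h1 : f (2 * i.rs) = sw δ s A B := by
      simp only [f]
      rw [List.drop_of_length_le hlA.le, List.take_of_length_le hlA.le, List.drop_of_length_le hlB.le,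
        List.take_of_length_le hlB.le]
      simp
    have := runs_seqL (act := act) (r := r) (fun n => chunkSw (E := E) (P := P) true i j δ
      (if true then n else 2 * i.rs - 1 - n)) (fun n => g (f n)) (2 * i.rs) ?_
    · refine Runs.to (a := encS act r a s) ?_ (b := g (sw δ s A B)) (by simp [g, swd])
      have h2 : g (f 0) = encS act r a s := by
        simp only [h0, g, hA, hB, Function.update_eq_self]
      rw [h1, h2] at this
      exact this
    · intro h hh
      have hle1 := hle (h + 1) (by omega)
      have hle0 := hle h (by omega)
      have hdl : (A.take (h * 2 ^ r)).length = (B.take (h * 2 ^ r)).length := by simp [hlA, hlB]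
      have hsl := sw_length δ s _ _ hdl
      have hl1 : (A.take (h * 2 ^ r)).length = h * 2 ^ r := by rw [List.length_take]; omega
      rw [hl1] at hsl
      have st := step (f h) h (by omega) (by
        simp only [f, List.length_append, hsl.1, List.length_drop]; omega) (by
        simp only [f, List.length_append, hsl.2, List.length_drop]; omega)
      simp only [if_true]
      refine Runs.to st ?_
      congr 1
      have ch : ∀ (W T : List Cell), W.length = 2 * i.rs * 2 ^ r → T.length = h * 2 ^ r →
          chunk (2 ^ r) h (T ++ W.drop (h * 2 ^ r)) = chunk (2 ^ r) h W ∧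
          ∀ c, setC (2 ^ r) h c (T ++ W.drop (h * 2 ^ r)) = T ++ (c ++ W.drop ((h + 1) * 2 ^ r)) := by
        intro W T hW hT
        constructor
        · rw [chunk_append hT, chunk]
        · intro c
          have e : h * 2 ^ r + ((h + 1) * 2 ^ r - T.length) = (h + 1) * 2 ^ r := by
            rw [hT, add_mul]; omega
          rw [setC, List.take_append_of_le_length hT.ge, List.take_of_length_le hT.le,
            List.drop_append, List.drop_of_length_le (by rw [hT, add_mul]; omega),
            List.nil_append, List.drop_drop, e]
      simp only [f, (ch A _ hlA hsl.1).1, (ch B _ hlB hsl.2).1, (ch A _ hlA hsl.1).2,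
        (ch B _ hlB hsl.2).2, swd, if_true]
      rw [take_succ_chunk h A, take_succ_chunk h B, sw_append _ _ _ _ _ _ hdl]
      simp

lemma runs_moves (hN : NN (r + 1) ≤ Nat.card X) {a : St E P X} (hW : WF (r + 1) a.mem)
    (s : Fin 3) (S : Set P) :
    Runs act r (compile (.move s S)) (encS act r a z0) ∅ (encS act r (a.move act s S) z0) := by
  have hN' := (NN_succ_mono r).trans hN
  set x' := act s a.x with hx'
  have hxx : act s x' = a.x := hi s a.x
  let φ : List (Σ f : Reg, Fin (2 * f.rs)) → PP P → X := fun D q =>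
    match q with
    | .blk q => pt act r (if q ∈ D then a.x else x') (nv cellE (chunk (2 ^ r) q.2 (a.mem q.1)))
    | q => encPos act r a.x a.mem a.pos q
  have key : ∀ D : List (Σ f : Reg, Fin (2 * f.rs)), D.Nodup →
      Runs act r (seqL (D.map (mvOne s))) ⟨(a.e, {}), zw r, a.x, φ D⟩ ∅
        ⟨(a.e, {}), zw r, a.x, φ []⟩ := by
    intro D hD
    induction D with
    | nil => exact runs_skip
    | cons q D ih =>
      rw [List.nodup_cons] at hD
      refine Runs.then (b := ⟨(a.e, {}), zw r, a.x, φ D⟩) ?_ (ih hD.2)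
      set w := chunk (2 ^ r) q.2 (a.mem q.1) with hw
      have hwl : w.length = 2 ^ r := length_chunk (hW.chunk_le q.2.2)
      set m1 := Function.update (zw r) .u w with hm1
      have hC1 : Cln r m1 := cln_zw.update (Or.inl rfl) hwl
      have h0q : φ (q :: D) (.blk q) = pt act r a.x (nv cellE w) := by simp [φ, hw]
      have h0Z : φ (q :: D) .Z = a.x := rfl
      refine Runs.then (runs_load hN hi ht cln_zw h0Z (Or.inl rfl) hwl h0q) ?_
      refine Runs.then (Runs.to (c := ⟨(a.e, {}), m1, x', Function.update
        (Function.update (φ D) (.blk q) x') .Z x'⟩) (runs_move hN') ?_) ?_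
      · simp only [St.move, St.mk.injEq, true_and]
        refine ⟨hm1.symm, hx'.symm, ?_⟩
        funext p
        by_cases hp : p = .blk q
        · subst hp; simp [← hx']
        · by_cases hp' : p = .Z
          · subst hp'; simp [← hx', φ, encPos]
          · simp only [Set.mem_insert_iff, hp, hp', Set.mem_singleton_iff, or_self, false_and,
              if_false, ne_eq, not_false_eq_true, Function.update_of_ne]
            rcases p with p | _ | q'
            · rfl
            · rfl
            · have : q' ≠ q := fun e => hp (by rw [e])
              simp [φ, this]
      refine Runs.then (runs_store (w := w) hN hi ht hC1 (by simp) (Or.inl rfl) hwl (by simp [hm1])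
        (by simp)) ?_
      refine Runs.then (Runs.to (c := ⟨(a.e, {}), m1, a.x, φ D⟩) (runs_move hN') ?_) (Runs.to
        (runs_fill hN' hC1.wf) ?_)
      · simp only [St.move, St.mk.injEq, true_and]
        refine ⟨hxx, ?_⟩
        funext p
        rcases p with p | _ | q'
        · simp
        · simp [hxx, φ, encPos]
        · by_cases hp : q' = q
          · subst hp
            simp [φ, hD.1, hw]
          · simp [hp]
      · simp only [St.mk.injEq, true_and, and_true]
        funext f
        cases f <;> simp [hm1] <;> rfl
  refine Runs.then (Runs.to (a := encS act r a z0) (b := ⟨(a.e, {}), zw r, a.x, φ []⟩) ?_ rfl)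
    (Runs.to (runs_move hN') ?_)
  · have := key (Finset.univ : Finset (Σ f : Reg, Fin (2 * f.rs))).toList (Finset.nodup_toList _)
    have e : φ (Finset.univ : Finset (Σ f : Reg, Fin (2 * f.rs))).toList = encPos act r a.x a.mem a.pos := by
      funext p
      rcases p with p | _ | q
      · rfl
      · rfl
      · simp [φ, encPos]
    rw [e] at this
    exact this
  · simp only [St.move, encS, St.mk.injEq, true_and]
    funext p
    rcases p with p | _ | q
    · simp [φ, encPos]
    · simp [φ, encPos]
    · simp [φ, encPos, hx']

end Compile

section Size
variable {E P : Type}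

lemma size_visit (i : Bool) (S : Set P) (q : P) (bk : Bool) :
    (visit i S q bk : Prog E P).size ≤ 200 := by
  simp [visit, goTo, goBack, walk, fwdStep, bwdStep, mvs, mark, head, rotl, rotr, clr, sweep1, cmpw,
    inc1, fill, copy, Stmt.size]

lemma size_scan (Z : P) (body : Prog E P) : (scan Z body).size ≤ body.size + 1000 := by
  have h1 := size_visit (E := E) true {Z} Z false
  have h2 := size_visit (E := E) false ∅ Z false
  have h3 := size_visit (E := E) true ∅ Z true
  have h4 := size_visit (E := E) true ∅ Z false
  have h5 := size_visit (E := E) true {Z} Z true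
  simp only [scan, isNew, inc1, inc2, cmpIJ, cmpw, fill, sweep1, Stmt.size]
  omega

lemma size_load (Z p : P) (f : Reg) : (load Z p f : Prog E P).size ≤ 1300 := by
  have h := size_visit (E := E) true ∅ p true
  have h' := size_scan (E := E) Z (.seq (visit true ∅ p true) <|
    .ite (fun e => e.2.seen)
      (.seq (copy .cnt f) (.asg fun e => (e.1, { e.2 with hit := true, seen := false }))) .skip)
  simp only [copy, Stmt.size] at h'
  simp only [load, copy, Stmt.size]
  omega

lemma size_store (Z p : P) (f : Reg) : (store Z p f : Prog E P).size ≤ 1300 := by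
  have h := size_visit (E := E) true {p} p false
  have h' := size_scan (E := E) Z (.seq (cmpw .cnt f fun e c => (e.1, { e.2 with eqJ := c })) <|
    .ite (fun e => e.2.eqJ)
      (.seq (visit true {p} p false)
        (.asg fun e => (e.1, { e.2 with hit := true, seen := false, eqJ := false }))) .skip)
  simp only [cmpw, Stmt.size] at h'
  simp only [store, cmpw, Stmt.size]
  omega

lemma size_explo (Z : P) (k : E → Bool → E) : (explo Z k).size ≤ 1300 := by
  have h' := size_scan (E := E) Z (ismax .cnt fun e c => (e.1, { e.2 with hit := c }))
  simp only [ismax, sweep1, Stmt.size] at h'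
  simp only [explo, ismax, sweep1, Stmt.size]
  omega

lemma Reg.rs_le (f : Reg) : f.rs ≤ c1 + c2 := by
  have h1 : 0 < c1 := rs_pos .w
  have h2 : 0 < c2 := rs_pos .it
  cases f <;> simp only [Reg.rs] <;> omega

/-- The number of memory blocks. -/
@[irreducible] def nblk : ℕ := Fintype.card (Σ f : Reg, Fin (2 * f.rs))

/-- The growth of the program size in a compilation. -/
@[irreducible] def cD : ℕ := 20000 * (c1 + c2 + nblk + 1)

lemma cD_ge : (∀ f : Reg, f.rs * 20000 + 20000 ≤ cD) ∧ nblk * 20000 + 20000 ≤ cD := by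
  have h : ∀ {n m : ℕ}, n ≤ m → n * 20000 + 20000 ≤ 20000 * (m + 1) := fun h => by omega
  unfold cD
  exact ⟨fun f => h (f.rs_le.trans (by omega)), h (by omega)⟩

lemma size_chunkSw (d : Bool) (i j : Reg) (δ : Cell → Cell → Cell → Cell × Cell × Cell) (h : ℕ) :
    (chunkSw d i j δ h : Prog E (PP P)).size ≤ 6000 := by
  have b1 := size_load (E := E) (P := PP P) .Z (pp i h) .u
  have b2 := size_load (E := E) (P := PP P) .Z (pp j h) .v
  have b3 := size_store (E := E) (P := PP P) .Z (pp i h) .u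
  have b4 := size_store (E := E) (P := PP P) .Z (pp j h) .v
  simp only [chunkSw, fill, sweep1, Stmt.size]
  omega

lemma size_mvOne (s : Fin 3) (q : Σ f : Reg, Fin (2 * f.rs)) :
    (mvOne s q : Prog E (PP P)).size ≤ 6000 := by
  have a1 := size_load (E := E) (P := PP P) .Z (.blk q) .u
  have a2 := size_store (E := E) (P := PP P) .Z (.blk q) .u
  simp only [mvOne, fill, sweep1, Stmt.size]
  omega

lemma size_compile_le (s : Stmt E P) : (compile s).size ≤ cD * s.size := by
  have hD : 10000 ≤ cD := by have := cD_ge.2; omega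
  have h1 : ∀ n : ℕ, 1 ≤ n → cD ≤ cD * n := fun n hn => Nat.le_mul_of_pos_right _ hn
  induction s with
  | skip => simp [compile, Stmt.size]; omega
  | asg k => simp [compile, Stmt.size]; omega
  | sweep d i j δ s k =>
    have hl := size_seqL (List.range (2 * i.rs)) (fun n => (chunkSw d i j δ
      (if d then n else 2 * i.rs - 1 - n) : Prog E (PP P))) _ fun n => size_chunkSw d i j δ _
    simp only [List.length_range] at hl
    have hc := cD_ge.1 i
    simp only [compile, Stmt.size]
    generalize (seqL _).size = z at *
    omega
  | move s S =>
    have hl := size_seqL (Finset.univ : Finset (Σ f : Reg, Fin (2 * f.rs))).toList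
      (mvOne s : _ → Prog E (PP P)) _ fun q => size_mvOne s q
    rw [Finset.length_toList, Finset.card_univ] at hl
    have hc := cD_ge.2
    simp only [compile, Stmt.size]
    rw [nblk] at hc
    generalize Fintype.card (Σ f : Reg, Fin (2 * f.rs)) = N at *
    generalize (seqL _).size = z at *
    omega
  | test p k => simp [compile, Stmt.size]; omega
  | explore k =>
    have := size_explo (E := E) (P := PP P) .Z k
    simp only [compile, Stmt.size]; omega
  | seq a b iha ihb => simp only [compile, Stmt.size, mul_add]; omega
  | ite c a b iha ihb => simp only [compile, Stmt.size, mul_add]; omega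
  | loop c a ih => simp only [compile, Stmt.size, mul_add]; omega

end Size

/-- The slowdown of a compilation. -/
@[irreducible] def slow (r : ℕ) : ℕ := (MM r + 3) ^ cD

section Main
variable {E P X : Type} {act : Fin 3 → X → X} {r : ℕ}

lemma Ev.wf {s : Stmt E P} {a b : St E P X} {t : ℕ} {V : Set X} {l : ℕ} (hE : Ev act r s a t V b)
    (hW : WF l a.mem) : WF l b.mem := by
  induction hE with
  | sweep d i j δ s k a h hij hl =>
    have := swd_length d δ (s a.e) (a.mem i) (a.mem j) (by rw [hW, hW, hl])
    exact (hW.update (by rw [this.1, hW])).update (by rw [this.2, hW, hl])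
  | seq _ _ h1 h2 => exact h2 (h1 hW)
  | ite_true _ _ h => exact h hW
  | ite_false _ _ h => exact h hW
  | loop_true _ _ _ h1 h2 => exact h2 (h1 hW)
  | _ => exact hW

lemma Runs.ev {s : Stmt E P} {a b : St (E × Loc) (PP P) X} {V : Set X}
    (h : Runs act r (compile s) a V b) (hs : s.size = 1) :
    ∃ t ≤ 1 * slow r, ∃ V' ⊇ V, Ev act r (compile s) a t V' b := by
  obtain ⟨t, ht, V', hV, hE⟩ := h
  refine ⟨t, ?_, V', hV, hE⟩
  have h1 := (compile s).tb_le (MM r)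
  have h2 := size_compile_le s
  rw [hs, mul_one] at h2
  have h3 := Nat.pow_le_pow_right (show 0 < MM r + 3 by omega) h2
  unfold slow
  omega

lemma Ev.compile [Fintype X] (hi : ∀ s x, act s (act s x) = x) (ht : Transv act) {s : Stmt E P} {a b : St E P X}
    {t : ℕ} {V : Set X} (hE : Ev act (r + 1) s a t V b) (hW : WF (r + 1) a.mem) :
    ∃ t' ≤ t * slow r, ∃ V' ⊇ V, Ev act r (compile s) (encS act r a z0) t' V' (encS act r b z0) := by
  have hpos : 1 ≤ slow r := by unfold slow; exact Nat.one_le_pow _ _ (by omega)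
  induction hE with
  | skip a => exact ⟨0, by simp, ∅, le_rfl, .skip _⟩
  | asg k a => exact Runs.ev (runs_asg _) rfl
  | sweep d i j δ s k a h hij hl =>
    refine Runs.ev ?_ rfl
    exact Runs.then (runs_asg _) (Runs.then (runs_sweeps hi ht h hW hij hl (s a.e)) (runs_asg _))
  | move s S a h => exact Runs.ev (runs_moves hi ht h hW s S) rfl
  | test p k a => exact Runs.ev (runs_test _ _) rfl
  | explore k a => exact Runs.ev (runs_explo (pos := encPos act r a.x a.mem a.pos) hi ht cln_zw rfl k) rfl
  | seq h₁ h₂ ih₁ ih₂ =>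
    obtain ⟨t₁, b₁, V₁, hV₁, e₁⟩ := ih₁ hW
    obtain ⟨t₂, b₂, V₂, hV₂, e₂⟩ := ih₂ (h₁.wf hW)
    exact ⟨_, by rw [add_mul, add_mul]; omega, _, Set.union_subset_union hV₁ hV₂, .seq e₁ e₂⟩
  | ite_true hc h ih =>
    obtain ⟨t₁, b₁, V₁, hV₁, e₁⟩ := ih hW
    exact ⟨_, by rw [add_mul]; omega, _, hV₁, .ite_true hc e₁⟩
  | ite_false hc h ih =>
    obtain ⟨t₁, b₁, V₁, hV₁, e₁⟩ := ih hW
    exact ⟨_, by rw [add_mul]; omega, _, hV₁, .ite_false hc e₁⟩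
  | loop_true hc h₁ h₂ ih₁ ih₂ =>
    obtain ⟨t₁, b₁, V₁, hV₁, e₁⟩ := ih₁ hW
    obtain ⟨t₂, b₂, V₂, hV₂, e₂⟩ := ih₂ (h₁.wf hW)
    exact ⟨_, by rw [add_mul, add_mul]; omega, _, Set.union_subset_union hV₁ hV₂,
      .loop_true hc e₁ e₂⟩
  | loop_false hc => exact ⟨1, by omega, ∅, le_rfl, .loop_false hc⟩

end Main

lemma encPos_zw {P X : Type} {act : Fin 3 → X → X} (r : ℕ) (x : X) :
    encPos act r x (zw (r + 1)) (fun _ : P => x) = fun _ => x := by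
  funext p
  rcases p with p | _ | q
  · rfl
  · rfl
  · have hW : WF (r + 1) (zw (r + 1)) := fun f => length_zw _ _
    have hl := length_chunk (hW.chunk_le q.2.2)
    have : chunk (2 ^ r) q.2 (zw (r + 1) q.1) = nw cellE (2 ^ r) 0 := by
      rw [nw_zero, cellE_symm_zero, List.eq_replicate_iff]
      refine ⟨hl, fun b hb => ?_⟩
      rw [chunk] at hb
      exact List.eq_of_mem_replicate (List.mem_of_mem_drop (List.mem_of_mem_take hb))
    simp only [encPos, this]
    rw [nv_nw _ _ _ (pow_pos (Nat.pos_of_ne_zero (NeZero.ne kap)) _), pt_zero]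

instance {P : Type} [Finite P] : Finite (PP P) :=
  Finite.of_injective (β := P ⊕ Option (Σ f : Reg, Fin (2 * f.rs)))
    (fun | .old p => .inl p | .Z => .inr none | .blk q => .inr (some q))
    (fun a b h => by rcases a with a | _ | a <;> rcases b with b | _ | b <;> simp_all)

lemma card_PP {P : Type} [Finite P] : Nat.card (PP P) ≤ Nat.card P + (nblk + 1) := by
  have : Nat.card (P ⊕ Option (Σ f : Reg, Fin (2 * f.rs))) = Nat.card P + (nblk + 1) := by
    rw [Nat.card_sum, Finite.card_option, Nat.card_eq_fintype_card (α := Σ f : Reg, _), nblk]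
  rw [← this]
  exact Nat.card_le_card_of_injective
    (fun | .old p => .inl p | .Z => .inr none | .blk q => .inr (some q))
    (fun a b h => by rcases a with a | _ | a <;> rcases b with b | _ | b <;> simp_all)

/-- The programs for exploration, of any depth. -/
theorem exists_explore (n : ℕ) : ∃ (E P : Type) (_ : Finite E) (_ : Finite P) (s : Stmt E P) (e : E),
    Nat.card E ≤ Nat.card Loc ^ n ∧ Nat.card P ≤ n * (nblk + 1) ∧ s.size ≤ cD ^ n ∧
    ∀ (l : ℕ) (X : Type) (_ : Fintype X) (act : Fin 3 → X → X), (∀ s x, act s (act s x) = x) →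
      Transv act → Nat.card X < NN (l + n) → ∀ x : X,
      ∃ t ≤ ∏ i ∈ Finset.range n, slow (l + i),
        Ev act l s ⟨e, zw l, x, fun _ => x⟩ t Set.univ ⟨e, zw l, x, fun _ => x⟩ := by
  induction n with
  | zero =>
    refine ⟨Unit, Empty, inferInstance, inferInstance, .explore fun e _ => e, (), by simp, by simp,
      by simp [Stmt.size], fun l X _ act hi ht hX x => ⟨1, by simp, ?_⟩⟩
    have := Ev.explore (P := Empty) (act := act) (r := l) (fun (e : Unit) _ => e)
      ⟨(), zw l, x, fun _ => x⟩
    rwa [if_pos (by simpa using hX)] at this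
  | succ n ih =>
    obtain ⟨E, P, _, _, s, e, hE, hP, hs, h⟩ := ih
    refine ⟨E × Loc, PP P, inferInstance, inferInstance, compile s, (e, { s2 := z0 }), ?_, ?_, ?_,
      fun l X _ act hi ht hX x => ?_⟩
    · rw [Nat.card_prod, pow_succ]
      exact Nat.mul_le_mul_right _ hE
    · rw [add_mul, one_mul]
      exact card_PP.trans (Nat.add_le_add_right hP _)
    · rw [pow_succ, mul_comm]
      exact (size_compile_le s).trans (Nat.mul_le_mul_left _ hs)
    · obtain ⟨t, ht', hEv⟩ := h (l + 1) X inferInstance act hi ht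
        (by rwa [show l + 1 + n = l + (n + 1) by ring]) x
      obtain ⟨t', ht'', V', hV', hEv'⟩ := hEv.compile hi ht (fun f => length_zw _ _)
      obtain rfl : V' = Set.univ := Set.univ_subset_iff.1 hV'
      have e1 : encS act l ⟨e, zw (l + 1), x, fun _ => x⟩ z0 =
          (⟨(e, { s2 := z0 }), zw l, x, fun _ => x⟩ : St (E × Loc) (PP P) X) := by
        simp only [encS, encPos_zw]
      rw [e1] at hEv'
      refine ⟨t', ht''.trans ?_, hEv'⟩
      rw [Finset.prod_range_succ']
      refine Nat.mul_le_mul_right _ (ht'.trans_eq (Finset.prod_congr rfl fun i _ => ?_))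
      rw [show l + 1 + i = l + (i + 1) by ring]

/-- Configurations of an automaton with control states `Q` walking on `X` with pebbles `P`. -/
@[ext] structure PCfg (Q P X : Type) where
  q : Q
  x : X
  pos : P → X

/-- Transition functions of pebble automata. -/
abbrev PAut (Q P : Type) := Q → (P → Bool) → Q × Option (Fin 3 × Set P)

section Automata
variable {Q P X : Type}

/-- One step of a pebble automaton. -/
def PAut.step (δ : PAut Q P) (act : Fin 3 → X → X) (c : PCfg Q P X) : PCfg Q P X where
  q := (δ c.q fun p => decide (c.pos p = c.x)).1
  x := (δ c.q fun p => decide (c.pos p = c.x)).2.elim c.x fun o => act o.1 c.x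
  pos := fun p => (δ c.q fun p => decide (c.pos p = c.x)).2.elim (c.pos p) fun o =>
    if p ∈ o.2 ∧ c.pos p = c.x then act o.1 c.x else c.pos p

/-- The restriction of a pebble automaton to a set of control states. -/
def PAut.restrict (δ : PAut Q P) (S : Set Q) : PAut S P := fun q v =>
  if h : (δ q v).1 ∈ S then (⟨_, h⟩, (δ q v).2) else (q, none)

/-- Forgetting the restriction of control states. -/
def PCfg.val {S : Set Q} (c : PCfg S P X) : PCfg Q P X := ⟨c.q, c.x, c.pos⟩

lemma PAut.val_step {δ : PAut Q P} {S : Set Q} (hS : ∀ q ∈ S, ∀ v, (δ q v).1 ∈ S)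
    (act : Fin 3 → X → X) (c : PCfg S P X) :
    ((δ.restrict S).step act c).val = δ.step act c.val := by
  have h := hS c.q c.q.2 fun p => decide (c.pos p = c.x)
  simp only [PAut.step, PAut.restrict, dif_pos h, PCfg.val]
  rfl

lemma PAut.val_iterate {δ : PAut Q P} {S : Set Q} (hS : ∀ q ∈ S, ∀ v, (δ q v).1 ∈ S)
    (act : Fin 3 → X → X) (n : ℕ) (c : PCfg S P X) :
    (((δ.restrict S).step act)^[n] c).val = (δ.step act)^[n] c.val := by
  induction n generalizing c with
  | zero => rfl
  | succ n ih => rw [Function.iterate_succ_apply, ih, PAut.val_step hS, Function.iterate_succ_apply]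

end Automata

section Machine
variable {E P X : Type}

/-- Control states for the execution of programs: a stack of programs, the control state of the
programs and the memory. -/
abbrev Ctl (E P : Type) := List (Stmt E P) × E × (Reg → List Cell)

/-- Execution of programs at level 0 by pebble automata. -/
def exec : PAut (Ctl E P) P
  | ([], e, m), _ => (([], e, m), none)
  | (.skip :: K, e, m), _ => ((K, e, m), none)
  | (.asg k :: K, e, m), _ => ((K, k e, m), none)
  | (.sweep d i j δ s k :: K, e, m), _ =>
    ((K, k e (swd d δ (s e) (m i) (m j)).1, if i.rs = j.rs then Function.update (Function.update m i
      (swd d δ (s e) (m i) (m j)).2.1) j (swd d δ (s e) (m i) (m j)).2.2 else m), none)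
  | (.move s S :: K, e, m), _ => ((K, e, m), some (s, S))
  | (.test p k :: K, e, m), v => ((K, k e (v p), m), none)
  | (.explore k :: K, e, m), _ => ((K, k e false, m), none)
  | (.seq a b :: K, e, m), _ => ((a :: b :: K, e, m), none)
  | (.ite c a b :: K, e, m), _ => (((if c e then a else b) :: K, e, m), none)
  | (.loop c a :: K, e, m), _ => ((if c e then a :: .loop c a :: K else K, e, m), none)

end Machine
section Exec
variable {E P X : Type} {act : Fin 3 → X → X}

def St.cfg (K : List (Stmt E P)) (a : St E P X) : PCfg (Ctl E P) P X := ⟨(K, a.e, a.mem), a.x, a.pos⟩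

/-- Execution of a program with at most `t` steps, visiting `V`. -/
def Exe (act : Fin 3 → X → X) (c : PCfg (Ctl E P) P X) (t : ℕ) (V : Set X)
    (d : PCfg (Ctl E P) P X) : Prop :=
  ∃ n ≤ t, (exec.step act)^[n] c = d ∧ ∀ y ∈ V, ∃ m ≤ n, ((exec.step act)^[m] c).x = y

lemma exe_one {c d : PCfg (Ctl E P) P X} (h : exec.step act c = d) : Exe act c 1 {c.x} d :=
  ⟨1, le_rfl, h, fun y hy => ⟨0, by omega, hy.symm⟩⟩

lemma Exe.mono {c d : PCfg (Ctl E P) P X} {t t' : ℕ} {V V' : Set X} (h : Exe act c t V d)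
    (ht : t ≤ t') (hV : V' ⊆ V) : Exe act c t' V' d := by
  obtain ⟨n, hn, he, hv⟩ := h
  exact ⟨n, hn.trans ht, he, fun y hy => hv y (hV hy)⟩

lemma Exe.comp {c d f : PCfg (Ctl E P) P X} {t t' : ℕ} {V V' : Set X} (h : Exe act c t V d)
    (h' : Exe act d t' V' f) : Exe act c (t + t') (V ∪ V') f := by
  obtain ⟨n, hn, rfl, hv⟩ := h
  obtain ⟨n', hn', rfl, hv'⟩ := h'
  refine ⟨n' + n, by omega, Function.iterate_add_apply _ _ _ _, ?_⟩
  rintro y (hy | hy)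
  · obtain ⟨m, hm, e⟩ := hv y hy
    exact ⟨m, by omega, e⟩
  · obtain ⟨m, hm, e⟩ := hv' y hy
    exact ⟨m + n, by omega, by rw [Function.iterate_add_apply, e]⟩

lemma Ev.exe {s : Stmt E P} {a b : St E P X} {t : ℕ} {V : Set X} (h : Ev act 0 s a t V b)
    (K : List (Stmt E P)) : Exe act (a.cfg (s :: K)) (2 * t + 1) V (b.cfg K) := by
  induction h generalizing K with
  | explore k a =>
    refine (exe_one ?_).mono (by omega) (by simp [NN])
    simp [PAut.step, exec, St.cfg, NN]
  | seq h₁ h₂ ih₁ ih₂ =>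
    exact ((exe_one rfl).comp ((ih₁ _).comp (ih₂ _))).mono (by omega) Set.subset_union_right
  | @ite_true c s₁ s₂ a b t V hc h ih =>
    have h1 : exec.step act (a.cfg (.ite c s₁ s₂ :: K)) = a.cfg (s₁ :: K) := by
      simp [PAut.step, exec, St.cfg, hc]
    exact ((exe_one h1).comp (ih _)).mono (by omega) Set.subset_union_right
  | @ite_false c s₁ s₂ a b t V hc h ih =>
    have h1 : exec.step act (a.cfg (.ite c s₁ s₂ :: K)) = a.cfg (s₂ :: K) := by
      simp [PAut.step, exec, St.cfg, hc]
    exact ((exe_one h1).comp (ih _)).mono (by omega) Set.subset_union_right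
  | @loop_true c s a b d t₁ t₂ V₁ V₂ hc h₁ h₂ ih₁ ih₂ =>
    have h1 : exec.step act (a.cfg (.loop c s :: K)) = a.cfg (s :: .loop c s :: K) := by
      simp [PAut.step, exec, St.cfg, hc]
    exact ((exe_one h1).comp ((ih₁ _).comp (ih₂ _))).mono (by omega) Set.subset_union_right
  | @loop_false c s a hc =>
    refine (exe_one ?_).mono (by omega) (by simp)
    simp [PAut.step, exec, St.cfg, hc]
  | skip a => exact (exe_one rfl).mono (by omega) (by simp)
  | asg k a => exact (exe_one rfl).mono (by omega) (by simp)
  | sweep d i j δ s k a h hij hl =>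
    refine (exe_one ?_).mono (by omega) (by simp)
    simp [PAut.step, exec, St.cfg, St.sweep, hl]
  | move s S a h => exact (exe_one rfl).mono (by omega) (by simp)
  | test p k a => exact (exe_one rfl).mono (by omega) subset_rfl

/-- The stacks arising in the execution of `s` on top of `K`. -/
def stk : Stmt E P → List (Stmt E P) → List (List (Stmt E P))
  | .seq a b, K => (.seq a b :: K) :: (stk a (b :: K) ++ stk b K)
  | .ite c a b, K => (.ite c a b :: K) :: (stk a K ++ stk b K)
  | .loop c a, K => (.loop c a :: K) :: stk a (.loop c a :: K)
  | s, K => [s :: K]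

lemma length_stk (s : Stmt E P) (K : List (Stmt E P)) : (stk s K).length ≤ s.size := by
  induction s generalizing K with
  | seq a b iha ihb =>
    have := iha (b :: K)
    have := ihb K
    simp only [stk, Stmt.size, List.length_cons, List.length_append]
    omega
  | ite c a b iha ihb =>
    have := iha K
    have := ihb K
    simp only [stk, Stmt.size, List.length_cons, List.length_append]
    omega
  | loop c a ih =>
    have := ih (.loop c a :: K)
    simp only [stk, Stmt.size, List.length_cons]
    omega
  | _ => simp [stk, Stmt.size]

lemma mem_stk (s : Stmt E P) (K : List (Stmt E P)) : s :: K ∈ stk s K := by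
  cases s <;> simp [stk]

lemma exec_stk (s : Stmt E P) (K : List (Stmt E P)) {L : List (Stmt E P)} (hL : L ∈ stk s K) (e : E)
    (m : Reg → List Cell) (v : P → Bool) :
    (exec (L, e, m) v).1.1 ∈ stk s K ∨ (exec (L, e, m) v).1.1 = K := by
  induction s generalizing K with
  | seq a b iha ihb =>
    simp only [stk, List.mem_cons, List.mem_append] at hL ⊢
    rcases hL with rfl | hL | hL
    · exact Or.inl (Or.inr (Or.inl (mem_stk _ _)))
    · rcases iha _ hL with h | h
      · exact Or.inl (Or.inr (Or.inl h))
      · exact Or.inl (Or.inr (Or.inr (h ▸ mem_stk _ _)))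
    · rcases ihb _ hL with h | h
      · exact Or.inl (Or.inr (Or.inr h))
      · exact Or.inr h
  | ite c a b iha ihb =>
    simp only [stk, List.mem_cons, List.mem_append] at hL ⊢
    rcases hL with rfl | hL | hL
    · simp only [exec]
      split_ifs
      · exact Or.inl (Or.inr (Or.inl (mem_stk _ _)))
      · exact Or.inl (Or.inr (Or.inr (mem_stk _ _)))
    · rcases iha _ hL with h | h
      · exact Or.inl (Or.inr (Or.inl h))
      · exact Or.inr h
    · rcases ihb _ hL with h | h
      · exact Or.inl (Or.inr (Or.inr h))
      · exact Or.inr h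
  | loop c a ih =>
    simp only [stk, List.mem_cons] at hL ⊢
    rcases hL with rfl | hL
    · simp only [exec]
      split_ifs
      · exact Or.inl (Or.inr (mem_stk _ _))
      · exact Or.inr rfl
    · rcases ih _ hL with h | h
      · exact Or.inl (Or.inr h)
      · exact Or.inl (Or.inl h)
  | _ =>
    simp only [stk, List.mem_singleton] at hL
    subst hL
    exact Or.inr rfl

/-- The control states used by a program. -/
def ctls (s : Stmt E P) : Set (Ctl E P) :=
  {L | L ∈ stk s [] ∨ L = []} ×ˢ (Set.univ ×ˢ {m | ∀ f, (m f).length = f.rs})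

lemma exec_mem_ctls {s : Stmt E P} (q : Ctl E P) (hq : q ∈ ctls s) (v : P → Bool) :
    (exec q v).1 ∈ ctls s := by
  obtain ⟨L, e, m⟩ := q
  obtain ⟨hL, -, hm⟩ := hq
  refine ⟨?_, trivial, ?_⟩
  · rcases hL with hL | rfl
    · exact exec_stk s [] hL e m v
    · exact Or.inr rfl
  · rcases L with _ | ⟨s, K⟩
    · exact hm
    · cases s with
      | sweep d i j δ z k =>
        simp only [exec]
        split_ifs with hl
        · intro f
          have := swd_length d δ (z e) (m i) (m j) (by rw [hm i, hm j, hl])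
          rw [hm i] at this
          by_cases hfj : f = j
          · subst hfj; simp [this.2, hl]
          · by_cases hfi : f = i
            · subst hfi; simp [hfj, this.1]
            · simp only [ne_eq, hfj, not_false_eq_true, Function.update_of_ne, hfi]
              exact hm f
        · exact hm
      | _ => exact hm

/-- The number of memory contents at level 0. -/
def nmem : ℕ := Nat.card (∀ f : Reg, Fin f.rs → Cell)

lemma ctls_card [Finite E] (s : Stmt E P) : Finite (ctls s) ∧
    Nat.card (ctls s) ≤ (s.size + 1) * (Nat.card E * nmem) := by
  let g : ctls s → Fin (s.size + 1) × E × (∀ f : Reg, Fin f.rs → Cell) := fun q =>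
    (Fin.ofNat _ (([] :: stk s []).idxOf q.1.1), q.1.2.1, fun f i =>
      (q.1.2.2 f)[i]'(by rw [q.2.2.2 f]; exact i.2))
  have hg : Function.Injective g := by
    rintro ⟨⟨L, e, m⟩, hq⟩ ⟨⟨L', e', m'⟩, hq'⟩ h
    obtain ⟨hL, hm⟩ := And.intro hq.1 hq.2.2
    obtain ⟨hL', hm'⟩ := And.intro hq'.1 hq'.2.2
    simp only [g, Prod.mk.injEq] at h
    obtain ⟨h1, rfl, h3⟩ := h
    have hlt : ∀ {L}, L ∈ stk s [] ∨ L = [] →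
        L ∈ [] :: stk s [] ∧ ([] :: stk s []).idxOf L < s.size + 1 := by
      intro L hL
      have : L ∈ [] :: stk s [] := by
        rcases hL with h | rfl
        · exact List.mem_cons_of_mem _ h
        · exact List.mem_cons_self
      refine ⟨this, (List.idxOf_lt_length_of_mem this).trans_le ?_⟩
      simpa using length_stk s []
    have hLL : L = L' := by
      have := congrArg Fin.val h1
      simp only [Fin.ofNat, Nat.mod_eq_of_lt (hlt hL).2, Nat.mod_eq_of_lt (hlt hL').2] at this
      exact (List.idxOf_inj (hlt hL).1).1 this
    have hmm : m = m' := by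
      funext f
      refine List.ext_getElem (by rw [hm f, hm' f]) fun i hi hi' => ?_
      exact congrFun (congrFun h3 f) ⟨i, by rw [← hm f]; exact hi⟩
    subst hLL hmm
    rfl
  refine ⟨Finite.of_injective g hg, (Nat.card_le_card_of_injective g hg).trans_eq ?_⟩
  rw [Nat.card_prod, Nat.card_prod, nmem, Nat.card_fin]

end Exec

/-- Pebble automata exploring all spaces with at most a given number of points. -/
theorem exists_automaton (n : ℕ) : ∃ (Q P : Type) (_ : Finite Q) (_ : Finite P) (δ : PAut Q P)
    (fin : Set Q) (q₀ : Q),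
    Nat.card Q ≤ (cD ^ n + 1) * (Nat.card Loc ^ n * nmem) ∧ Nat.card P ≤ n * (nblk + 1) ∧
    ∀ (X : Type) (_ : Fintype X) (act : Fin 3 → X → X), (∀ s x, act s (act s x) = x) →
      Transv act → Nat.card X < NN n → ∀ x : X,
      ∃ t ≤ 2 * ∏ i ∈ Finset.range n, slow i + 1, ∃ q ∈ fin,
        (δ.step act)^[t] ⟨q₀, x, fun _ => x⟩ = ⟨q, x, fun _ => x⟩ ∧
        (∀ t' < t, ((δ.step act)^[t'] ⟨q₀, x, fun _ => x⟩).q ∉ fin) ∧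
        ∀ y, ∃ t' ≤ t, ((δ.step act)^[t'] ⟨q₀, x, fun _ => x⟩).x = y := by
  obtain ⟨E, P, _, _, s, e, hE, hP, hs, h⟩ := exists_explore n
  obtain ⟨hf, hc⟩ := ctls_card s
  have hm : ∀ f : Reg, (zw 0 f).length = f.rs := fun f => by simp
  refine ⟨ctls s, P, hf, inferInstance, exec.restrict (ctls s), {q | q.1.1 = []},
    ⟨([s], e, zw 0), Or.inl (mem_stk s []), trivial, hm⟩,
    hc.trans (Nat.mul_le_mul (by omega) (Nat.mul_le_mul_right _ hE)), hP,
    fun X _ act hi ht hX x => ?_⟩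
  obtain ⟨t, ht', hEv⟩ := h 0 X inferInstance act hi ht (by rwa [zero_add]) x
  obtain ⟨T, hT, hrun, hvis⟩ := hEv.exe []
  simp only [zero_add] at ht'
  set c₀ : PCfg (ctls s) P X :=
    ⟨⟨([s], e, zw 0), Or.inl (mem_stk s []), trivial, hm⟩, x, fun _ => x⟩ with hc₀
  set stp := ((exec (P := P)).restrict (ctls s)).step act with hstp
  have hval : ∀ k, (stp^[k] c₀).val = (exec.step act)^[k] c₀.val :=
    fun k => PAut.val_iterate exec_mem_ctls act k c₀
  have hend : stp^[T] c₀ = ⟨⟨([], e, zw 0), Or.inr rfl, trivial, hm⟩, x, fun _ => x⟩ := by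
    have := (hval T).trans hrun
    simp only [PCfg.val, St.cfg, PCfg.mk.injEq] at this
    exact PCfg.ext (Subtype.ext this.1) this.2.1 this.2.2
  have hstay : ∀ c : PCfg (ctls s) P X, c.q.1.1 = [] → stp c = c := by
    rintro ⟨⟨⟨L, e, m⟩, hq⟩, x, p⟩ h
    obtain rfl : L = [] := h
    have hq' : (([], e, m) : Ctl E P) ∈ ctls s := hq
    simp [hstp, PAut.step, PAut.restrict, exec, hq']
  have hex : ∃ k, (stp^[k] c₀).q.1.1 = [] := ⟨T, by rw [hend]⟩
  have hle : Nat.find hex ≤ T := Nat.find_min' hex (by rw [hend])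
  have hlast : ∀ k, Nat.find hex ≤ k → stp^[k] c₀ = stp^[Nat.find hex] c₀ := by
    intro k hk
    induction k, hk using Nat.le_induction with
    | base => rfl
    | succ k hk ih =>
      rw [Function.iterate_succ_apply', ih, hstay _ (Nat.find_spec hex)]
  refine ⟨Nat.find hex, by omega, _, ?_, (hlast T hle).symm.trans hend, fun t' h => Nat.find_min hex h,
    fun y => ?_⟩
  · rfl
  · obtain ⟨m, hm, hy⟩ := hvis y trivial
    have hy' : (stp^[m] c₀).x = y := by
      rw [← hy]
      exact congrArg PCfg.x (hval m)
    rcases le_total m (Nat.find hex) with h | h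
    · exact ⟨m, h, hy'⟩
    · exact ⟨_, le_rfl, by rw [← hlast m h, hy']⟩

section Agents

variable {ι A V : Type}

/-- Configurations of agents with index set `ι` and states `A`: the state, the vertex and the
entry port of each agent. -/
@[ext] structure ACfg (ι A V : Type) where
  st : ι → A
  dt : ι → V × ℕ

/-- Agent programs; the vector of visible states includes the state of the agent itself. -/
abbrev AProg (ι A : Type) := ι → (ι → Option A) → ℕ → ℕ → A × Option ℕ

/-- The result of leaving the vertex `x.1` through a port. -/
def PGraph.leave (G : PGraph V) (x : V × ℕ) (l : ℕ) : V × ℕ :=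
  if l < G.deg x.1 then (G.nbr x.1 l, G.back x.1 l) else x

/-- One action of an agent. -/
def AProg.out (τ : AProg ι A) (G : PGraph V) (c : ACfg ι A V) (i : ι) : A × Option ℕ :=
  τ i (fun j => if (c.dt j).1 = (c.dt i).1 then some (c.st j) else none)
    (G.deg (c.dt i).1) (c.dt i).2

/-- One synchronous step; agents in a state in `H` have halted. -/
def AProg.step (τ : AProg ι A) (H : Set A) (G : PGraph V) (c : ACfg ι A V) : ACfg ι A V where
  st := fun i => if c.st i ∈ H then c.st i else (τ.out G c i).1
  dt := fun i => if c.st i ∈ H then c.dt i else (τ.out G c i).2.elim (c.dt i) (G.leave (c.dt i))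

/-- The agent system of an agent program. -/
def AProg.toSys {N k : ℕ} (τ : AProg ι A) (H : Set A) (a₀ : ι → A) (e : Fin k ≃ ι)
    (ε : A ≃ Fin N) : MAgentSys k (fun _ => N) where
  start := fun i => ε (a₀ (e i))
  halt := fun _ => Finset.univ.filter fun a => ε.symm a ∈ H
  trans := fun i s vis d l =>
    let r := τ (e i) (fun j => if j = e i then some (ε.symm s) else (vis (e.symm j)).map ε.symm) d l
    (ε r.1, r.2)

/-- The configuration of an agent system corresponding to a configuration of agents. -/
def ACfg.toM {N k : ℕ} (c : ACfg ι A V) (e : Fin k ≃ ι) (ε : A ≃ Fin N) :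
    MConfig V k (fun _ => N) where
  st := fun i => ε (c.st (e i))
  pos := fun i => (c.dt (e i)).1
  lab := fun i => (c.dt (e i)).2

lemma AProg.mStep_toM {N k : ℕ} (τ : AProg ι A) (H : Set A) (a₀ : ι → A) (e : Fin k ≃ ι)
    (ε : A ≃ Fin N) (G : PGraph V) (c : ACfg ι A V) :
    mStep (τ.toSys H a₀ e ε) G (c.toM e ε) = (τ.step H G c).toM e ε := by
  have hout : ∀ i, mOut (τ.toSys H a₀ e ε) G (c.toM e ε) i =
      (ε (τ.out G c (e i)).1, (τ.out G c (e i)).2) := by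
    intro i
    have : (fun j => if j = e i then some (ε.symm ((c.toM e ε).st i)) else
        (mVis (c.toM e ε) i (e.symm j)).map ε.symm) =
        fun j => if (c.dt j).1 = (c.dt (e i)).1 then some (c.st j) else none := by
      funext j
      by_cases hj : j = e i
      · subst hj; simp [ACfg.toM]
      · have : e.symm j ≠ i := fun h => hj (by rw [← h, e.apply_symm_apply])
        simp only [hj, if_false, mVis, this, ACfg.toM, e.apply_symm_apply]
        split_ifs <;> simp
    simp only [mOut, AProg.toSys, this]
    rfl
  have hh : ∀ i, (c.toM e ε).st i ∈ (τ.toSys H a₀ e ε).halt i ↔ c.st (e i) ∈ H := by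
    intro i
    simp [AProg.toSys, ACfg.toM]
  simp only [mStep, hout, hh]
  simp only [ACfg.toM, AProg.step, MConfig.mk.injEq]
  refine ⟨?_, ?_, ?_⟩ <;> funext i <;> split_ifs <;> try rfl
  all_goals
    rcases (τ.out G c (e i)).2 with _ | l
    · rfl
    · by_cases hl : l < G.deg (c.dt (e i)).1 <;> simp [PGraph.leave, hl]

lemma AProg.mRun_toM {N k : ℕ} (τ : AProg ι A) (H : Set A) (a₀ : ι → A) (e : Fin k ≃ ι)
    (ε : A ≃ Fin N) (G : PGraph V) (v : V) (t : ℕ) :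
    mRun (τ.toSys H a₀ e ε) G v t = ((τ.step H G)^[t] ⟨a₀, fun _ => (v, 0)⟩).toM e ε := by
  induction t with
  | zero => rfl
  | succ t ih =>
    rw [Function.iterate_succ_apply', ← AProg.mStep_toM τ H a₀, ← ih, mRun, mRun,
      Function.iterate_succ_apply']

end Agents

section Darts

variable {V : Type} {G : PGraph V}

/-- Pairs of a vertex and a port at it. -/
abbrev PGraph.Dart (G : PGraph V) := {x : V × ℕ // x.2 < G.deg x.1}

/-- Two involutions generating all cyclic shifts of `0, …, d - 1`. -/
def portRefl (s : Fin 3) (d l : ℕ) : ℕ := if s = 1 then d - 1 - l else (d - l) % d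

lemma portRefl_lt {s : Fin 3} {d l : ℕ} (h : l < d) : portRefl s d l < d := by
  unfold portRefl
  split_ifs
  · omega
  · exact Nat.mod_lt _ (by omega)

lemma portRefl_portRefl {s : Fin 3} {d l : ℕ} (h : l < d) : portRefl s d (portRefl s d l) = l := by
  unfold portRefl
  split_ifs
  · omega
  · rcases Nat.eq_zero_or_pos l with rfl | hl
    · simp
    · rw [Nat.mod_eq_of_lt (by omega : d - l < d), Nat.sub_sub_self h.le, Nat.mod_eq_of_lt h]

/-- The three involutions on darts: crossing an edge and two reflections of the ports. -/
def PGraph.Wf.act (h : G.Wf) (s : Fin 3) (x : G.Dart) : G.Dart :=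
  if s = 0 then ⟨(G.nbr x.1.1 x.1.2, G.back x.1.1 x.1.2), h.2.1 _ _ x.2⟩
  else ⟨(x.1.1, portRefl s (G.deg x.1.1) x.1.2), portRefl_lt x.2⟩

lemma PGraph.Wf.act_act (h : G.Wf) (s : Fin 3) (x : G.Dart) : h.act s (h.act s x) = x := by
  by_cases hs : s = 0
  · simp only [act, hs, if_true]
    exact Subtype.ext (Prod.ext (h.2.2.1 _ _ x.2) (h.2.2.2.1 _ _ x.2))
  · simp only [act, hs, if_false, portRefl_portRefl x.2]

lemma PGraph.Wf.dart_eq_iff (h : G.Wf) (x y : G.Dart) :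
    x = y ↔ x.1.1 = y.1.1 ∧ (h.act 0 x).1.1 = (h.act 0 y).1.1 := by
  refine ⟨fun h => h ▸ ⟨rfl, rfl⟩, ?_⟩
  obtain ⟨⟨v, i⟩, hx⟩ := x
  obtain ⟨⟨w, j⟩, hy⟩ := y
  rintro ⟨rfl : v = w, h2 : G.nbr v i = G.nbr v j⟩
  have := h.2.2.2.2.2 v hx hy h2
  subst this
  rfl

lemma PGraph.Wf.leave_eq (h : G.Wf) (x : G.Dart) : G.leave x.1 x.1.2 = (h.act 0 x).1 := by
  simp only [leave, if_pos x.2]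
  rfl

lemma PGraph.Wf.leave_portRefl (h : G.Wf) (x : G.Dart) {s : Fin 3} (hs : s ≠ 0) :
    G.leave x.1 (portRefl s (G.deg x.1.1) x.1.2) = (h.act 0 (h.act s x)).1 := by
  simp only [leave, if_pos (portRefl_lt x.2), act, if_neg hs]
  rfl

lemma PGraph.Wf.transv (h : G.Wf) (hc : G.Conn) : Transv h.act := by
  have hsymm : ∀ x y, Relation.ReflTransGen (fun u v => ∃ s, h.act s u = v) x y →
      Relation.ReflTransGen (fun u v => ∃ s, h.act s u = v) y x :=
    fun x y hxy => by
      induction hxy with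
      | refl => exact .refl
      | @tail b c _ hbc ih =>
        obtain ⟨s, rfl⟩ := hbc
        exact .head ⟨s, h.act_act s b⟩ ih
  have hzero : ∀ (v : V) (i : ℕ) (hi : i < G.deg v),
      Relation.ReflTransGen (fun u v => ∃ s, h.act s u = v) ⟨(v, i), hi⟩ ⟨(v, 0), h.1 v⟩ := by
    intro v i
    induction i with
    | zero => exact fun _ => .refl
    | succ i ih =>
      intro hi
      refine .head ⟨2, rfl⟩ (.head ⟨1, rfl⟩ ?_)
      convert ih (by omega) using 1
      refine Subtype.ext (Prod.ext rfl ?_)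
      have : (G.deg v - (i + 1)) % G.deg v = G.deg v - (i + 1) := Nat.mod_eq_of_lt (by omega)
      simp [act, portRefl, this]
      omega
  have hv : ∀ v w : V, Relation.ReflTransGen (fun u v => ∃ s, h.act s u = v)
      (⟨(v, 0), h.1 v⟩ : G.Dart) ⟨(w, 0), h.1 w⟩ := by
    intro v w
    have := hc v w
    induction this with
    | refl => exact .refl
    | @tail b c _ hbc ih =>
      obtain ⟨i, hi, rfl⟩ := hbc
      refine ih.trans ((hsymm _ _ (hzero b i hi)).trans ?_)
      exact .head ⟨0, rfl⟩ (hzero _ _ _)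
  rintro ⟨⟨v, i⟩, hi⟩ ⟨⟨w, j⟩, hj⟩
  exact (hzero v i hi).trans ((hv v w).trans (hsymm _ _ (hzero w j hj)))

lemma PGraph.Wf.card_dart {m : ℕ} {G : PGraph (Fin m)} (h : G.Wf) :
    Finite G.Dart ∧ Nat.card G.Dart ≤ m * m := by
  let g : G.Dart → Fin m × Fin m := fun x => (x.1.1, (h.act 0 x).1.1)
  have hg : Function.Injective g := fun x y hxy =>
    (h.dart_eq_iff x y).2 (Prod.ext_iff.1 hxy)
  refine ⟨Finite.of_injective g hg, (Nat.card_le_card_of_injective g hg).trans_eq ?_⟩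
  rw [Nat.card_prod, Nat.card_fin]

end Darts

section Simulation

variable {Q P : Type} {κ N : ℕ}

/-- States of the agents simulating a pebble automaton: a phase, a letter of the code of the
control state and a flag; `none` is the halting state. -/
abbrev SimSt (N : ℕ) := Option (Fin 4 × Fin N × Bool)

/-- The control state of a pebble automaton, decoded from the visible agents. -/
def simQ [Nonempty Q] (code : Q → Fin (κ + 1) → Fin (N + 1))
    (vis : Fin (κ + 1) ⊕ P → Option (SimSt (N + 1))) : Q :=
  Function.invFun code fun c => (vis (.inl c)).join.elim 0 fun s => s.2.1

/-- The pebbles present at the current place, as observed from the visible agents. -/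
def simObs (vis : Fin (κ + 1) ⊕ P → Option (SimSt (N + 1))) (p : P) : Bool :=
  (vis (.inr p)).join.elim false fun s => s.2.2

/-- The involution applied to an agent. -/
def simMv (i : Fin (κ + 1) ⊕ P) (o : Option (Fin 3 × Set P)) : Option (Fin 3) :=
  o.bind fun o => if ∀ p, i = .inr p → p ∈ o.2 then some o.1 else none

/-- The agents simulating a pebble automaton. -/
def simProg [Nonempty Q] (δ : PAut Q P) (fin : Set Q) (code : Q → Fin (κ + 1) → Fin (N + 1)) :
    AProg (Fin (κ + 1) ⊕ P) (SimSt (N + 1)) := fun i vis d l =>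
  match vis i with
  | some (some (0, a, _)) => (some (1, a, false), some l)
  | some (some (1, a, _)) => (some (2, a, (vis (.inl 0)).isSome), some l)
  | some (some (2, a, b)) =>
    if (vis (.inl 0)).isSome ∧ b = true then
      if simQ code vis ∈ fin then (none, none)
      else
        let o := δ (simQ code vis) (simObs vis)
        let a' := i.elim (code o.1) fun _ => a
        match simMv i o.2 with
        | none => (some (3, a', false), none)
        | some s => if s = 0 then (some (3, a', false), some l)
            else (some (3, a', true), some (portRefl s d l))
    else (some (3, a, false), none)
  | some (some (3, a, b)) => (some (0, a, false), if b = true then some l else none)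
  | _ => (none, none)

variable {V : Type} {G : PGraph V}

/-- The letter stored by an agent. -/
def simLetter (code : Q → Fin (κ + 1) → Fin (N + 1)) (q : Q) (i : Fin (κ + 1) ⊕ P) :
    Fin (N + 1) := i.elim (code q) fun _ => 0

/-- The place of an agent in the simulation. -/
def PCfg.dart {X : Type} (c : PCfg Q P X) (i : Fin (κ + 1) ⊕ P) : X := i.elim (fun _ => c.x) c.pos

/-- The configuration of the agents simulating a configuration of a pebble automaton. -/
def simCfg (code : Q → Fin (κ + 1) → Fin (N + 1)) (c : PCfg Q P G.Dart) :
    ACfg (Fin (κ + 1) ⊕ P) (SimSt (N + 1)) V where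
  st := fun i => some (0, simLetter code c.q i, false)
  dt := fun i => (c.dart i).1

variable [Nonempty Q] (δ : PAut Q P) (fin : Set Q) {code : Q → Fin (κ + 1) → Fin (N + 1)}
  (h : G.Wf) (c : PCfg Q P G.Dart)

include h

lemma sim_step_zero : (simProg δ fin code).step {none} G (simCfg code c) =
    ⟨fun i => some (1, simLetter code c.q i, false), fun i => (h.act 0 (c.dart i)).1⟩ := by
  ext1 <;> funext i <;> simp [AProg.step, simCfg, AProg.out, simProg, h.leave_eq]

lemma sim_step_one : (simProg δ fin code).step {none} G
    ⟨fun i => some (1, simLetter code c.q i, false), fun i => (h.act 0 (c.dart i)).1⟩ =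
    ⟨fun i => some (2, simLetter code c.q i,
      decide ((h.act 0 c.x).1.1 = (h.act 0 (c.dart i)).1.1)), fun i => (c.dart i).1⟩ := by
  ext1 <;> funext i
  · by_cases hi : (h.act 0 c.x).1.1 = (h.act 0 (c.dart i)).1.1 <;>
      simp [AProg.step, AProg.out, simProg, PCfg.dart] <;> simp [PCfg.dart] at hi <;> simp [hi]
  · simp [AProg.step, AProg.out, simProg, h.leave_eq, h.act_act]

/-- The pebbles at the place of the automaton. -/
def PCfg.vis {X : Type} (c : PCfg Q P X) (p : P) : Bool := decide (c.pos p = c.x)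

/-- The involution applied to an agent in a step of the automaton. -/
def PAut.mv {X : Type} (δ : PAut Q P) (c : PCfg Q P X) (i : Fin (κ + 1) ⊕ P) : Option (Fin 3) :=
  if c.dart i = c.x then simMv i (δ c.q c.vis).2 else none

omit h [Nonempty Q] in
lemma PAut.step_eq {X : Type} (act : Fin 3 → X → X) (c : PCfg Q P X) : δ.step act c =
    ⟨(δ c.q c.vis).1, (δ c.q c.vis).2.elim c.x fun o => act o.1 c.x,
      fun p => (δ c.q c.vis).2.elim (c.pos p) fun o =>
        if p ∈ o.2 ∧ c.pos p = c.x then act o.1 c.x else c.pos p⟩ := rfl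

omit h [Nonempty Q] in
lemma PAut.dart_step {X : Type} (act : Fin 3 → X → X) (c : PCfg Q P X) (i : Fin (κ + 1) ⊕ P) :
    (δ.step act c).dart i = (δ.mv c i).elim (c.dart i) fun s => act s (c.dart i) := by
  rcases ho : (δ c.q c.vis).2 with _ | ⟨s, S⟩ <;> rcases i with i | p
  · simp [PCfg.dart, PAut.step_eq, PAut.mv, simMv, ho]
  · simp [PCfg.dart, PAut.step_eq, PAut.mv, simMv, ho]
  · simp [PCfg.dart, PAut.step_eq, PAut.mv, simMv, ho]
  · by_cases h1 : c.pos p = c.x <;> by_cases h2 : p ∈ S <;>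
      simp [PCfg.dart, PAut.step_eq, PAut.mv, simMv, ho, h1, h2]

omit [Nonempty Q] in
lemma sim_active (i : Fin (κ + 1) ⊕ P) : ((c.dart (κ := κ) (.inl 0)).1.1 = (c.dart i).1.1 ∧
    (h.act 0 c.x).1.1 = (h.act 0 (c.dart i)).1.1) ↔ c.dart i = c.x := by
  rw [eq_comm (a := c.dart i), h.dart_eq_iff]
  rfl

omit h in
lemma simQ_eq (hc : Function.Injective code) (b : Fin (κ + 1) ⊕ P → Bool) :
    simQ code (fun j => if (c.dart j).1.1 = c.x.1.1 then
      some (some (2, simLetter code c.q j, b j)) else none) = c.q := by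
  have : (fun i => code c.q i) = code c.q := rfl
  simp [simQ, PCfg.dart, simLetter, this, Function.leftInverse_invFun hc c.q]

omit [Nonempty Q] in
lemma simObs_eq : simObs (fun j : Fin (κ + 1) ⊕ P => if (c.dart j).1.1 = c.x.1.1 then
      some (some (2, simLetter code c.q j,
        decide ((h.act 0 c.x).1.1 = (h.act 0 (c.dart j)).1.1))) else none) =
    c.vis := by
  funext p
  have := h.dart_eq_iff (c.pos p) c.x
  by_cases h1 : (c.pos p).1.1 = c.x.1.1 <;>
    simp [simObs, PCfg.dart, PCfg.vis, h1, this, eq_comm (a := (h.act 0 c.x).1.1)]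

lemma sim_step_two (hc : Function.Injective code) (hq : c.q ∉ fin) :
    (simProg δ fin code).step {none} G
    ⟨fun i => some (2, simLetter code c.q i,
      decide ((h.act 0 c.x).1.1 = (h.act 0 (c.dart i)).1.1)), fun i => (c.dart i).1⟩ =
    ⟨fun i => some (3, simLetter code (δ.step h.act c).q i,
        (δ.mv c i).elim false fun s => decide (s ≠ 0)),
      fun i => ((δ.mv c i).elim (c.dart i) fun s =>
        if s = 0 then h.act 0 (c.dart i) else h.act 0 (h.act s (c.dart i))).1⟩ := by
  have key : ∀ i, (simProg δ fin code).out G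
      ⟨fun i => some (2, simLetter code c.q i,
        decide ((h.act 0 c.x).1.1 = (h.act 0 (c.dart i)).1.1)), fun i => (c.dart i).1⟩ i =
      (some (3, simLetter code (δ.step h.act c).q i,
        (δ.mv c i).elim false fun s => decide (s ≠ 0)),
        (δ.mv c i).map fun s => if s = 0 then (c.dart i).1.2 else
          portRefl s (G.deg (c.dart i).1.1) (c.dart i).1.2) := by
    intro i
    have ha := sim_active h c i
    by_cases hi : c.dart i = c.x
    · have h1 := simQ_eq (V := V) c hc fun j =>
        decide ((h.act 0 c.x).1.1 = (h.act 0 (c.dart j)).1.1)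
      have h2 := simObs_eq (code := code) h c
      have hl : ∀ q', Sum.elim (code q') (fun _ => simLetter code c.q i) i =
          simLetter code q' i := fun q' => by rcases i with i | p <;> rfl
      rw [hi] at ha ⊢
      simp only [iff_true] at ha
      simp only [AProg.out, hi, simProg, if_true, h1, h2, hq, if_false, PAut.mv, hl]
      rcases hs : simMv i (δ c.q c.vis).2 with _ | s
      · simp [ha.1, PAut.step_eq]
      · by_cases h0 : s = 0 <;> simp [ha.1, PAut.step_eq, h0]
    · have hl : simLetter code c.q i = simLetter code (δ.step h.act c).q i := by
        rcases i with i | p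
        · exact absurd rfl hi
        · rfl
      simp only [hi, iff_false] at ha
      simp only [AProg.out, simProg, if_true, PAut.mv, hi, if_false, ← hl]
      rw [if_neg]
      · rfl
      · refine fun h' => ha ⟨?_, by simpa using h'.2⟩
        by_contra hne
        simp [hne] at h'
  ext1 <;> funext i
  · simp [AProg.step, key]
  · simp only [AProg.step, key, Set.mem_singleton_iff, reduceCtorEq, if_false]
    rcases δ.mv c i with _ | s
    · rfl
    · by_cases h0 : s = 0
      · simp [h0, h.leave_eq]
      · simp [h0, h.leave_portRefl _ h0]

lemma sim_step_three :
    (simProg δ fin code).step {none} G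
    ⟨fun i => some (3, simLetter code (δ.step h.act c).q i,
        (δ.mv c i).elim false fun s => decide (s ≠ 0)),
      fun i => ((δ.mv c i).elim (c.dart i) fun s =>
        if s = 0 then h.act 0 (c.dart i) else h.act 0 (h.act s (c.dart i))).1⟩ =
    simCfg code (δ.step h.act c) := by
  ext1 <;> funext i
  · simp [AProg.step, AProg.out, simProg, simCfg]
  · simp only [simCfg, δ.dart_step]
    rcases hm : δ.mv c i with _ | s
    · simp [AProg.step, AProg.out, simProg, hm]
    · by_cases h0 : s = 0 <;> simp [AProg.step, AProg.out, simProg, hm, h0, h.leave_eq, h.act_act]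

lemma sim_halt (hc : Function.Injective code) (hq : c.q ∈ fin) (hp : ∀ p, c.pos p = c.x) :
    (simProg δ fin code).step {none} G
    ⟨fun i => some (2, simLetter code c.q i,
      decide ((h.act 0 c.x).1.1 = (h.act 0 (c.dart i)).1.1)), fun i => (c.dart i).1⟩ =
    ⟨fun _ => none, fun _ => c.x.1⟩ := by
  have hd : ∀ i : Fin (κ + 1) ⊕ P, c.dart i = c.x := fun i => by
    rcases i with i | p
    · rfl
    · exact hp p
  have h1 := simQ_eq (V := V) c hc fun j =>
    decide ((h.act 0 c.x).1.1 = (h.act 0 (c.dart j)).1.1)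
  simp only [hd] at h1
  ext1 <;> funext i <;> simp [AProg.step, AProg.out, simProg, hd] <;>
    simp at h1 <;> simp [h1, hq]

end Simulation

section Run

variable {Q P V : Type} {κ N : ℕ} {G : PGraph V} [Nonempty Q] (δ : PAut Q P) (fin : Set Q)
  {code : Q → Fin (κ + 1) → Fin (N + 1)}

lemma sim_iterate (h : G.Wf) (hc : Function.Injective code) (c : PCfg Q P G.Dart) (T : ℕ)
    (hq : ∀ t < T, ((δ.step h.act)^[t] c).q ∉ fin) :
    ((simProg δ fin code).step {none} G)^[4 * T] (simCfg code c) =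
      simCfg code ((δ.step h.act)^[T] c) := by
  induction T with
  | zero => rfl
  | succ T ih =>
    rw [show 4 * (T + 1) = 4 + 4 * T by ring, Function.iterate_add_apply,
      ih fun t ht => hq t (by omega), Function.iterate_succ_apply']
    simp only [Function.iterate_succ_apply', Function.iterate_zero, id_eq, sim_step_zero δ fin h,
      sim_step_one δ fin h, sim_step_two δ fin h _ hc (hq T (by omega)), sim_step_three δ fin h]

/-- A pebble automaton is simulated by agents with constant memory. -/
theorem exists_sim [Finite P] (q₀ : Q) (hc : Function.Injective code) :
    ∃ Sys : MAgentSys (κ + 1 + Nat.card P) fun _ => 8 * (N + 1) + 1,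
      ∀ (m : ℕ) (G : PGraph (Fin m)) (h : G.Wf) (v : Fin m) (T : ℕ) (q : Q),
        q ∈ fin →
        (δ.step h.act)^[T] ⟨q₀, ⟨(v, 0), h.1 v⟩, fun _ => ⟨(v, 0), h.1 v⟩⟩ =
          ⟨q, ⟨(v, 0), h.1 v⟩, fun _ => ⟨(v, 0), h.1 v⟩⟩ →
        (∀ t < T,
          ((δ.step h.act)^[t] ⟨q₀, ⟨(v, 0), h.1 v⟩, fun _ => ⟨(v, 0), h.1 v⟩⟩).q ∉ fin) →
        (∀ y, ∃ t ≤ T,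
          ((δ.step h.act)^[t] ⟨q₀, ⟨(v, 0), h.1 v⟩, fun _ => ⟨(v, 0), h.1 v⟩⟩).x = y) →
        (∀ i, (mRun Sys G v (4 * T + 3)).st i ∈ Sys.halt i) ∧
        (∀ i, (mRun Sys G v (4 * T + 3)).pos i = v) ∧
        ∀ w, ∃ t ≤ 4 * T + 3, ∃ i, (mRun Sys G v t).pos i = w := by
  let e : Fin (κ + 1 + Nat.card P) ≃ Fin (κ + 1) ⊕ P :=
    finSumFinEquiv.symm.trans (Equiv.sumCongr (Equiv.refl _) (Finite.equivFin P).symm)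
  let ε : SimSt (N + 1) ≃ Fin (8 * (N + 1) + 1) :=
    Fintype.equivFinOfCardEq (by simp; ring)
  refine ⟨(simProg δ fin code).toSys {none} (fun i => some (0, simLetter code q₀ i, false)) e ε,
    fun m G h v T q hq hT hnot hvis => ?_⟩
  set c₀ : PCfg Q P G.Dart := ⟨q₀, ⟨(v, 0), h.1 v⟩, fun _ => ⟨(v, 0), h.1 v⟩⟩
  have hini : (⟨fun i => some (0, simLetter code q₀ i, false), fun _ => (v, 0)⟩ :
      ACfg (Fin (κ + 1) ⊕ P) (SimSt (N + 1)) (Fin m)) = simCfg code c₀ := by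
    ext1 <;> funext i <;> rcases i with i | i <;> rfl
  have hit := fun t ht => sim_iterate δ fin h hc c₀ t (ht : ∀ t' < t, _)
  have hend : ((simProg δ fin code).step {none} G)^[4 * T + 3] (simCfg code c₀) =
      ⟨fun _ => none, fun _ => (v, 0)⟩ := by
    rw [add_comm (4 * T), Function.iterate_add_apply, hit T hnot, hT]
    simp only [Function.iterate_succ_apply', Function.iterate_zero, id_eq]
    rw [sim_step_zero δ fin h, sim_step_one δ fin h, sim_halt δ fin h _ hc hq fun _ => rfl]
  simp only [AProg.mRun_toM, hini, hend]
  refine ⟨fun i => ?_, fun i => rfl, fun w => ?_⟩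
  · simp [AProg.toSys, ACfg.toM]
  · obtain ⟨t, ht, hx⟩ := hvis ⟨(w, 0), h.1 w⟩
    refine ⟨4 * t, by omega, e.symm (.inl 0), ?_⟩
    rw [hit t fun t' ht' => hnot t' (by omega)]
    simp [ACfg.toM, simCfg, PCfg.dart, hx]

end Run

lemma prod_slow_le (R : ℕ) :
    ∏ i ∈ Finset.range R, slow i ≤ kap ^ ((2 * c2 + 1) * cD * 2 ^ R) := by
  have hk := four_le_kap
  have hs : ∀ i, slow i ≤ kap ^ ((2 * c2 + 1) * cD * 2 ^ i) := by
    intro i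
    have h1 : 1 ≤ MM i := Nat.one_le_pow _ _ (by omega)
    calc slow i = (MM i + 3) ^ cD := by unfold slow; rfl
      _ ≤ (MM i * kap) ^ cD := Nat.pow_le_pow_left (by nlinarith) _
      _ = kap ^ ((2 * c2 * 2 ^ i + 1) * cD) := by rw [MM, ← pow_succ, ← pow_mul]
      _ ≤ _ := Nat.pow_le_pow_right (by omega) (by
          have := Nat.mul_le_mul_right cD
            (Nat.add_le_add_left (Nat.one_le_two_pow (n := i)) (2 * c2 * 2 ^ i))
          calc _ ≤ _ := this
            _ = _ := by ring)
  induction R with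
  | zero => simpa using Nat.one_le_pow _ _ (by omega)
  | succ R ih =>
    rw [Finset.prod_range_succ, pow_succ 2 R, mul_two, mul_add, pow_add kap]
    exact Nat.mul_le_mul ih (hs R)

lemma lt_NN {n m : ℕ} (h : m ≤ n) : m * m < NN (Nat.log 2 (Nat.log 2 n) + 3) := by
  have h1 := Nat.lt_pow_succ_log_self one_lt_two n
  have h2 := Nat.lt_pow_succ_log_self one_lt_two (Nat.log 2 n)
  have hk := four_le_kap
  calc m * m < 2 ^ (Nat.log 2 n).succ * 2 ^ (Nat.log 2 n).succ := by gcongr <;> omega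
    _ = 4 ^ (Nat.log 2 n).succ := by rw [← mul_pow]; norm_num
    _ ≤ 4 ^ 2 ^ (Nat.log 2 (Nat.log 2 n)).succ := Nat.pow_le_pow_right (by omega) h2
    _ ≤ kap ^ 2 ^ (Nat.log 2 (Nat.log 2 n) + 2) := (Nat.pow_le_pow_left hk _).trans
        (Nat.pow_le_pow_right (by omega) (Nat.pow_le_pow_right (by omega) (by omega)))

lemma time_le {n T : ℕ} (hn : 2 ≤ n)
    (hT : T ≤ 2 * ∏ i ∈ Finset.range (Nat.log 2 (Nat.log 2 n) + 3), slow i + 1) :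
    4 * T + 3 ≤ n ^ (kap * ((2 * c2 + 1) * cD * 8) + 4) := by
  have hl : Nat.log 2 n ≠ 0 := (Nat.log_pos one_lt_two hn).ne'
  have hk := four_le_kap
  have h : ∏ i ∈ Finset.range (Nat.log 2 (Nat.log 2 n) + 3), slow i ≤
      n ^ (kap * ((2 * c2 + 1) * cD * 8)) :=
    calc _ ≤ kap ^ ((2 * c2 + 1) * cD * 2 ^ (Nat.log 2 (Nat.log 2 n) + 3)) := prod_slow_le _
      _ ≤ kap ^ ((2 * c2 + 1) * cD * 8 * Nat.log 2 n) := Nat.pow_le_pow_right (by omega) (by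
          rw [pow_add, mul_comm (2 ^ _), ← mul_assoc]
          exact Nat.mul_le_mul_left _ (Nat.pow_log_le_self 2 hl))
      _ ≤ (2 ^ kap) ^ ((2 * c2 + 1) * cD * 8 * Nat.log 2 n) :=
          Nat.pow_le_pow_left Nat.lt_two_pow_self.le _
      _ = (2 ^ Nat.log 2 n) ^ (kap * ((2 * c2 + 1) * cD * 8)) := by
          rw [← pow_mul, ← pow_mul]; congr 1; ring
      _ ≤ _ := Nat.pow_le_pow_left (Nat.pow_log_le_self 2 (by omega)) _
  have h1 : 1 ≤ n ^ (kap * ((2 * c2 + 1) * cD * 8)) := Nat.one_le_pow _ _ (by omega)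
  have h16 : 2 ^ 4 ≤ n ^ 4 := Nat.pow_le_pow_left hn 4
  rw [pow_add]
  calc 4 * T + 3 ≤ n ^ (kap * ((2 * c2 + 1) * cD * 8)) * 2 ^ 4 := by
        generalize n ^ (kap * ((2 * c2 + 1) * cD * 8)) = z at *
        generalize ∏ i ∈ Finset.range (Nat.log 2 (Nat.log 2 n) + 3), slow i = y at *
        omega
    _ ≤ _ := Nat.mul_le_mul_left _ h16

lemma exists_code {Q : Type} [Finite Q] {R a b c N : ℕ}
    (h : Nat.card Q ≤ (a ^ R + 1) * (b ^ R * c)) (hN : N = (a + 2) * (b + 1) * (c + 1)) :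
    ∃ f : Q → Fin (R + 1) → Fin (N + 1), Function.Injective f := by
  have : Fintype Q := Fintype.ofFinite Q
  have h1 : a ^ R + 1 ≤ (a + 2) ^ (R + 1) := by
    have h2 := Nat.pow_le_pow_left (Nat.le_add_right a 2) R
    have h3 : 1 ≤ (a + 2) ^ R := Nat.one_le_pow _ _ (by omega)
    rw [pow_succ]
    nlinarith
  have h2 : b ^ R ≤ (b + 1) ^ (R + 1) :=
    (Nat.pow_le_pow_left (Nat.le_succ b) R).trans (Nat.pow_le_pow_right (by omega) (by omega))
  have h3 : c ≤ (c + 1) ^ (R + 1) := (Nat.le_succ c).trans (Nat.le_self_pow (by omega) _)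
  have h4 : Fintype.card Q ≤ Fintype.card (Fin (R + 1) → Fin (N + 1)) := by
    rw [← Nat.card_eq_fintype_card, Fintype.card_fun, Fintype.card_fin, Fintype.card_fin]
    calc _ ≤ _ := h
      _ ≤ (a + 2) ^ (R + 1) * ((b + 1) ^ (R + 1) * (c + 1) ^ (R + 1)) := by gcongr
      _ = ((a + 2) * (b + 1) * (c + 1)) ^ (R + 1) := by rw [← mul_assoc, mul_pow, mul_pow]
      _ = N ^ (R + 1) := by rw [hN]
      _ ≤ _ := Nat.pow_le_pow_left (by omega) _
  obtain ⟨f⟩ := Function.Embedding.nonempty_of_card_le h4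
  exact ⟨f, f.injective⟩

/-- There is a constant `C` such that for every `n` there is a
set of at most `C·log log n` collaborating agents, each with at most `C` states
(constant memory each), that explores every connected graph on at most `n`
vertices within `n ^ C` steps, with all agents terminating at the starting
vertex.  (The agents are not given `n`: the same system works for all graphs on
at most `n` vertices.) -/
theorem explore_loglog_agents_constant_memory :
    ∃ C : ℕ, 0 < C ∧ ∀ n : ℕ, 1 ≤ n →
      ∃ (k : ℕ) (sz : Fin k → ℕ) (Sys : MAgentSys k sz),
        k ≤ C * (Nat.log 2 (Nat.log 2 n) + 1) ∧
        (∀ i, sz i ≤ C) ∧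
        ∀ m : ℕ, 0 < m → m ≤ n → ∀ G : PGraph (Fin m), G.Wf → G.Conn →
          ∀ v0 : Fin m, ∃ t ≤ n ^ C,
            (∀ i, (mRun Sys G v0 t).st i ∈ Sys.halt i) ∧
            (∀ i, (mRun Sys G v0 t).pos i = v0) ∧
            (∀ w : Fin m, ∃ t' ≤ t, ∃ i, (mRun Sys G v0 t').pos i = w) := by
  obtain ⟨K, hK⟩ : ∃ K, K = kap * ((2 * c2 + 1) * cD * 8) + 4 := ⟨_, rfl⟩
  obtain ⟨N, hN⟩ : ∃ N, N = (cD + 2) * (Nat.card Loc + 1) * (nmem + 1) := ⟨_, rfl⟩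
  obtain ⟨D, hD⟩ : ∃ D, D = 4 + 3 * (nblk + 1) := ⟨_, rfl⟩
  refine ⟨K + (8 * (N + 1) + 1) + D, by positivity, fun n hn => ?_⟩
  obtain ⟨Q, P, _, _, δ, fin, q₀, hQ, hP, H⟩ := exists_automaton (Nat.log 2 (Nat.log 2 n) + 3)
  obtain ⟨code, hc⟩ := exists_code hQ hN
  have : Nonempty Q := ⟨q₀⟩
  obtain ⟨Sys, hSys⟩ := exists_sim δ fin q₀ hc
  refine ⟨_, _, Sys, ?_, fun _ => (Nat.le_add_left _ K).trans (Nat.le_add_right _ D), fun m hm hmn G hG hC v => ?_⟩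
  · refine le_trans ?_ (Nat.mul_le_mul_right _ (Nat.le_add_left D _))
    refine (Nat.add_le_add_left hP _).trans ?_
    rw [hD]
    generalize Nat.log 2 (Nat.log 2 n) = L
    generalize nblk = b
    nlinarith [Nat.zero_le (L * b)]
  · have hm2 : 2 ≤ m := by
      by_contra hlt
      obtain rfl : m = 1 := by omega
      exact hG.2.2.2.2.1 v 0 (hG.1 v) (Subsingleton.elim _ _)
    obtain ⟨hf, hcard⟩ := hG.card_dart
    obtain ⟨T, hT, q, hq, hrun, hnot, hvis⟩ := H G.Dart (Fintype.ofFinite _) hG.act hG.act_act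
      (hG.transv hC) (hcard.trans_lt (lt_NN hmn)) ⟨(v, 0), hG.1 v⟩
    exact ⟨4 * T + 3, (time_le (hm2.trans hmn) hT).trans
      (Nat.pow_le_pow_right hn
        (by rw [← hK, add_assoc]; exact Nat.le_add_right _ _)), hSys m G hG v T q hq hrun hnot hvis⟩
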